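/- arXiv:2312.09605 — 2 statements merged into one kernel-verified Lean document; each statement's English description precedes it below -/
import Mathlib

section
/- Fix one of the two signs ±. There exists a constant C > 0 such that for every pair (q̃, r̃) ∈ {(6,∞), (∞,2)}, every T > 0, every μ ∈ (0,1], every ε ∈ (0,1] and every Schwartz function f on ℝ, one has ‖ t ↦ e^{±(t/ε) ∂ₓ/√(1+μD²/3)} f ‖_{L^{q̃}(0,T; L^{r̃}(ℝ))} ≤ C (ε/μ)^{(1/3)(1/2 − 1/r̃)} ‖(1 + μD²)^{(5/6)(1/2 − 1/r̃)} f‖_{L²(ℝ)}, with the convention 1/∞ = 0. -/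
open MeasureTheory Real Complex
open scoped ENNReal

/-- One-dimensional Fourier transform with the convention
`f̂(ξ) = (2π)^{-1/2} ∫ e^{-i x ξ} f(x) dx`. -/
noncomputable def ft1 (f : ℝ → ℂ) (ξ : ℝ) : ℂ :=
  (((2 * π) ^ (-(1 : ℝ) / 2) : ℝ) : ℂ) * ∫ x : ℝ, Complex.exp (-Complex.I * (x * ξ : ℝ)) * f x

/-- One-dimensional Fourier multiplier `m(D) f (x) = (2π)^{-1/2} ∫ e^{i x ξ} m(ξ) f̂(ξ) dξ`. -/
noncomputable def fmult1 (m : ℝ → ℂ) (f : ℝ → ℂ) (x : ℝ) : ℂ :=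
  (((2 * π) ^ (-(1 : ℝ) / 2) : ℝ) : ℂ) *
    ∫ ξ : ℝ, Complex.exp (Complex.I * (x * ξ : ℝ)) * m ξ * ft1 f ξ

/-- Symbol `e^{σ i τ ξ (1 + μ ξ²/3)^{-1/2}}` of the free propagator
`e^{σ τ ∂ₓ/√(1+μD²/3)}` of the linearized 1D classical Boussinesq system (`σ = ±1`). -/
noncomputable def prop1 (σ τ μ : ℝ) (ξ : ℝ) : ℂ :=
  Complex.exp (Complex.I * ((σ * τ * ξ / Real.sqrt (1 + μ * ξ ^ 2 / 3) : ℝ) : ℂ))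

/-- `L^q` norm in time on `(0,T)` of an `ℝ≥0∞`-valued function (used for mixed
space-time norms `L^q(0,T;L^r)`), with the usual `essSup` convention for `q = ∞`. -/
noncomputable def timeLp (q : ℝ≥0∞) (T : ℝ) (g : ℝ → ℝ≥0∞) : ℝ≥0∞ :=
  if q = ⊤ then essSup g (MeasureTheory.volume.restrict (Set.Ioo 0 T))
  else (∫⁻ t in Set.Ioo 0 T, g t ^ q.toReal) ^ (1 / q.toReal)

section PartA
open scoped FourierTransform

lemma hasTG_expI : Function.HasTemperateGrowth (fun y : ℝ => Complex.exp (Complex.I * (y : ℂ))) := by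
  have key : ∀ n : ℕ, iteratedDeriv n (fun y : ℝ => Complex.exp (Complex.I * (y : ℂ))) =
      fun y : ℝ => Complex.I ^ n * Complex.exp (Complex.I * (y : ℂ)) := by
    intro n
    induction n with
    | zero => simp
    | succ n ih =>
      rw [iteratedDeriv_succ, ih]
      ext y
      have h1 : HasDerivAt (fun y : ℝ => Complex.exp (Complex.I * (y : ℂ)))
          (Complex.exp (Complex.I * (y : ℂ)) * (Complex.I * 1)) y :=
        ((Complex.ofRealCLM.hasDerivAt (x := y)).const_mul Complex.I).cexp
      have h2 := (h1.const_mul (Complex.I ^ n)).deriv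
      rw [h2]; ring
  refine ⟨?_, fun n => ⟨0, 1, fun x => ?_⟩⟩
  · exact (contDiff_const.mul Complex.ofRealCLM.contDiff).cexp
  · rw [norm_iteratedFDeriv_eq_norm_iteratedDeriv, key]
    simp [Complex.norm_exp]

lemma hasTG_weight (μ : ℝ) (hμ : 0 ≤ μ) (r : ℝ) :
    Function.HasTemperateGrowth (fun ξ : ℝ => (1 + μ * ξ ^ 2) ^ r) := by
  have h1 := Function.hasTemperateGrowth_one_add_norm_sq_rpow ℝ r
  have h2 : Function.HasTemperateGrowth (fun ξ : ℝ => √μ * ξ) := by fun_prop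
  have h3 := h1.comp h2
  have e : (fun ξ : ℝ => (1 + μ * ξ ^ 2) ^ r) =
      (fun x : ℝ => (1 + ‖x‖ ^ 2) ^ r) ∘ (fun ξ : ℝ => √μ * ξ) := by
    ext ξ
    simp [mul_pow, Real.sq_sqrt hμ]
  rw [e]; exact h3

lemma hasTG_prop (σ τ μ : ℝ) (hμ : 0 ≤ μ) :
    Function.HasTemperateGrowth (fun ξ : ℝ => prop1 σ τ μ ξ) := by
  have h1 := hasTG_weight (μ / 3) (by positivity) (-(1/2))
  have h2 : Function.HasTemperateGrowth (fun ξ : ℝ => σ * τ * ξ * (1 + μ / 3 * ξ ^ 2) ^ (-(1/2 : ℝ))) := by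
    fun_prop
  have h3 := hasTG_expI.comp h2
  convert h3 using 2 with ξ
  simp only [prop1, Function.comp]
  congr 3
  rw [Real.rpow_neg (by positivity), Real.sqrt_eq_rpow, div_eq_mul_inv]
  congr 4; ring

lemma two_pi_rpow_mul : ENNReal.ofReal ((2 * π) ^ (-(1 : ℝ) / 2)) *
    ENNReal.ofReal (2 * π) ^ (1 / 2 : ℝ) = 1 := by
  have : 0 < 2 * π := by positivity
  rw [ENNReal.ofReal_rpow_of_pos this, ← ENNReal.ofReal_mul (by positivity), ← Real.rpow_add this]
  norm_num

/-- `ft1 f` is a Schwartz function. -/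
lemma exists_schwartz_ft1 (f : SchwartzMap ℝ ℂ) : ∃ g : SchwartzMap ℝ ℂ, ∀ ξ, g ξ = ft1 f ξ := by
  have hp : (2 * π)⁻¹ ≠ 0 := by positivity
  refine ⟨(((2 * π) ^ (-(1 : ℝ) / 2) : ℝ) : ℂ) • SchwartzMap.compCLMOfContinuousLinearEquiv ℂ
    (ContinuousLinearEquiv.unitsEquivAut ℝ (Units.mk0 _ hp)) (𝓕 f), fun ξ => ?_⟩
  simp only [_root_.smul_apply, SchwartzMap.compCLMOfContinuousLinearEquiv_apply, ft1, smul_eq_mul,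
    Function.comp]
  congr 1
  rw [SchwartzMap.fourier_coe, Real.fourier_real_eq_integral_exp_smul]
  refine integral_congr_ae (Filter.Eventually.of_forall fun x => ?_)
  simp only [smul_eq_mul]
  congr 2
  simp only [ContinuousLinearEquiv.unitsEquivAut_apply, Units.val_mk0]
  have : (-2 * π * x * (ξ * (2 * π)⁻¹)) = -(x * ξ) := by field_simp
  rw [this]; push_cast; ring

lemma plancherel_aux (h : SchwartzMap ℝ ℂ) :
    eLpNorm (fun x : ℝ => (((2 * π) ^ (-(1 : ℝ) / 2) : ℝ) : ℂ) *
      ∫ ξ : ℝ, Complex.exp (Complex.I * (x * ξ : ℝ)) * h ξ) 2 volume = eLpNorm h 2 volume := by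
  have hp : (2 * π)⁻¹ ≠ 0 := by positivity
  have e1 : (fun x : ℝ => (((2 * π) ^ (-(1 : ℝ) / 2) : ℝ) : ℂ) *
      ∫ ξ : ℝ, Complex.exp (Complex.I * (x * ξ : ℝ)) * h ξ) =
      (((2 * π) ^ (-(1 : ℝ) / 2) : ℝ) : ℂ) • ((𝓕⁻ h : SchwartzMap ℝ ℂ) ∘ fun x => (2 * π)⁻¹ * x) := by
    ext x
    simp only [Pi.smul_apply, Function.comp, smul_eq_mul]
    congr 1
    rw [SchwartzMap.fourierInv_coe, Real.fourierInv_eq']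
    refine integral_congr_ae (Filter.Eventually.of_forall fun ξ => ?_)
    simp only [smul_eq_mul]
    congr 2
    have : (2 * π * inner ℝ ξ ((2 * π)⁻¹ * x)) = x * ξ := by
      simp; field_simp
    rw [this]; push_cast; ring
  rw [e1, eLpNorm_const_smul]
  have e2 : eLpNorm ((𝓕⁻ h : SchwartzMap ℝ ℂ) ∘ fun x => (2 * π)⁻¹ * x) 2 volume =
      ENNReal.ofReal (2 * π) ^ (1 / 2 : ℝ) * eLpNorm (𝓕⁻ h : SchwartzMap ℝ ℂ) 2 volume := by
    rw [← eLpNorm_map_measure (by exact (SchwartzMap.continuous _).aestronglyMeasurable) (by fun_prop),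
      Real.map_volume_mul_left hp, eLpNorm_smul_measure_of_ne_top (by simp)]
    simp [abs_of_pos Real.pi_pos]
  rw [e2, ← mul_assoc]
  have e3 : ‖(((2 * π) ^ (-(1 : ℝ) / 2) : ℝ) : ℂ)‖ₑ = ENNReal.ofReal ((2 * π) ^ (-(1 : ℝ) / 2)) := by
    rw [← ofReal_norm, Complex.norm_real, Real.norm_of_nonneg (by positivity)]
  rw [e3, two_pi_rpow_mul, one_mul]
  have e4 := SchwartzMap.norm_fourier_toL2_eq (𝓕⁻ h)
  rw [FourierTransform.fourier_fourierInv_eq, SchwartzMap.norm_toLp, SchwartzMap.norm_toLp] at e4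
  exact ((ENNReal.toReal_eq_toReal_iff' (SchwartzMap.memLp _ _ _).2.ne (SchwartzMap.memLp _ _ _).2.ne).1 e4).symm

lemma plancherel (m : ℝ → ℂ) (hm : Function.HasTemperateGrowth m) (f : SchwartzMap ℝ ℂ) :
    eLpNorm (fmult1 m f) 2 volume = eLpNorm (fun ξ => m ξ * ft1 f ξ) 2 volume := by
  obtain ⟨g, hg⟩ := exists_schwartz_ft1 f
  have := plancherel_aux (SchwartzMap.smulLeftCLM ℂ m g)
  rw [SchwartzMap.smulLeftCLM_apply hm] at this
  simp only [smul_eq_mul, hg, ← mul_assoc] at this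
  exact this

lemma case_two (σ τ μ : ℝ) (hμ : 0 ≤ μ) (f : SchwartzMap ℝ ℂ) :
    eLpNorm (fmult1 (fun ξ => prop1 σ τ μ ξ) f) 2 volume = eLpNorm (fmult1 (fun _ => 1) f) 2 volume := by
  rw [plancherel _ (hasTG_prop σ τ μ hμ), plancherel _ (by fun_prop)]
  refine eLpNorm_congr_norm_ae (Filter.Eventually.of_forall fun ξ => ?_)
  simp [prop1, Complex.norm_exp]

end PartA
section PartB

lemma lint_even (g : ℝ → ℝ≥0∞) : ∫⁻ r, g |r| = 2 * ∫⁻ r in Set.Ioi (0 : ℝ), g r := by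
  rw [← lintegral_add_compl (fun r => g |r|) (measurableSet_Ioi (a := (0 : ℝ))), two_mul]
  congr 1
  · exact setLIntegral_congr_fun measurableSet_Ioi fun r hr => by simp [abs_of_pos (Set.mem_Ioi.1 hr)]
  · rw [Set.compl_Ioi, setLIntegral_congr (Iio_ae_eq_Iic (a := (0 : ℝ))).symm]
    have h := (Measure.measurePreserving_neg (volume : Measure ℝ)).setLIntegral_comp_preimage_emb
      (Homeomorph.neg ℝ).measurableEmbedding g (Set.Ioi 0)
    rw [← h]
    have : Neg.neg ⁻¹' (Set.Ioi (0 : ℝ)) = Set.Iio 0 := by ext; simp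
    rw [this]
    exact setLIntegral_congr_fun measurableSet_Iio fun r hr => by simp [abs_of_neg (Set.mem_Iio.1 hr)]

/-- The HLS kernel `|r|^{-1/3}`. -/
noncomputable def kern (r : ℝ) : ℝ≥0∞ := ENNReal.ofReal |r| ^ (-(1 / 3) : ℝ)

lemma measurable_kern : Measurable kern := by unfold kern; fun_prop

lemma kern_near (R : ℝ) (hR : 0 < R) (t : ℝ) :
    ∫⁻ r, (Set.Iio R).indicator 1 |t - r| * kern (t - r) = ENNReal.ofReal (3 * R ^ (2 / 3 : ℝ)) := by
  rw [lintegral_sub_left_eq_self (fun r => (Set.Iio R).indicator 1 |r| * kern r) t]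
  unfold kern
  rw [lint_even (fun r => (Set.Iio R).indicator 1 r * ENNReal.ofReal r ^ (-(1 / 3) : ℝ))]
  have e : ∫⁻ r in Set.Ioi (0 : ℝ), (Set.Iio R).indicator 1 r * ENNReal.ofReal r ^ (-(1 / 3) : ℝ) =
      ∫⁻ r in Set.Ioc 0 R, ENNReal.ofReal (r ^ (-(1 / 3) : ℝ)) := by
    rw [setLIntegral_congr (Ioo_ae_eq_Ioc (a := (0 : ℝ)) (b := R)).symm, ← lintegral_indicator measurableSet_Ioi, ← lintegral_indicator measurableSet_Ioo]
    congr 1; ext r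
    by_cases h0 : 0 < r <;> by_cases h1 : r < R <;> simp [Set.indicator, h0, h1, ENNReal.ofReal_rpow_of_pos]
  rw [e, ← ofReal_integral_eq_lintegral_ofReal, ← intervalIntegral.integral_of_le hR.le,
    integral_rpow (by norm_num), ← ENNReal.ofReal_ofNat, ← ENNReal.ofReal_mul (by norm_num)]
  · congr 1
    rw [Real.zero_rpow (by norm_num), show (-(1 / 3) + 1 : ℝ) = 2 / 3 by norm_num]
    ring
  · exact (intervalIntegrable_iff_integrableOn_Ioc_of_le hR.le).1
      (intervalIntegral.intervalIntegrable_rpow' (by norm_num))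
  · filter_upwards [ae_restrict_mem measurableSet_Ioc] with r hr
    exact Real.rpow_nonneg hr.1.le _

lemma kern_far (R : ℝ) (hR : 0 < R) (t : ℝ) :
    ∫⁻ r, ((Set.Ici R).indicator 1 |t - r| * kern (t - r)) ^ (6 : ℝ) = ENNReal.ofReal (2 / R) := by
  rw [lintegral_sub_left_eq_self (fun r => ((Set.Ici R).indicator 1 |r| * kern r) ^ (6 : ℝ)) t]
  unfold kern
  rw [lint_even (fun r => ((Set.Ici R).indicator 1 r * ENNReal.ofReal r ^ (-(1 / 3) : ℝ)) ^ (6 : ℝ))]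
  have e : ∫⁻ r in Set.Ioi (0 : ℝ), ((Set.Ici R).indicator 1 r * ENNReal.ofReal r ^ (-(1 / 3) : ℝ)) ^ (6 : ℝ) =
      ∫⁻ r in Set.Ioi R, ENNReal.ofReal (r ^ (-2 : ℝ)) := by
    rw [setLIntegral_congr (Ioi_ae_eq_Ici (a := R)), ← lintegral_indicator measurableSet_Ioi, ← lintegral_indicator measurableSet_Ici]
    congr 1; ext r
    by_cases h1 : R ≤ r
    · have h0 : 0 < r := hR.trans_le h1
      simp only [Set.indicator, Set.mem_Ioi, h0, Set.mem_Ici, h1, if_true, Pi.one_apply, one_mul]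
      rw [← ENNReal.rpow_mul, ENNReal.ofReal_rpow_of_pos h0]; norm_num
    · simp [Set.indicator, h1]
  rw [e, ← ofReal_integral_eq_lintegral_ofReal,
    integral_Ioi_rpow_of_lt (by norm_num) hR, ← ENNReal.ofReal_ofNat, ← ENNReal.ofReal_mul (by norm_num)]
  · congr 1
    rw [show (-2 + 1 : ℝ) = -1 by norm_num, Real.rpow_neg_one]
    ring
  · exact integrableOn_Ioi_rpow_of_lt (by norm_num) hR
  · filter_upwards [ae_restrict_mem measurableSet_Ioi] with r hr
    exact Real.rpow_nonneg (hR.le.trans (Set.mem_Ioi.1 hr).le) _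

lemma hls_inner (F : ℝ → ℝ≥0∞) (hF : Measurable F) (a m : ℝ) (ha : 0 < a) (hm : 0 < m)
    (hA : ∫⁻ r, F r ^ (6 / 5 : ℝ) = ENNReal.ofReal a) (t : ℝ) :
    ∫⁻ r, min (F r) (ENNReal.ofReal m) * kern (t - r) ≤
      ENNReal.ofReal (5 * (a ^ (2 / 3 : ℝ) * m ^ (1 / 5 : ℝ))) := by
  set R : ℝ := a / m ^ (6 / 5 : ℝ) with hRdef
  have hR : 0 < R := by positivity
  have hk := measurable_kern
  have hi1 : Measurable fun r => (Set.Iio R).indicator (1 : ℝ → ℝ≥0∞) |t - r| :=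
    (measurable_one.indicator measurableSet_Iio).comp (by fun_prop)
  have hi2 : Measurable fun r => (Set.Ici R).indicator (1 : ℝ → ℝ≥0∞) |t - r| :=
    (measurable_one.indicator measurableSet_Ici).comp (by fun_prop)
  have hk' : Measurable fun r => kern (t - r) := hk.comp (by fun_prop)
  calc ∫⁻ r, min (F r) (ENNReal.ofReal m) * kern (t - r)
      ≤ ∫⁻ r, (ENNReal.ofReal m * ((Set.Iio R).indicator 1 |t - r| * kern (t - r)) +
          F r * ((Set.Ici R).indicator 1 |t - r| * kern (t - r))) := by
        refine lintegral_mono fun r => ?_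
        by_cases h : |t - r| < R
        · simp only [Set.indicator, Set.mem_Iio, h, if_true, Set.mem_Ici, not_le.2 h, if_false, Pi.one_apply, one_mul, zero_mul, mul_zero, add_zero]
          gcongr; exact min_le_right _ _
        · simp only [Set.indicator, Set.mem_Iio, h, if_true, Set.mem_Ici, not_lt.1 h, if_false, Pi.one_apply, one_mul, zero_mul, mul_zero, zero_add]
          gcongr; exact min_le_left _ _
    _ = ENNReal.ofReal m * ENNReal.ofReal (3 * R ^ (2 / 3 : ℝ)) +
          ∫⁻ r, F r * ((Set.Ici R).indicator 1 |t - r| * kern (t - r)) := by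
        rw [lintegral_add_left (by exact (hi1.mul hk').const_mul _), lintegral_const_mul _ (by exact hi1.mul hk'), kern_near R hR]
    _ ≤ ENNReal.ofReal m * ENNReal.ofReal (3 * R ^ (2 / 3 : ℝ)) +
          (ENNReal.ofReal a) ^ (1 / (6 / 5) : ℝ) * (ENNReal.ofReal (2 / R)) ^ (1 / 6 : ℝ) := by
        gcongr
        rw [← hA, ← kern_far R hR t]
        exact ENNReal.lintegral_mul_le_Lp_mul_Lq volume (by constructor <;> norm_num) hF.aemeasurable (hi2.mul hk').aemeasurable
    _ ≤ _ := by
        rw [ENNReal.ofReal_rpow_of_pos ha, ENNReal.ofReal_rpow_of_pos (by positivity), ← ENNReal.ofReal_mul hm.le,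
          ← ENNReal.ofReal_mul (by positivity), ← ENNReal.ofReal_add (by positivity) (by positivity)]
        refine ENNReal.ofReal_le_ofReal ?_
        have e1 : R ^ (2 / 3 : ℝ) = a ^ (2 / 3 : ℝ) * m ^ (-(4 / 5) : ℝ) := by
          rw [hRdef, Real.div_rpow ha.le (by positivity), ← Real.rpow_mul hm.le, Real.rpow_neg hm.le]
          norm_num [div_eq_mul_inv]
        have e2 : (2 / R) ^ (1 / 6 : ℝ) = 2 ^ (1 / 6 : ℝ) * (a ^ (-(1 / 6) : ℝ) * m ^ (1 / 5 : ℝ)) := by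
          rw [hRdef, div_div_eq_mul_div, Real.div_rpow (by positivity) ha.le, Real.mul_rpow (by norm_num) (by positivity),
            ← Real.rpow_mul hm.le, Real.rpow_neg ha.le]
          norm_num [div_eq_mul_inv]
          ring
        have e3 : m * m ^ (-(4 / 5) : ℝ) = m ^ (1 / 5 : ℝ) := by
          nth_rewrite 1 [← Real.rpow_one m]
          rw [← Real.rpow_add hm]; norm_num
        have e4 : a ^ (1 / (6 / 5) : ℝ) * a ^ (-(1 / 6) : ℝ) = a ^ (2 / 3 : ℝ) := by
          rw [← Real.rpow_add ha]; norm_num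
        have e5 : (2 : ℝ) ^ (1 / 6 : ℝ) ≤ 2 := by
          calc (2 : ℝ) ^ (1 / 6 : ℝ) ≤ 2 ^ (1 : ℝ) := Real.rpow_le_rpow_of_exponent_le (by norm_num) (by norm_num)
            _ = 2 := by norm_num
        rw [e1, e2]
        calc _ = 3 * (a ^ (2 / 3 : ℝ) * (m * m ^ (-(4 / 5) : ℝ))) +
              2 ^ (1 / 6 : ℝ) * ((a ^ (1 / (6 / 5) : ℝ) * a ^ (-(1 / 6) : ℝ)) * m ^ (1 / 5 : ℝ)) := by ring
          _ = (3 + 2 ^ (1 / 6 : ℝ)) * (a ^ (2 / 3 : ℝ) * m ^ (1 / 5 : ℝ)) := by rw [e3, e4]; ring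
          _ ≤ _ := by gcongr; linarith

/-- Hardy-Littlewood-Sobolev. -/
lemma hls (F : ℝ → ℝ≥0∞) (hF : Measurable F) (hfin : ∀ t, F t ≠ ⊤) :
    ∫⁻ t, ∫⁻ r, F t * F r * kern (t - r) ≤ 10 * (∫⁻ r, F r ^ (6 / 5 : ℝ)) ^ (5 / 3 : ℝ) := by
  have hk := measurable_kern
  set A := ∫⁻ r, F r ^ (6 / 5 : ℝ) with hA
  by_cases hAtop : A = ⊤
  · rw [hAtop]; simp
  by_cases hA0 : A = 0
  · have h0 : ∀ᵐ r, F r = 0 := by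
      have := (lintegral_eq_zero_iff (by fun_prop)).1 (hA ▸ hA0)
      filter_upwards [this] with r hr
      have h' : ¬ ((6 : ℝ) / 5 < 0) := by norm_num
      simpa [h'] using hr
    have : ∫⁻ t, ∫⁻ r, F t * F r * kern (t - r) = 0 := by
      rw [lintegral_eq_zero_iff' (by fun_prop)]
      filter_upwards [h0] with t ht
      simp [ht]
    rw [this]; exact zero_le
  have hmk : Measurable fun p : ℝ × ℝ => kern (p.1 - p.2) := hk.comp (by fun_prop)
  set a := A.toReal with ha
  have hapos : 0 < a := ENNReal.toReal_pos hA0 hAtop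
  have hAa : A = ENNReal.ofReal a := (ENNReal.ofReal_toReal hAtop).symm
  set G : ℝ → ℝ → ℝ≥0∞ := fun t r => F t * (min (F r) (F t) * kern (t - r)) with hG
  have hGm : Measurable (Function.uncurry G) := by
    simp only [hG, Function.uncurry_def]
    fun_prop
  have hGm2 : Measurable (Function.uncurry fun t r => G r t) := hGm.comp measurable_swap
  calc ∫⁻ t, ∫⁻ r, F t * F r * kern (t - r) ≤ ∫⁻ t, ∫⁻ r, (G t r + G r t) := by
        refine lintegral_mono fun t => lintegral_mono fun r => ?_
        have hs : kern (r - t) = kern (t - r) := by simp [kern, abs_sub_comm]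
        simp only [hG, hs]
        rcases le_total (F r) (F t) with h | h
        · rw [min_eq_left h, ← mul_assoc]; exact le_self_add
        · rw [min_eq_left h]
          exact (by rw [mul_comm (F t), mul_assoc] : F t * F r * kern (t - r) = F r * (F t * kern (t - r))).le.trans le_add_self
    _ = (∫⁻ t, ∫⁻ r, G t r) + ∫⁻ t, ∫⁻ r, G r t := by
        rw [← lintegral_add_left (by exact hGm.lintegral_prod_right')]
        refine lintegral_congr fun t => ?_
        rw [lintegral_add_left (by exact hGm.of_uncurry_left)]
    _ = 2 * ∫⁻ t, ∫⁻ r, G t r := by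
        rw [lintegral_lintegral_swap (f := fun t r => G r t) hGm2.aemeasurable, two_mul]
    _ ≤ 2 * ∫⁻ t, ENNReal.ofReal (5 * a ^ (2 / 3 : ℝ)) * F t ^ (6 / 5 : ℝ) := by
        gcongr with t
        by_cases h0 : F t = 0
        · simp [hG, h0]
        have hm : 0 < (F t).toReal := ENNReal.toReal_pos h0 (hfin t)
        have hFt : F t = ENNReal.ofReal (F t).toReal := (ENNReal.ofReal_toReal (hfin t)).symm
        simp only [hG]
        rw [lintegral_const_mul' _ _ (hfin t)]
        calc F t * ∫⁻ r, min (F r) (F t) * kern (t - r)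
            ≤ F t * ENNReal.ofReal (5 * (a ^ (2 / 3 : ℝ) * (F t).toReal ^ (1 / 5 : ℝ))) := by
              gcongr
              have := hls_inner F hF a _ hapos hm (hA ▸ hAa) t
              rwa [← hFt] at this
          _ = _ := by
              rw [hFt, ENNReal.toReal_ofReal hm.le, ENNReal.ofReal_rpow_of_pos hm, ← ENNReal.ofReal_mul hm.le, ← ENNReal.ofReal_mul (by positivity)]
              congr 1
              have : (F t).toReal ^ (6 / 5 : ℝ) = (F t).toReal * (F t).toReal ^ (1 / 5 : ℝ) := by
                nth_rewrite 2 [← Real.rpow_one (F t).toReal]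
                rw [← Real.rpow_add hm]; norm_num
              rw [this]; ring
    _ = _ := by
        rw [lintegral_const_mul _ (by fun_prop), ← hA, hAa, ENNReal.ofReal_rpow_of_pos hapos,
          ← ENNReal.ofReal_mul (by positivity)]
        have : a ^ (5 / 3 : ℝ) = a ^ (2 / 3 : ℝ) * a := by
          nth_rewrite 3 [← Real.rpow_one a]
          rw [← Real.rpow_add hapos]; norm_num
        rw [this, ← ENNReal.ofReal_ofNat, ← ENNReal.ofReal_ofNat, ← ENNReal.ofReal_mul (by norm_num), ← ENNReal.ofReal_mul (by norm_num)]
        congr 1; ring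

end PartB
section PartC

lemma vdc_first (ψ h h' w : ℝ → ℝ) (a b lam : ℝ) (hab : a ≤ b) (hlam : 0 < lam)
    (hψ : ∀ η, HasDerivAt ψ (h η * w η) η) (hh : ∀ η, HasDerivAt h (h' η) η)
    (hw : Continuous w) (hh' : Continuous h')
    (hmono : (∀ η ∈ Set.Icc a b, 0 ≤ h' η) ∨ (∀ η ∈ Set.Icc a b, h' η ≤ 0))
    (hlow : ∀ η ∈ Set.Icc a b, lam ≤ |h η|) :
    ‖∫ η in a..b, Complex.exp (Complex.I * (ψ η : ℂ)) * (w η : ℂ)‖ ≤ 4 / lam := by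
  have hu : Set.uIcc a b = Set.Icc a b := Set.uIcc_of_le hab
  have hne : ∀ η ∈ Set.Icc a b, h η ≠ 0 := fun η hη h0 => by
    have := hlow η hη; rw [h0, abs_zero] at this; linarith
  have hhc : Continuous h := continuous_iff_continuousAt.2 fun η => (hh η).continuousAt
  have hψc : Continuous ψ := continuous_iff_continuousAt.2 fun η => (hψ η).continuousAt
  -- E = e^{iψ}
  set E : ℝ → ℂ := fun η => Complex.exp (Complex.I * (ψ η : ℂ)) with hE
  have hEc : Continuous E := by fun_prop
  have hEn : ∀ η, ‖E η‖ = 1 := fun η => by simp [hE, Complex.norm_exp]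
  have hEd : ∀ η, HasDerivAt E (E η * (Complex.I * ((h η * w η : ℝ) : ℂ))) η := fun η =>
    ((hψ η).ofReal_comp.const_mul Complex.I).cexp
  -- v = 1/(i h)
  set v : ℝ → ℂ := fun η => -Complex.I * (((h η)⁻¹ : ℝ) : ℂ) with hv
  have hvd : ∀ η ∈ Set.uIcc a b, HasDerivAt v (-Complex.I * ((-(h' η) / (h η) ^ 2 : ℝ) : ℂ)) η := fun η hη =>
    ((hh η).inv (hne η (hu ▸ hη))).ofReal_comp.const_mul _
  have hc1 : ContinuousOn (fun η => -(h' η) / (h η) ^ 2) (Set.uIcc a b) := by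
    refine ContinuousOn.div (by fun_prop) (by fun_prop) fun η hη => pow_ne_zero _ (hne η (hu ▸ hη))
  have hc2 : ContinuousOn (fun η => -Complex.I * ((-(h' η) / (h η) ^ 2 : ℝ) : ℂ)) (Set.uIcc a b) :=
    continuousOn_const.mul (Complex.continuous_ofReal.comp_continuousOn hc1)
  have ibp := intervalIntegral.integral_mul_deriv_eq_deriv_mul (u := v) (v := E) hvd
    (fun η _ => hEd η) hc2.intervalIntegrable
    (Continuous.intervalIntegrable (by fun_prop) _ _)
  have e1 : ∫ η in a..b, E η * (w η : ℂ) =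
      ∫ η in a..b, v η * (E η * (Complex.I * ((h η * w η : ℝ) : ℂ))) := by
    refine intervalIntegral.integral_congr fun η hη => ?_
    have h0 : (h η : ℂ) ≠ 0 := by exact_mod_cast hne η (hu ▸ hη)
    simp only [hv]
    push_cast
    have : -Complex.I * Complex.I = 1 := by simp
    field_simp
    linear_combination (E η * w η) * (this).symm
  rw [e1, ibp]
  have hinv : ∀ η ∈ Set.Icc a b, |(h η)⁻¹| ≤ 1 / lam := fun η hη => by
    rw [abs_inv, one_div]; exact inv_anti₀ hlam (hlow η hη)
  have hvn : ∀ η ∈ Set.Icc a b, ‖v η * E η‖ ≤ 1 / lam := fun η hη => by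
    rw [norm_mul, hEn, mul_one]; simp only [hv, norm_mul, norm_neg, Complex.norm_I, one_mul, Complex.norm_real]
    exact hinv η hη
  have hint : ‖∫ η in a..b, -Complex.I * ((-(h' η) / (h η) ^ 2 : ℝ) : ℂ) * E η‖ ≤ 2 / lam := by
    have hfund : ∫ η in a..b, -(h' η) / (h η) ^ 2 = (h b)⁻¹ - (h a)⁻¹ :=
      intervalIntegral.integral_eq_sub_of_hasDerivAt (fun η hη => (hh η).inv (hne η (hu ▸ hη)))
        hc1.intervalIntegrable
    calc ‖∫ η in a..b, -Complex.I * ((-(h' η) / (h η) ^ 2 : ℝ) : ℂ) * E η‖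
        ≤ ∫ η in a..b, ‖-Complex.I * ((-(h' η) / (h η) ^ 2 : ℝ) : ℂ) * E η‖ :=
          intervalIntegral.norm_integral_le_integral_norm hab
      _ = ∫ η in a..b, |-(h' η) / (h η) ^ 2| := by
          refine intervalIntegral.integral_congr fun η _ => ?_
          simp only [norm_mul, hEn, mul_one, norm_neg, Complex.norm_I, one_mul, Complex.norm_real, Real.norm_eq_abs]
      _ = |∫ η in a..b, -(h' η) / (h η) ^ 2| := by
          rcases hmono with hm | hm
          · have : ∀ η ∈ Set.Icc a b, -(h' η) / (h η) ^ 2 ≤ 0 := fun η hη =>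
              div_nonpos_of_nonpos_of_nonneg (neg_nonpos.2 (hm η hη)) (sq_nonneg _)
            rw [intervalIntegral.integral_congr (g := fun η => -(-(h' η) / (h η) ^ 2)) fun η hη => by
              exact abs_of_nonpos (this η (hu ▸ hη))]
            rw [intervalIntegral.integral_neg, abs_of_nonpos]
            have := intervalIntegral.integral_nonneg (μ := volume) hab (f := fun η => -(-(h' η) / (h η) ^ 2))
              fun η hη => neg_nonneg.2 (this η hη)
            rw [intervalIntegral.integral_neg] at this
            linarith
          · have : ∀ η ∈ Set.Icc a b, 0 ≤ -(h' η) / (h η) ^ 2 := fun η hη =>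
              div_nonneg (neg_nonneg.2 (hm η hη)) (sq_nonneg _)
            rw [intervalIntegral.integral_congr (g := fun η => (-(h' η) / (h η) ^ 2)) fun η hη => by
              exact abs_of_nonneg (this η (hu ▸ hη))]
            rw [abs_of_nonneg]
            exact intervalIntegral.integral_nonneg (μ := volume) hab this
      _ ≤ 2 / lam := by
          rw [hfund]
          have h1 := hinv b (Set.right_mem_Icc.2 hab)
          have h2 := hinv a (Set.left_mem_Icc.2 hab)
          calc _ ≤ |(h b)⁻¹| + |(h a)⁻¹| := abs_sub _ _
            _ ≤ 1 / lam + 1 / lam := by gcongr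
            _ = _ := by ring
  calc _ ≤ ‖v b * E b‖ + ‖v a * E a‖ + _ := (norm_sub_le _ _).trans (add_le_add_left (norm_sub_le _ _) _)
    _ ≤ 1 / lam + 1 / lam + 2 / lam := by
      gcongr
      · exact hvn b (Set.right_mem_Icc.2 hab)
      · exact hvn a (Set.left_mem_Icc.2 hab)
    _ = _ := by ring

lemma level_split (h : ℝ → ℝ) (hc : Continuous h) (a b L : ℝ) (hab : a ≤ b)
    (hanti : AntitoneOn h (Set.Icc a b)) :
    ∃ p ∈ Set.Icc a b, (p = a ∨ ∀ η ∈ Set.Icc a p, L ≤ h η) ∧ (p = b ∨ ∀ η ∈ Set.Icc p b, h η ≤ L) := by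
  by_cases h1 : h a ≤ L
  · exact ⟨a, Set.left_mem_Icc.2 hab, Or.inl rfl, Or.inr fun η hη =>
      (hanti (Set.left_mem_Icc.2 hab) hη hη.1).trans h1⟩
  by_cases h2 : L ≤ h b
  · exact ⟨b, Set.right_mem_Icc.2 hab, Or.inr fun η hη =>
      h2.trans (hanti hη (Set.right_mem_Icc.2 hab) hη.2), Or.inl rfl⟩
  obtain ⟨p, hp, hpL⟩ := intermediate_value_Icc' hab hc.continuousOn (show L ∈ Set.Icc (h b) (h a) from
    ⟨(not_le.1 h2).le, (not_le.1 h1).le⟩)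
  refine ⟨p, hp, Or.inr fun η hη => ?_, Or.inr fun η hη => ?_⟩
  · rw [← hpL]; exact hanti ⟨hη.1, hη.2.trans hp.2⟩ hp hη.2
  · rw [← hpL]; exact hanti hp ⟨hp.1.trans hη.1, hη.2⟩ hη.1

lemma vdc_second (ψ h h' w : ℝ → ℝ) (a b lam : ℝ) (hab : a ≤ b) (hlam : 0 < lam)
    (hψ : ∀ η, HasDerivAt ψ (h η * w η) η) (hh : ∀ η, HasDerivAt h (h' η) η)
    (hw : Continuous w) (hh' : Continuous h') (hwpos : ∀ η, 0 < w η)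
    (hlow : ∀ η ∈ Set.Icc a b, lam ^ 2 * w η ≤ -h' η) :
    ‖∫ η in a..b, Complex.exp (Complex.I * (ψ η : ℂ)) * (w η : ℂ)‖ ≤ 10 / lam := by
  have hhc : Continuous h := continuous_iff_continuousAt.2 fun η => (hh η).continuousAt
  have hψc : Continuous ψ := continuous_iff_continuousAt.2 fun η => (hψ η).continuousAt
  have hneg : ∀ η ∈ Set.Icc a b, h' η ≤ 0 := fun η hη => by
    have := hlow η hη
    have := mul_pos (pow_pos hlam 2) (hwpos η)
    linarith
  have hanti : AntitoneOn h (Set.Icc a b) :=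
    antitoneOn_of_hasDerivWithinAt_nonpos (convex_Icc a b) hhc.continuousOn
      (fun η _ => (hh η).hasDerivWithinAt) fun η hη => hneg η (interior_subset hη)
  obtain ⟨p, hp, hp1, hp2⟩ := level_split h hhc a b lam hab hanti
  obtain ⟨q, hq, hq1, hq2⟩ := level_split h hhc p b (-lam) hp.2
    (hanti.mono (Set.Icc_subset_Icc_left hp.1))
  have hint : ∀ c d, IntervalIntegrable (fun η => Complex.exp (Complex.I * (ψ η : ℂ)) * (w η : ℂ)) volume c d :=
    fun c d => Continuous.intervalIntegrable (by fun_prop) _ _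
  rw [← intervalIntegral.integral_add_adjacent_intervals (hint a p) (hint p b),
    ← intervalIntegral.integral_add_adjacent_intervals (hint p q) (hint q b)]
  have I1 : ‖∫ η in a..p, Complex.exp (Complex.I * (ψ η : ℂ)) * (w η : ℂ)‖ ≤ 4 / lam := by
    rcases hp1 with rfl | hp1
    · rw [intervalIntegral.integral_same]; simp; positivity
    · exact vdc_first ψ h h' w a p lam hp.1 hlam hψ hh hw hh'
        (Or.inr fun η hη => hneg η ⟨hη.1, hη.2.trans hp.2⟩) fun η hη => (hp1 η hη).trans (le_abs_self _)
  have I3 : ‖∫ η in q..b, Complex.exp (Complex.I * (ψ η : ℂ)) * (w η : ℂ)‖ ≤ 4 / lam := by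
    rcases hq2 with rfl | hq2
    · rw [intervalIntegral.integral_same]; simp; positivity
    · refine vdc_first ψ h h' w q b lam hq.2 hlam hψ hh hw hh'
        (Or.inr fun η hη => hneg η ⟨hp.1.trans (hq.1.trans hη.1), hη.2⟩) fun η hη => ?_
      have := hq2 η hη
      have := neg_le_abs (h η)
      linarith
  have I2 : ‖∫ η in p..q, Complex.exp (Complex.I * (ψ η : ℂ)) * (w η : ℂ)‖ ≤ 2 / lam := by
    rcases hq1 with rfl | hq1
    · rw [intervalIntegral.integral_same]; simp; positivity
    rcases hp2 with rfl | hp2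
    · have : q = p := le_antisymm hq.2 hq.1
      subst this
      rw [intervalIntegral.integral_same]; simp; positivity
    calc _ ≤ ∫ η in p..q, ‖Complex.exp (Complex.I * (ψ η : ℂ)) * (w η : ℂ)‖ :=
          intervalIntegral.norm_integral_le_integral_norm hq.1
      _ = ∫ η in p..q, w η := by
          refine intervalIntegral.integral_congr fun η _ => ?_
          simp [Complex.norm_exp, abs_of_pos (hwpos η)]
      _ ≤ ∫ η in p..q, (lam ^ 2)⁻¹ * (-h' η) := by
          refine intervalIntegral.integral_mono_on hq.1 (hw.intervalIntegrable _ _)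
            (Continuous.intervalIntegrable (by fun_prop) _ _) fun η hη => ?_
          rw [le_inv_mul_iff₀ (by positivity)]
          exact hlow η ⟨hp.1.trans hη.1, hη.2.trans hq.2⟩
      _ = (lam ^ 2)⁻¹ * (h p - h q) := by
          rw [intervalIntegral.integral_const_mul, intervalIntegral.integral_neg,
            intervalIntegral.integral_eq_sub_of_hasDerivAt (fun η _ => hh η) (hh'.intervalIntegrable _ _)]
          ring
      _ ≤ (lam ^ 2)⁻¹ * (lam + lam) := by
          gcongr
          have h1 := hp2 p ⟨le_rfl, hp.2⟩
          have h2 := hq1 q ⟨hq.1, le_rfl⟩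
          linarith
      _ = _ := by field_simp; norm_num
  calc _ ≤ 4 / lam + (2 / lam + 4 / lam) :=
        (norm_add_le _ _).trans (add_le_add I1 ((norm_add_le _ _).trans (add_le_add I2 I3)))
    _ = _ := by ring

end PartC
section PartD

/-- `Q(η) = 1 + η²/3`. -/
noncomputable def QQ (η : ℝ) : ℝ := 1 + η ^ 2 / 3
/-- the weight `Q^{-5/6}`. -/
noncomputable def ww (η : ℝ) : ℝ := QQ η ^ (-(5 / 6) : ℝ)
/-- the phase `η Q^{-1/2}`. -/
noncomputable def ph (η : ℝ) : ℝ := η * QQ η ^ (-(1 / 2) : ℝ)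

lemma QQ_pos (η : ℝ) : 0 < QQ η := by unfold QQ; positivity
lemma one_le_QQ (η : ℝ) : 1 ≤ QQ η := by unfold QQ; nlinarith [sq_nonneg η]
lemma QQ_cont : Continuous QQ := by unfold QQ; fun_prop
lemma QQ_rpow_cont (r : ℝ) : Continuous fun η => QQ η ^ r :=
  QQ_cont.rpow_const fun η => Or.inl (QQ_pos η).ne'
lemma QQ_deriv (η : ℝ) : HasDerivAt QQ (2 * η / 3) η := by
  have := ((hasDerivAt_pow 2 η).div_const 3).const_add 1
  have e : QQ = fun x => 1 + x ^ 2 / 3 := rfl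
  rw [e]
  simpa using this
lemma QQ_rpow_deriv (r η : ℝ) : HasDerivAt (fun η => QQ η ^ r) (2 * η / 3 * r * QQ η ^ (r - 1)) η :=
  (QQ_deriv η).rpow_const (Or.inl (QQ_pos η).ne')
lemma ww_pos (η : ℝ) : 0 < ww η := Real.rpow_pos_of_pos (QQ_pos η) _
lemma ww_cont : Continuous ww := QQ_rpow_cont _
lemma ph_cont : Continuous ph := continuous_id.mul (QQ_rpow_cont _)
lemma QQ_even (η : ℝ) : QQ (-η) = QQ η := by simp [QQ]
lemma ww_even (η : ℝ) : ww (-η) = ww η := by simp [ww, QQ_even]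
lemma ph_odd (η : ℝ) : ph (-η) = -ph η := by simp [ph, QQ_even]

lemma ph_deriv (η : ℝ) : HasDerivAt ph (QQ η ^ (-(3 / 2) : ℝ)) η := by
  have := (hasDerivAt_id η).mul (QQ_rpow_deriv (-(1 / 2)) η)
  have e : (QQ η ^ (-(3 / 2) : ℝ)) = 1 * QQ η ^ (-(1 / 2) : ℝ) + id η * (2 * η / 3 * (-(1 / 2)) * QQ η ^ (-(1 / 2) - 1 : ℝ)) := by
    have h1 : QQ η ^ (-(1 / 2) : ℝ) = QQ η * QQ η ^ (-(3 / 2) : ℝ) := by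
      nth_rewrite 2 [← Real.rpow_one (QQ η)]
      rw [← Real.rpow_add (QQ_pos η)]; norm_num
    rw [h1, show (-(1 / 2) - 1 : ℝ) = -(3 / 2) by norm_num]
    have : QQ η = 1 + η ^ 2 / 3 := rfl
    simp only [id]
    linear_combination (-(QQ η ^ (-(3 / 2) : ℝ))) * this
  rw [e]; exact this

lemma ww_le_one (η : ℝ) : ww η ≤ 1 := Real.rpow_le_one_of_one_le_of_nonpos (one_le_QQ η) (by norm_num)

lemma ww_le (η : ℝ) (h : 0 < η) : ww η ≤ 3 * η ^ (-(5 / 3) : ℝ) := by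
  have h1 : ww η ≤ (η ^ 2 / 3) ^ (-(5 / 6) : ℝ) :=
    Real.rpow_le_rpow_of_nonpos (by positivity) (by unfold QQ; linarith) (by norm_num)
  refine h1.trans ?_
  rw [Real.div_rpow (by positivity) (by norm_num), ← Real.rpow_natCast, ← Real.rpow_mul h.le]
  have h2 : (3 : ℝ) ^ (5 / 6 : ℝ) ≤ 3 := by
    calc (3 : ℝ) ^ (5 / 6 : ℝ) ≤ 3 ^ (1 : ℝ) := Real.rpow_le_rpow_of_exponent_le (by norm_num) (by norm_num)
      _ = 3 := by norm_num
  rw [Real.rpow_neg (by norm_num : (0 : ℝ) ≤ 3), div_inv_eq_mul, mul_comm]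
  norm_num
  gcongr

lemma four_thirds_rpow (r : ℝ) (hr1 : -1 ≤ r) : 1 / 2 ≤ (4 / 3 : ℝ) ^ r := by
  calc (1 / 2 : ℝ) ≤ (4 / 3 : ℝ) ^ (-1 : ℝ) := by rw [Real.rpow_neg_one]; norm_num
    _ ≤ _ := Real.rpow_le_rpow_of_exponent_le (by norm_num) hr1

/-- lower bound for `η w(η)` in the intermediate range -/
lemma eta_ww_lower (s η : ℝ) (hs : 1 ≤ s) (h1 : s ^ (-(1 / 3) : ℝ) ≤ η) (h2 : η ≤ s ^ (1 / 2 : ℝ)) :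
    s ^ (-(1 / 3) : ℝ) / 2 ≤ η * ww η := by
  have hs0 : 0 < s := by linarith
  have hη : 0 < η := (Real.rpow_pos_of_pos hs0 _).trans_le h1
  rcases le_total η 1 with h | h
  · have : 1 / 2 ≤ ww η := (four_thirds_rpow (-(5 / 6)) (by norm_num)).trans
      (Real.rpow_le_rpow_of_nonpos (QQ_pos η) (by unfold QQ; nlinarith) (by norm_num))
    calc s ^ (-(1 / 3) : ℝ) / 2 = s ^ (-(1 / 3) : ℝ) * (1 / 2) := by ring
      _ ≤ _ := by gcongr
  · have h3 : (1 / 2) * η ^ (-(5 / 3) : ℝ) ≤ ww η := by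
      calc (1 / 2) * η ^ (-(5 / 3) : ℝ) ≤ (4 / 3) ^ (-(5 / 6) : ℝ) * (η ^ 2) ^ (-(5 / 6) : ℝ) := by
            have : (η ^ 2) ^ (-(5 / 6) : ℝ) = η ^ (-(5 / 3) : ℝ) := by
              rw [← Real.rpow_natCast, ← Real.rpow_mul hη.le]; norm_num
            rw [this]
            gcongr
            exact four_thirds_rpow (-(5 / 6)) (by norm_num)
        _ = (4 / 3 * η ^ 2) ^ (-(5 / 6) : ℝ) := by rw [Real.mul_rpow (by norm_num) (by positivity)]
        _ ≤ ww η := Real.rpow_le_rpow_of_nonpos (QQ_pos η) (by unfold QQ; nlinarith) (by norm_num)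
    have h4 : η * η ^ (-(5 / 3) : ℝ) = η ^ (-(2 / 3) : ℝ) := by
      nth_rewrite 1 [← Real.rpow_one η]
      rw [← Real.rpow_add hη]; norm_num
    have h5 : s ^ (-(1 / 3) : ℝ) ≤ η ^ (-(2 / 3) : ℝ) := by
      calc s ^ (-(1 / 3) : ℝ) = (s ^ (1 / 2 : ℝ)) ^ (-(2 / 3) : ℝ) := by
            rw [← Real.rpow_mul hs0.le]; norm_num
        _ ≤ _ := Real.rpow_le_rpow_of_nonpos hη h2 (by norm_num)
    calc s ^ (-(1 / 3) : ℝ) / 2 ≤ η ^ (-(2 / 3) : ℝ) / 2 := by gcongr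
      _ = η * ((1 / 2) * η ^ (-(5 / 3) : ℝ)) := by rw [← h4]; ring
      _ ≤ _ := by gcongr

lemma mid_bound (s x : ℝ) (hs : 1 ≤ s) :
    ‖∫ η in (s ^ (-(1 / 3) : ℝ))..(s ^ (1 / 2 : ℝ)),
      Complex.exp (Complex.I * ((x * η + s * ph η : ℝ) : ℂ)) * (ww η : ℂ)‖ ≤ 30 * s ^ (-(1 / 3) : ℝ) := by
  have hs0 : 0 < s := by linarith
  set h : ℝ → ℝ := fun η => x * QQ η ^ (5 / 6 : ℝ) + s * QQ η ^ (-(2 / 3) : ℝ) with hh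
  set h' : ℝ → ℝ := fun η => x * (2 * η / 3 * (5 / 6) * QQ η ^ (5 / 6 - 1 : ℝ)) +
    s * (2 * η / 3 * (-(2 / 3)) * QQ η ^ (-(2 / 3) - 1 : ℝ)) with hh'
  have hd : ∀ η, HasDerivAt h (h' η) η := fun η =>
    ((QQ_rpow_deriv (5 / 6) η).const_mul x).add ((QQ_rpow_deriv (-(2 / 3)) η).const_mul s)
  have hψ : ∀ η, HasDerivAt (fun η => x * η + s * ph η) (h η * ww η) η := fun η => by
    have h1 := ((hasDerivAt_id η).const_mul x).add ((ph_deriv η).const_mul s)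
    have e : h η * ww η = x * 1 + s * QQ η ^ (-(3 / 2) : ℝ) := by
      simp only [hh, ww]
      rw [add_mul, mul_assoc, mul_assoc, ← Real.rpow_add (QQ_pos η), ← Real.rpow_add (QQ_pos η)]
      norm_num
    rw [e]; exact h1
  have hh'c : Continuous h' := by
    have h1 := QQ_rpow_cont (5 / 6 - 1)
    have h2 := QQ_rpow_cont (-(2 / 3) - 1)
    simp only [hh']; fun_prop
  have ha : s ^ (-(1 / 3) : ℝ) ≤ 1 := Real.rpow_le_one_of_one_le_of_nonpos hs (by norm_num)
  have hb : 1 ≤ s ^ (1 / 2 : ℝ) := Real.one_le_rpow hs (by norm_num)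
  have hapos : 0 < s ^ (-(1 / 3) : ℝ) := Real.rpow_pos_of_pos hs0 _
  have hab := ha.trans hb
  have hinv : s ^ (-(1 / 3) : ℝ) = (s ^ (1 / 3 : ℝ))⁻¹ := Real.rpow_neg hs0.le _
  have hs3pos : 0 < s ^ (1 / 3 : ℝ) := Real.rpow_pos_of_pos hs0 _
  have hs3 : s * s ^ (-(1 / 3) : ℝ) = (s ^ (1 / 3 : ℝ)) ^ 2 := by
    nth_rewrite 1 [← Real.rpow_one s]
    rw [← Real.rpow_add hs0, ← Real.rpow_natCast, ← Real.rpow_mul hs0.le]; norm_num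
  rcases le_total x 0 with hx | hx
  · have := vdc_second (fun η => x * η + s * ph η) h h' ww _ _ (s ^ (1 / 3 : ℝ) / 3) hab (by positivity) hψ hd ww_cont
      hh'c ww_pos (fun η hη => by
        have h1 := eta_ww_lower s η hs hη.1 hη.2
        have hη0 : 0 < η := hapos.trans_le hη.1
        have e1 : QQ η ^ (-(2 / 3) - 1 : ℝ) = ww η * ww η := by
          rw [ww, ← Real.rpow_add (QQ_pos η)]; norm_num
        have e2 : x * (2 * η / 3 * (5 / 6) * QQ η ^ (5 / 6 - 1 : ℝ)) ≤ 0 :=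
          mul_nonpos_of_nonpos_of_nonneg hx (by have := QQ_pos η; positivity)
        simp only [hh']
        rw [e1]
        have e3 : (s ^ (1 / 3 : ℝ) / 3) ^ 2 * ww η ≤ s * (4 / 9 * (η * ww η)) * ww η := by
          have := (ww_pos η).le
          gcongr
          calc (s ^ (1 / 3 : ℝ) / 3) ^ 2 = s * (1 / 9 * s ^ (-(1 / 3) : ℝ)) := by
                rw [div_pow, ← hs3]; ring
            _ ≤ s * (4 / 9 * (η * ww η)) := mul_le_mul_of_nonneg_left (by linarith) hs0.le
        nlinarith)
    refine this.trans (le_of_eq ?_)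
    rw [hinv]; field_simp; norm_num
  · -- no stationary point
    have hlow : ∀ η ∈ Set.Icc (s ^ (-(1 / 3) : ℝ)) (s ^ (1 / 2 : ℝ)), s ^ (1 / 3 : ℝ) / 2 ≤ |h η| := fun η hη => by
      have hη0 : 0 < η := hapos.trans_le hη.1
      refine le_trans ?_ (le_abs_self _)
      have hη2 : η ^ 2 ≤ s := by
        calc η ^ 2 ≤ (s ^ (1 / 2 : ℝ)) ^ 2 := by gcongr; exact hη.2
          _ = s := by rw [← Real.rpow_natCast, ← Real.rpow_mul hs0.le]; norm_num
      have e1 : (1 / 2) * s ^ (-(2 / 3) : ℝ) ≤ QQ η ^ (-(2 / 3) : ℝ) := by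
        calc (1 / 2) * s ^ (-(2 / 3) : ℝ) ≤ (4 / 3) ^ (-(2 / 3) : ℝ) * s ^ (-(2 / 3) : ℝ) := by
              gcongr; exact four_thirds_rpow (-(2 / 3)) (by norm_num)
          _ = (4 / 3 * s) ^ (-(2 / 3) : ℝ) := by rw [Real.mul_rpow (by norm_num) hs0.le]
          _ ≤ _ := Real.rpow_le_rpow_of_nonpos (QQ_pos η) (by unfold QQ; nlinarith) (by norm_num)
      have e2 : s * s ^ (-(2 / 3) : ℝ) = s ^ (1 / 3 : ℝ) := by
        nth_rewrite 1 [← Real.rpow_one s]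
        rw [← Real.rpow_add hs0]; norm_num
      have e3 : 0 ≤ x * QQ η ^ (5 / 6 : ℝ) := mul_nonneg hx (Real.rpow_nonneg (QQ_pos η).le _)
      simp only [hh]
      nlinarith
    have fact : ∀ η, h' η = 2 * η / 3 * QQ η ^ (-(5 / 3) : ℝ) * (5 / 6 * (x * QQ η ^ (3 / 2 : ℝ)) - 2 / 3 * s) := fun η => by
      have e1 : QQ η ^ (5 / 6 - 1 : ℝ) = QQ η ^ (-(5 / 3) : ℝ) * QQ η ^ (3 / 2 : ℝ) := by
        rw [← Real.rpow_add (QQ_pos η)]; norm_num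
      simp only [hh']
      rw [e1, show (-(2 / 3) - 1 : ℝ) = -(5 / 3) by norm_num]; ring
    obtain ⟨p, hp, hp1, hp2⟩ := level_split (fun η => - (x * QQ η ^ (3 / 2 : ℝ)))
      (continuous_const.mul (QQ_rpow_cont _)).neg _ _ (-(4 / 5 * s)) hab (by
        intro η hη ζ hζ hle
        have hη0 : 0 < η := hapos.trans_le hη.1
        have : QQ η ≤ QQ ζ := by unfold QQ; gcongr
        have := Real.rpow_le_rpow (QQ_pos η).le this (show (0 : ℝ) ≤ 3 / 2 by norm_num)
        simp only [neg_le_neg_iff]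
        gcongr)
    have hint : ∀ c d, IntervalIntegrable (fun η => Complex.exp (Complex.I * ((x * η + s * ph η : ℝ) : ℂ)) * (ww η : ℂ)) volume c d :=
      fun c d => Continuous.intervalIntegrable (by have := ph_cont; have := ww_cont; fun_prop) _ _
    rw [← intervalIntegral.integral_add_adjacent_intervals (hint _ p) (hint p _)]
    have I1 : ‖∫ η in (s ^ (-(1 / 3) : ℝ))..p, Complex.exp (Complex.I * ((x * η + s * ph η : ℝ) : ℂ)) * (ww η : ℂ)‖
        ≤ 4 / (s ^ (1 / 3 : ℝ) / 2) := by
      rcases hp1 with rfl | hp1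
      · rw [intervalIntegral.integral_same]; simp; positivity
      · refine vdc_first (fun η => x * η + s * ph η) h h' ww _ _ _ hp.1 (by positivity) hψ hd ww_cont hh'c
          (Or.inr fun η hη => ?_) fun η hη => hlow η ⟨hη.1, hη.2.trans hp.2⟩
        have hη0 : 0 < η := hapos.trans_le hη.1
        rw [fact]
        have := hp1 η hη
        exact mul_nonpos_of_nonneg_of_nonpos (by have := QQ_pos η; positivity) (by linarith)
    have I2 : ‖∫ η in p..(s ^ (1 / 2 : ℝ)), Complex.exp (Complex.I * ((x * η + s * ph η : ℝ) : ℂ)) * (ww η : ℂ)‖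
        ≤ 4 / (s ^ (1 / 3 : ℝ) / 2) := by
      rcases hp2 with rfl | hp2
      · rw [intervalIntegral.integral_same]; simp; positivity
      · refine vdc_first (fun η => x * η + s * ph η) h h' ww _ _ _ hp.2 (by positivity) hψ hd ww_cont hh'c
          (Or.inl fun η hη => ?_) fun η hη => hlow η ⟨hp.1.trans hη.1, hη.2⟩
        have hη0 : 0 < η := hapos.trans_le (hp.1.trans hη.1)
        rw [fact]
        have := hp2 η hη
        exact mul_nonneg (by have := QQ_pos η; positivity) (by linarith)
    calc _ ≤ _ := (norm_add_le _ _).trans (add_le_add I1 I2)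
      _ = 16 * s ^ (-(1 / 3) : ℝ) := by rw [hinv]; field_simp; norm_num
      _ ≤ _ := by gcongr; norm_num

lemma ww_tail_integrable (b : ℝ) (hb : 0 < b) : IntegrableOn ww (Set.Ioi b) := by
  refine Integrable.mono' ((integrableOn_Ioi_rpow_of_lt (show (-(5 / 3) : ℝ) < -1 by norm_num) hb).const_mul 3)
    ww_cont.aestronglyMeasurable ?_
  filter_upwards [ae_restrict_mem measurableSet_Ioi] with η hη
  rw [Real.norm_of_nonneg (ww_pos η).le]
  exact ww_le η (hb.trans hη)

lemma ww_tail (b : ℝ) (hb : 0 < b) : ∫ η in Set.Ioi b, ww η ≤ 9 / 2 * b ^ (-(2 / 3) : ℝ) := by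
  calc ∫ η in Set.Ioi b, ww η ≤ ∫ η in Set.Ioi b, 3 * η ^ (-(5 / 3) : ℝ) := by
        refine setIntegral_mono_on (ww_tail_integrable b hb)
          ((integrableOn_Ioi_rpow_of_lt (show (-(5 / 3) : ℝ) < -1 by norm_num) hb).const_mul 3)
          measurableSet_Ioi fun η hη => ww_le η (hb.trans hη)
    _ = _ := by
        rw [integral_const_mul, integral_Ioi_rpow_of_lt (by norm_num) hb,
          show (-(5 / 3) + 1 : ℝ) = -(2 / 3) by norm_num]; ring

lemma ww_integrableOn_Ioi : IntegrableOn ww (Set.Ioi 0) := by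
  rw [← Set.Ioc_union_Ioi_eq_Ioi (zero_le_one' ℝ)]
  exact (ww_cont.integrableOn_Icc.mono_set Set.Ioc_subset_Icc_self).union (ww_tail_integrable 1 one_pos)

lemma ww_integrable : Integrable ww := by
  rw [← integrableOn_univ, ← Set.Iic_union_Ioi (a := (0 : ℝ))]
  refine IntegrableOn.union ?_ ww_integrableOn_Ioi
  rw [integrableOn_Iic_iff_integrableOn_Iio]
  have h := ww_integrableOn_Ioi
  rw [← (Measure.measurePreserving_neg (volume : Measure ℝ)).integrableOn_comp_preimage
      (Homeomorph.neg ℝ).measurableEmbedding] at h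
  have e : Neg.neg ⁻¹' (Set.Ioi (0 : ℝ)) = Set.Iio 0 := by ext; simp
  rw [e] at h
  refine h.congr_fun (fun η _ => by simp [ww_even]) measurableSet_Iio

lemma osc_cont (s x : ℝ) : Continuous fun η => Complex.exp (Complex.I * ((x * η + s * ph η : ℝ) : ℂ)) * (ww η : ℂ) := by
  have := ph_cont; have := ww_cont; fun_prop

lemma osc_norm (s x η : ℝ) : ‖Complex.exp (Complex.I * ((x * η + s * ph η : ℝ) : ℂ)) * (ww η : ℂ)‖ = ww η := by
  have : ‖Complex.exp (Complex.I * ((x * η + s * ph η : ℝ) : ℂ))‖ = 1 := by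
    rw [mul_comm]; exact Complex.norm_exp_ofReal_mul_I _
  rw [norm_mul, this, one_mul, Complex.norm_real, Real.norm_of_nonneg (ww_pos η).le]

lemma osc_integrable (s x : ℝ) : Integrable fun η => Complex.exp (Complex.I * ((x * η + s * ph η : ℝ) : ℂ)) * (ww η : ℂ) :=
  ww_integrable.mono' (osc_cont s x).aestronglyMeasurable (Filter.Eventually.of_forall fun η => (osc_norm s x η).le)

lemma norm_set_le (s x : ℝ) (S : Set ℝ) :
    ‖∫ η in S, Complex.exp (Complex.I * ((x * η + s * ph η : ℝ) : ℂ)) * (ww η : ℂ)‖ ≤ ∫ η in S, ww η := by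
  refine (norm_integral_le_integral_norm _).trans (le_of_eq ?_)
  simp_rw [osc_norm]

lemma ww_head (a : ℝ) (ha : 0 ≤ a) : ∫ η in Set.Ioc 0 a, ww η ≤ a := by
  rw [← intervalIntegral.integral_of_le ha]
  calc ∫ η in (0 : ℝ)..a, ww η ≤ ∫ _ in (0 : ℝ)..a, (1 : ℝ) :=
        intervalIntegral.integral_mono_on ha (ww_cont.intervalIntegrable _ _) (by simp) fun η _ => ww_le_one η
    _ = a := by simp

lemma half_bound (s x : ℝ) (hs : 0 < s) :
    ‖∫ η in Set.Ioi (0 : ℝ), Complex.exp (Complex.I * ((x * η + s * ph η : ℝ) : ℂ)) * (ww η : ℂ)‖ ≤ 36 * s ^ (-(1 / 3) : ℝ) := by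
  have hi := osc_integrable s x
  rcases le_total s 1 with h1 | h1
  · have h2 : 1 ≤ s ^ (-(1 / 3) : ℝ) := Real.one_le_rpow_of_pos_of_le_one_of_nonpos hs h1 (by norm_num)
    refine (norm_set_le s x _).trans ?_
    rw [← Set.Ioc_union_Ioi_eq_Ioi (zero_le_one' ℝ), setIntegral_union (Set.Ioc_disjoint_Ioi le_rfl) measurableSet_Ioi
      ww_integrable.integrableOn ww_integrable.integrableOn]
    have := ww_head 1 zero_le_one
    have := ww_tail 1 one_pos
    rw [Real.one_rpow] at this
    linarith
  · have ha : s ^ (-(1 / 3) : ℝ) ≤ 1 := Real.rpow_le_one_of_one_le_of_nonpos h1 (by norm_num)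
    have hb : 1 ≤ s ^ (1 / 2 : ℝ) := Real.one_le_rpow h1 (by norm_num)
    have hapos : 0 < s ^ (-(1 / 3) : ℝ) := Real.rpow_pos_of_pos hs _
    rw [← Set.Ioc_union_Ioi_eq_Ioi hapos.le, setIntegral_union (Set.Ioc_disjoint_Ioi le_rfl) measurableSet_Ioi
      hi.integrableOn hi.integrableOn, ← Set.Ioc_union_Ioi_eq_Ioi (ha.trans hb), setIntegral_union (Set.Ioc_disjoint_Ioi le_rfl) measurableSet_Ioi
      hi.integrableOn hi.integrableOn, ← intervalIntegral.integral_of_le (ha.trans hb)]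
    have I1 := (norm_set_le s x (Set.Ioc 0 (s ^ (-(1 / 3) : ℝ)))).trans (ww_head _ hapos.le)
    have I2 := mid_bound s x h1
    have I3 := (norm_set_le s x (Set.Ioi (s ^ (1 / 2 : ℝ)))).trans (ww_tail _ (by linarith))
    have e : (s ^ (1 / 2 : ℝ)) ^ (-(2 / 3) : ℝ) = s ^ (-(1 / 3) : ℝ) := by
      rw [← Real.rpow_mul hs.le]; norm_num
    rw [e] at I3
    refine (norm_add_le _ _).trans ((add_le_add I1 ((norm_add_le _ _).trans (add_le_add I2 I3))).trans ?_)
    linarith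

lemma osc_conj (s x η : ℝ) : (starRingEnd ℂ) (Complex.exp (Complex.I * ((x * η + s * ph η : ℝ) : ℂ)) * (ww η : ℂ)) =
    Complex.exp (Complex.I * ((-(x * η + s * ph η) : ℝ) : ℂ)) * (ww η : ℂ) := by
  rw [map_mul, ← Complex.exp_conj, map_mul, Complex.conj_I, Complex.conj_ofReal, Complex.conj_ofReal]
  congr 2; push_cast; ring

lemma full_bound_pos (s x : ℝ) (hs : 0 < s) :
    ‖∫ η : ℝ, Complex.exp (Complex.I * ((x * η + s * ph η : ℝ) : ℂ)) * (ww η : ℂ)‖ ≤ 72 * s ^ (-(1 / 3) : ℝ) := by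
  have hi := osc_integrable s x
  rw [← setIntegral_univ, ← Set.Iic_union_Ioi (a := (0 : ℝ)), setIntegral_union (Set.Iic_disjoint_Ioi le_rfl)
    measurableSet_Ioi hi.integrableOn hi.integrableOn]
  have e : ‖∫ η in Set.Iic (0 : ℝ), Complex.exp (Complex.I * ((x * η + s * ph η : ℝ) : ℂ)) * (ww η : ℂ)‖ =
      ‖∫ η in Set.Ioi (0 : ℝ), Complex.exp (Complex.I * ((x * η + s * ph η : ℝ) : ℂ)) * (ww η : ℂ)‖ := by
    have h1 := integral_comp_neg_Ioi (0 : ℝ) (fun η => Complex.exp (Complex.I * ((x * η + s * ph η : ℝ) : ℂ)) * (ww η : ℂ))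
    rw [neg_zero] at h1
    rw [← h1, ← Complex.norm_conj (∫ η in Set.Ioi (0 : ℝ), Complex.exp (Complex.I * ((x * η + s * ph η : ℝ) : ℂ)) * (ww η : ℂ)), ← integral_conj]
    congr 2; ext η
    rw [osc_conj, ww_even, ph_odd]
    congr 4; ring
  have := half_bound s x hs
  refine (norm_add_le _ _).trans ?_
  rw [e]; linarith

lemma full_bound (s x : ℝ) (hs : s ≠ 0) :
    ‖∫ η : ℝ, Complex.exp (Complex.I * ((x * η + s * ph η : ℝ) : ℂ)) * (ww η : ℂ)‖ ≤ 72 * |s| ^ (-(1 / 3) : ℝ) := by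
  rcases lt_or_gt_of_ne hs with h | h
  · rw [abs_of_neg h]
    have := full_bound_pos (-s) (-x) (neg_pos.2 h)
    rw [← Complex.norm_conj, ← integral_conj]
    simp_rw [osc_conj]
    have e : ∀ η, -(x * η + s * ph η) = -x * η + -s * ph η := fun η => by ring
    simp_rw [e]
    exact this
  · rw [abs_of_pos h]; exact full_bound_pos s x h

end PartD
section PartE

/-- oscillating factor -/
noncomputable def osc (θ : ℝ → ℝ) (t x ξ : ℝ) : ℂ := Complex.exp (Complex.I * ((x * ξ + t * θ ξ : ℝ) : ℂ))

lemma osc_nrm (θ : ℝ → ℝ) (t x ξ : ℝ) : ‖osc θ t x ξ‖ = 1 := by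
  unfold osc; rw [mul_comm]; exact Complex.norm_exp_ofReal_mul_I _

lemma osc_mul_conj (θ : ℝ → ℝ) (t x r y ξ : ℝ) :
    osc θ t x ξ * (starRingEnd ℂ) (osc θ r y ξ) = osc θ (t - r) (x - y) ξ := by
  unfold osc
  rw [← Complex.exp_conj, map_mul, Complex.conj_I, Complex.conj_ofReal, ← Complex.exp_add]
  congr 1; push_cast; ring

lemma osc_measurable (θ : ℝ → ℝ) (hθ : Continuous θ) (X : ℝ → ℝ) (hX : Measurable X) :
    Measurable fun p : ℝ × ℝ => osc θ p.1 (X p.1) p.2 := by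
  unfold osc
  have := hθ.measurable
  fun_prop

lemma TTstar (θ W : ℝ → ℝ) (hθ : Continuous θ) (hWc : Continuous W)
    (hWpos : ∀ ξ, 0 < W ξ) (hWi : Integrable W) (B : ℝ≥0∞)
    (hB : ∀ t x, ‖∫ ξ, osc θ t x ξ * (W ξ : ℂ)‖ₑ ≤ B * kern t)
    (X : ℝ → ℝ) (hX : Measurable X) (G : ℝ → ℂ) (hG : Measurable G) (hGi : Integrable G) :
    ∫⁻ ξ, ‖∫ t, G t * osc θ t (X t) ξ‖ₑ ^ (2 : ℝ) * ENNReal.ofReal (W ξ) ≤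
      10 * B * (∫⁻ t, ‖G t‖ₑ ^ (6 / 5 : ℝ)) ^ (5 / 3 : ℝ) := by
  have hom := osc_measurable θ hθ X hX
  set H : ℝ → ℂ := fun ξ => ∫ t, G t * osc θ t (X t) ξ with hH
  -- triple integrand
  set Φ : ℝ → ℝ × ℝ → ℂ := fun ξ p => (G p.1 * osc θ p.1 (X p.1) ξ) *
    (starRingEnd ℂ) (G p.2 * osc θ p.2 (X p.2) ξ) * (W ξ : ℂ) with hΦ
  have hΦm : Measurable (Function.uncurry Φ) := by
    simp only [hΦ, Function.uncurry_def]
    have h1 : Measurable fun z : ℝ × ℝ × ℝ => osc θ z.2.1 (X z.2.1) z.1 :=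
      hom.comp (measurable_snd.fst.prodMk measurable_fst)
    have h2 : Measurable fun z : ℝ × ℝ × ℝ => osc θ z.2.2 (X z.2.2) z.1 :=
      hom.comp (measurable_snd.snd.prodMk measurable_fst)
    have h3 : Measurable fun z : ℝ × ℝ × ℝ => (W z.1 : ℂ) := by
      have := hWc.measurable
      fun_prop
    have h4 : Measurable fun z : ℝ × ℝ × ℝ => G z.2.1 := hG.comp (by fun_prop)
    have h5 : Measurable fun z : ℝ × ℝ × ℝ => G z.2.2 := hG.comp (by fun_prop)
    exact ((h4.mul h1).mul (Complex.continuous_conj.measurable.comp (h5.mul h2))).mul h3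
  have hΦn : ∀ z : ℝ × ℝ × ℝ, ‖Function.uncurry Φ z‖ = W z.1 * (‖G z.2.1‖ * ‖G z.2.2‖) := by
    intro z
    simp only [hΦ, Function.uncurry_def, norm_mul, osc_nrm, RCLike.norm_conj, mul_one, Complex.norm_real,
      Real.norm_of_nonneg (hWpos z.1).le]
    ring
  have hΦi : Integrable (Function.uncurry Φ) (volume.prod (volume.prod volume)) := by
    refine Integrable.mono' (hWi.mul_prod (hGi.norm.mul_prod hGi.norm)) hΦm.aestronglyMeasurable
      (Filter.Eventually.of_forall fun z => (hΦn z).le)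
  have hinner : ∀ ξ, ∫ p, Φ ξ p ∂(volume.prod volume) = ((‖H ξ‖ ^ 2 * W ξ : ℝ) : ℂ) := by
    intro ξ
    simp only [hΦ]
    rw [integral_mul_const, integral_prod_mul (fun t => G t * osc θ t (X t) ξ)
      (fun t => (starRingEnd ℂ) (G t * osc θ t (X t) ξ)), integral_conj]
    rw [Complex.mul_conj, Complex.normSq_eq_norm_sq]
    push_cast; rfl
  have hswap := integral_integral_swap hΦi
  have hinner2 : ∀ p : ℝ × ℝ, ∫ ξ, Φ ξ p = G p.1 * (starRingEnd ℂ) (G p.2) *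
      ∫ ξ, osc θ (p.1 - p.2) (X p.1 - X p.2) ξ * (W ξ : ℂ) := by
    intro p
    rw [← integral_const_mul]
    congr 1; ext ξ
    simp only [hΦ]
    rw [← osc_mul_conj, map_mul]; ring
  simp_rw [hinner, hinner2] at hswap
  have hHi : Integrable fun ξ => ‖H ξ‖ ^ 2 * W ξ := by
    have := hΦi.integral_prod_left
    simp only [Function.uncurry_apply_pair, hinner] at this
    exact this.re
  rw [integral_complex_ofReal] at hswap
  have hS : ∫⁻ ξ, ‖H ξ‖ₑ ^ (2 : ℝ) * ENNReal.ofReal (W ξ) = ENNReal.ofReal (∫ ξ, ‖H ξ‖ ^ 2 * W ξ) := by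
    rw [ofReal_integral_eq_lintegral_ofReal hHi (Filter.Eventually.of_forall fun ξ =>
      mul_nonneg (sq_nonneg _) (hWpos ξ).le)]
    refine lintegral_congr fun ξ => ?_
    rw [ENNReal.ofReal_mul (sq_nonneg _), ENNReal.ofReal_pow (norm_nonneg _), ofReal_norm]
    norm_num
  have hk := measurable_kern
  have hGe : Measurable fun t => ‖G t‖ₑ := hG.enorm
  rw [hS]
  calc ENNReal.ofReal (∫ ξ, ‖H ξ‖ ^ 2 * W ξ) = ‖((∫ ξ, ‖H ξ‖ ^ 2 * W ξ : ℝ) : ℂ)‖ₑ := by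
        rw [← ofReal_norm, Complex.norm_real, Real.norm_of_nonneg]
        exact integral_nonneg fun ξ => mul_nonneg (sq_nonneg _) (hWpos ξ).le
    _ ≤ ∫⁻ p : ℝ × ℝ, ‖G p.1 * (starRingEnd ℂ) (G p.2) *
          ∫ ξ, osc θ (p.1 - p.2) (X p.1 - X p.2) ξ * (W ξ : ℂ)‖ₑ ∂(volume.prod volume) := by
        rw [hswap]; exact enorm_integral_le_lintegral_enorm _
    _ ≤ ∫⁻ p : ℝ × ℝ, B * (‖G p.1‖ₑ * ‖G p.2‖ₑ * kern (p.1 - p.2)) ∂(volume.prod volume) := by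
        refine lintegral_mono fun p => ?_
        rw [enorm_mul, enorm_mul]
        have e : ‖(starRingEnd ℂ) (G p.2)‖ₑ = ‖G p.2‖ₑ := by
          rw [← ofReal_norm, RCLike.norm_conj, ofReal_norm]
        rw [e]
        calc _ ≤ ‖G p.1‖ₑ * ‖G p.2‖ₑ * (B * kern (p.1 - p.2)) := by gcongr; exact hB _ _
          _ = _ := by ring
    _ = B * ∫⁻ t, ∫⁻ r, ‖G t‖ₑ * ‖G r‖ₑ * kern (t - r) := by
        have hm : Measurable fun p : ℝ × ℝ => ‖G p.1‖ₑ * ‖G p.2‖ₑ * kern (p.1 - p.2) := by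
          have h1 : Measurable fun p : ℝ × ℝ => kern (p.1 - p.2) := hk.comp (by fun_prop)
          exact ((hGe.comp measurable_fst).mul (hGe.comp measurable_snd)).mul h1
        rw [lintegral_const_mul _ hm, lintegral_prod _ hm.aemeasurable]
    _ ≤ B * (10 * (∫⁻ t, ‖G t‖ₑ ^ (6 / 5 : ℝ)) ^ (5 / 3 : ℝ)) := by
        gcongr
        exact hls (fun t => ‖G t‖ₑ) hGe fun t => by simp
    _ = _ := by ring

/-- the free evolution -/
noncomputable def uu (θ : ℝ → ℝ) (g : ℝ → ℂ) (t x : ℝ) : ℂ := ∫ ξ, osc θ t x ξ * g ξ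

lemma uu_cont (θ : ℝ → ℝ) (hθ : Continuous θ) (g : ℝ → ℂ) (hg : Continuous g) (hgi : Integrable g) :
    Continuous fun p : ℝ × ℝ => uu θ g p.1 p.2 := by
  unfold uu
  refine continuous_of_dominated (bound := fun ξ => ‖g ξ‖) ?_ ?_ hgi.norm ?_
  · intro p
    unfold osc
    exact Continuous.aestronglyMeasurable (by fun_prop)
  · intro p
    exact Filter.Eventually.of_forall fun ξ => by rw [norm_mul, osc_nrm, one_mul]
  · refine Filter.Eventually.of_forall fun ξ => ?_
    unfold osc
    fun_prop

lemma uu_bound (θ : ℝ → ℝ) (g : ℝ → ℂ) (t x : ℝ) : ‖uu θ g t x‖ ≤ ∫ ξ, ‖g ξ‖ := by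
  refine (norm_integral_le_integral_norm _).trans (le_of_eq ?_)
  simp_rw [norm_mul, osc_nrm, one_mul]

set_option maxHeartbeats 1000000 in
lemma strich_sel (θ W : ℝ → ℝ) (hθ : Continuous θ) (hWc : Continuous W)
    (hWpos : ∀ ξ, 0 < W ξ) (hWi : Integrable W) (B : ℝ≥0∞)
    (hB : ∀ t x, ‖∫ ξ, osc θ t x ξ * (W ξ : ℂ)‖ₑ ≤ B * kern t)
    (g : ℝ → ℂ) (hg : Continuous g) (hgi : Integrable g) (T : ℝ)
    (X : ℝ → ℝ) (hX : Measurable X) :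
    (∫⁻ t in Set.Ioo 0 T, ‖uu θ g t (X t)‖ₑ ^ (6 : ℝ)) ^ (1 / 6 : ℝ) ≤
      (10 * B) ^ (1 / 2 : ℝ) * (∫⁻ ξ, ‖g ξ‖ₑ ^ (2 : ℝ) * ENNReal.ofReal (W ξ)⁻¹) ^ (1 / 2 : ℝ) := by
  set U : ℝ → ℂ := fun t => uu θ g t (X t) with hU
  have hUm : Measurable U := (uu_cont θ hθ g hg hgi).measurable.comp (measurable_id.prodMk hX)
  set M := ∫ ξ, ‖g ξ‖ with hM
  have hM0 : 0 ≤ M := integral_nonneg fun ξ => norm_nonneg _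
  have hUb : ∀ t, ‖U t‖ ≤ M := fun t => uu_bound θ g t (X t)
  set G : ℝ → ℂ := (Set.Ioo 0 T).indicator fun t => (starRingEnd ℂ) (U t) * ((‖U t‖ ^ 4 : ℝ) : ℂ) with hG
  have hGm0 : Measurable fun t => (starRingEnd ℂ) (U t) * ((‖U t‖ ^ 4 : ℝ) : ℂ) := by
    have h1 : Measurable fun t => (starRingEnd ℂ) (U t) := Complex.continuous_conj.measurable.comp hUm
    have h2 : Measurable fun t => ‖U t‖ := hUm.norm
    fun_prop
  have hGm : Measurable G := hGm0.indicator measurableSet_Ioo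
  have hGn : ∀ t, ‖(starRingEnd ℂ) (U t) * ((‖U t‖ ^ 4 : ℝ) : ℂ)‖ = ‖U t‖ ^ 5 := fun t => by
    rw [norm_mul, RCLike.norm_conj, Complex.norm_real, Real.norm_of_nonneg (by positivity)]; ring
  have hGi : Integrable G := by
    rw [hG, integrable_indicator_iff measurableSet_Ioo]
    refine Measure.integrableOn_of_bounded (M := M ^ 5) (by simp) hGm0.aestronglyMeasurable
      (Filter.Eventually.of_forall fun t => ?_)
    rw [hGn]; gcongr; exact hUb t
  set A := ∫⁻ t in Set.Ioo 0 T, ‖U t‖ₑ ^ (6 : ℝ) with hA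
  have hAfin : A ≠ ⊤ := by
    refine ne_of_lt (lt_of_le_of_lt (lintegral_mono (g := fun _ => ENNReal.ofReal M ^ (6 : ℝ)) fun t => ?_) ?_)
    · refine ENNReal.rpow_le_rpow ?_ (by norm_num)
      rw [← ofReal_norm]; exact ENNReal.ofReal_le_ofReal (hUb t)
    · rw [setLIntegral_const]
      exact ENNReal.mul_lt_top (ENNReal.rpow_lt_top_of_nonneg (by norm_num) ENNReal.ofReal_ne_top) (by simp)
  have hGA : ∫⁻ t, ‖G t‖ₑ ^ (6 / 5 : ℝ) = A := by
    rw [hA, ← lintegral_indicator measurableSet_Ioo]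
    refine lintegral_congr fun t => ?_
    by_cases ht : t ∈ Set.Ioo 0 T
    · simp only [hG, Set.indicator_of_mem ht]
      rw [← ofReal_norm, hGn, ENNReal.ofReal_pow (norm_nonneg _), ofReal_norm, ← ENNReal.rpow_natCast, ← ENNReal.rpow_mul]
      norm_num
    · simp only [hG, Set.indicator_of_notMem ht, enorm_zero]
      rw [ENNReal.zero_rpow_of_pos (by norm_num)]
  set H : ℝ → ℂ := fun ξ => ∫ t, G t * osc θ t (X t) ξ with hH
  have hom := osc_measurable θ hθ X hX
  -- duality
  set Φ : ℝ → ℝ → ℂ := fun t ξ => G t * (osc θ t (X t) ξ * g ξ) with hΦ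
  have hΦm : Measurable (Function.uncurry Φ) :=
    (hGm.comp measurable_fst).mul (hom.mul (hg.measurable.comp measurable_snd))
  have hΦi : Integrable (Function.uncurry Φ) (volume.prod volume) := by
    refine Integrable.mono' (hGi.norm.mul_prod hgi.norm) hΦm.aestronglyMeasurable
      (Filter.Eventually.of_forall fun z => ?_)
    simp only [hΦ, Function.uncurry_def, norm_mul, osc_nrm, one_mul]; exact le_rfl
  have hswap := integral_integral_swap hΦi
  have i1 : ∀ t, ∫ ξ, Φ t ξ = (((Set.Ioo 0 T).indicator (fun t => ‖U t‖ ^ 6) t : ℝ) : ℂ) := fun t => by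
    simp only [hΦ]
    rw [integral_const_mul]
    by_cases ht : t ∈ Set.Ioo 0 T
    · simp only [hG, Set.indicator_of_mem ht]
      have : (starRingEnd ℂ) (U t) * U t = ((‖U t‖ ^ 2 : ℝ) : ℂ) := by
        rw [mul_comm, Complex.mul_conj, Complex.normSq_eq_norm_sq]
      calc _ = (starRingEnd ℂ) (U t) * ((‖U t‖ ^ 4 : ℝ) : ℂ) * U t := rfl
        _ = ((starRingEnd ℂ) (U t) * U t) * ((‖U t‖ ^ 4 : ℝ) : ℂ) := by ring
        _ = _ := by rw [this]; push_cast; ring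
    · simp [hG, Set.indicator_of_notMem ht]
  have i2 : ∀ ξ, ∫ t, Φ t ξ = g ξ * H ξ := fun ξ => by
    rw [hH, ← integral_const_mul]
    congr 1; ext t; simp only [hΦ]; ring
  simp_rw [i1, i2] at hswap
  rw [integral_complex_ofReal] at hswap
  have hAint : A = ENNReal.ofReal (∫ t, (Set.Ioo 0 T).indicator (fun t => ‖U t‖ ^ 6) t) := by
    rw [integral_indicator measurableSet_Ioo, ofReal_integral_eq_lintegral_ofReal]
    · refine lintegral_congr fun t => ?_
      rw [ENNReal.ofReal_pow (norm_nonneg _), ofReal_norm]; norm_num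
    · refine Measure.integrableOn_of_bounded (M := M ^ 6) (by simp) (hUm.norm.pow_const 6).aestronglyMeasurable
        (Filter.Eventually.of_forall fun t => ?_)
      rw [norm_pow, norm_norm]; gcongr; exact hUb t
    · exact Filter.Eventually.of_forall fun t => by positivity
  have hHm : AEMeasurable H := by
    have : StronglyMeasurable fun ξ => ∫ t, G t * osc θ t (X t) ξ := by
      refine StronglyMeasurable.integral_prod_right (f := fun ξ t => G t * osc θ t (X t) ξ) ?_
      refine Measurable.stronglyMeasurable ?_
      exact (hGm.comp measurable_snd).mul (hom.comp measurable_swap)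
    exact this.measurable.aemeasurable
  set N := ∫⁻ ξ, ‖g ξ‖ₑ ^ (2 : ℝ) * ENNReal.ofReal (W ξ)⁻¹ with hN
  have hWm := hWc.measurable
  have main : A ≤ N ^ (1 / 2 : ℝ) * (10 * B * A ^ (5 / 3 : ℝ)) ^ (1 / 2 : ℝ) := by
    calc A = ‖((∫ t, (Set.Ioo 0 T).indicator (fun t => ‖U t‖ ^ 6) t : ℝ) : ℂ)‖ₑ := by
          rw [hAint, ← ofReal_norm, Complex.norm_real, Real.norm_of_nonneg]
          exact integral_nonneg fun t => Set.indicator_nonneg (fun t _ => by positivity) t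
      _ ≤ ∫⁻ ξ, ‖g ξ * H ξ‖ₑ := by
          rw [hswap]; exact enorm_integral_le_lintegral_enorm _
      _ = ∫⁻ ξ, (‖g ξ‖ₑ * ENNReal.ofReal (W ξ)⁻¹ ^ (1 / 2 : ℝ)) * (‖H ξ‖ₑ * ENNReal.ofReal (W ξ) ^ (1 / 2 : ℝ)) := by
          refine lintegral_congr fun ξ => ?_
          rw [enorm_mul]
          have : ENNReal.ofReal (W ξ)⁻¹ ^ (1 / 2 : ℝ) * ENNReal.ofReal (W ξ) ^ (1 / 2 : ℝ) = 1 := by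
            rw [← ENNReal.mul_rpow_of_nonneg _ _ (by norm_num), ← ENNReal.ofReal_mul (inv_nonneg.2 (hWpos ξ).le),
              inv_mul_cancel₀ (hWpos ξ).ne']
            simp
          rw [mul_mul_mul_comm, this, mul_one]
      _ ≤ (∫⁻ ξ, (‖g ξ‖ₑ * ENNReal.ofReal (W ξ)⁻¹ ^ (1 / 2 : ℝ)) ^ (2 : ℝ)) ^ (1 / 2 : ℝ) *
          (∫⁻ ξ, (‖H ξ‖ₑ * ENNReal.ofReal (W ξ) ^ (1 / 2 : ℝ)) ^ (2 : ℝ)) ^ (1 / 2 : ℝ) := by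
          refine ENNReal.lintegral_mul_le_Lp_mul_Lq volume (by constructor <;> norm_num) ?_ ?_
          · have := hg.measurable.enorm
            exact Measurable.aemeasurable (by fun_prop)
          · exact hHm.enorm.mul (by fun_prop)
      _ = N ^ (1 / 2 : ℝ) * (∫⁻ ξ, ‖H ξ‖ₑ ^ (2 : ℝ) * ENNReal.ofReal (W ξ)) ^ (1 / 2 : ℝ) := by
          have e : ∀ a b : ℝ≥0∞, (a * b ^ (1 / 2 : ℝ)) ^ (2 : ℝ) = a ^ (2 : ℝ) * b := fun a b => by
            rw [ENNReal.mul_rpow_of_nonneg _ _ (by norm_num), ← ENNReal.rpow_mul]; norm_num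
          simp_rw [e]; rfl
      _ ≤ _ := by
          gcongr
          have := TTstar θ W hθ hWc hWpos hWi B hB X hX G hGm hGi
          rw [hGA] at this
          exact this
  by_cases hA0 : A = 0
  · rw [hA0, ENNReal.zero_rpow_of_pos (by norm_num)]; exact zero_le
  have hsplit : A = A ^ (1 / 6 : ℝ) * A ^ (5 / 6 : ℝ) := by
    rw [← ENNReal.rpow_add _ _ hA0 hAfin]; norm_num
  have h56 : (10 * B * A ^ (5 / 3 : ℝ)) ^ (1 / 2 : ℝ) = (10 * B) ^ (1 / 2 : ℝ) * A ^ (5 / 6 : ℝ) := by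
    rw [ENNReal.mul_rpow_of_nonneg _ _ (by norm_num), ← ENNReal.rpow_mul]; norm_num
  rw [h56] at main
  nth_rewrite 1 [hsplit] at main
  rw [← mul_assoc, mul_comm (N ^ (1 / 2 : ℝ))] at main
  refine (ENNReal.mul_le_mul_iff_left ?_ ?_).1 main
  · exact (ENNReal.rpow_pos (pos_iff_ne_zero.2 hA0) hAfin).ne'
  · exact ENNReal.rpow_ne_top_of_nonneg (by norm_num) hAfin

end PartE

section PartF

lemma kernel_scaled (σ μ ε : ℝ) (hσ : |σ| = 1) (hμ : 0 < μ) (hε : 0 < ε) (t x : ℝ) :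
    ‖∫ ξ, osc (fun ξ => σ / (ε * √μ) * ph (√μ * ξ)) t x ξ * ((ww (√μ * ξ) : ℝ) : ℂ)‖ₑ ≤
      ENNReal.ofReal (72 * (ε / μ) ^ (1 / 3 : ℝ)) * kern t := by
  have ha : 0 < √μ := Real.sqrt_pos.2 hμ
  have hμa : μ = √μ ^ 2 := (Real.sq_sqrt hμ.le).symm
  by_cases ht : t = 0
  · have hk : kern t = ⊤ := by
      simp only [kern, ht, abs_zero, ENNReal.ofReal_zero]
      exact ENNReal.zero_rpow_of_neg (by norm_num)
    rw [hk, ENNReal.mul_top]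
    · exact le_top
    · rw [ENNReal.ofReal_ne_zero_iff]; positivity
  have hσ0 : σ ≠ 0 := fun h => by simp [h] at hσ
  generalize hb : √μ = a at *
  set F : ℝ → ℂ := fun η => Complex.exp (Complex.I * (((x / a) * η + (t * (σ / (ε * a))) * ph η : ℝ) : ℂ)) *
    (ww η : ℂ) with hF
  have e1 : ∀ ξ, osc (fun ξ => σ / (ε * a) * ph (a * ξ)) t x ξ * ((ww (a * ξ) : ℝ) : ℂ) = F (a * ξ) := by
    intro ξ
    simp only [osc, hF]
    congr 4
    field_simp
  simp_rw [e1]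
  rw [Measure.integral_comp_mul_left F a]
  have hs : t * (σ / (ε * a)) ≠ 0 := mul_ne_zero ht (div_ne_zero hσ0 (by positivity))
  have hfb := full_bound (t * (σ / (ε * a))) (x / a) hs
  have ht0 : 0 < |t| := abs_pos.2 ht
  have hk : kern t = ENNReal.ofReal (|t| ^ (-(1 / 3) : ℝ)) := by
    rw [kern, ENNReal.ofReal_rpow_of_pos ht0]
  rw [hk, ← ENNReal.ofReal_mul (by positivity), ← ofReal_norm]
  refine ENNReal.ofReal_le_ofReal ?_
  rw [norm_smul, Real.norm_eq_abs, abs_abs, abs_of_pos (inv_pos.2 ha)]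
  refine (mul_le_mul_of_nonneg_left hfb (inv_pos.2 ha).le).trans (le_of_eq ?_)
  rw [abs_mul, abs_div, hσ, abs_of_pos (by positivity : 0 < ε * a), Real.mul_rpow ht0.le (by positivity),
    one_div (ε * a), Real.inv_rpow (by positivity), Real.rpow_neg (by positivity : 0 ≤ ε * a), inv_inv,
    Real.mul_rpow hε.le ha.le, hμa, Real.div_rpow hε.le (by positivity), ← Real.rpow_natCast a 2,
    ← Real.rpow_mul ha.le]
  have : a⁻¹ * a ^ (1 / 3 : ℝ) = (a ^ (((2 : ℕ) : ℝ) * (1 / 3) : ℝ))⁻¹ := by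
    rw [← Real.rpow_neg_one, ← Real.rpow_add ha, ← Real.rpow_neg ha.le]; norm_num
  rw [div_eq_mul_inv (ε ^ _) (a ^ _), ← this]
  ring

/-- measurable near-maximizer selection -/
noncomputable def sel (v : ℝ → ℝ → ℂ) : ℕ → ℝ → ℝ
  | 0 => fun _ => TopologicalSpace.denseSeq ℝ 0
  | n + 1 => fun t =>
      if ‖v t (sel v n t)‖ < ‖v t (TopologicalSpace.denseSeq ℝ (n + 1))‖ then
        TopologicalSpace.denseSeq ℝ (n + 1) else sel v n t

lemma sel_measurable (v : ℝ → ℝ → ℂ) (hv : Continuous fun p : ℝ × ℝ => v p.1 p.2) (n : ℕ) :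
    Measurable (sel v n) := by
  induction n with
  | zero => exact measurable_const
  | succ n ih =>
    refine Measurable.ite ?_ measurable_const ih
    refine measurableSet_lt ?_ ?_
    · exact (hv.measurable.comp (measurable_id.prodMk ih)).norm
    · exact (hv.measurable.comp (measurable_id.prodMk measurable_const)).norm

lemma sel_mono (v : ℝ → ℝ → ℂ) (n : ℕ) (t : ℝ) : ‖v t (sel v n t)‖ ≤ ‖v t (sel v (n + 1) t)‖ := by
  simp only [sel]
  split_ifs with h
  · exact h.le
  · exact le_rfl

lemma sel_ge (v : ℝ → ℝ → ℂ) (n : ℕ) (t : ℝ) :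
    ‖v t (TopologicalSpace.denseSeq ℝ n)‖ ≤ ‖v t (sel v n t)‖ := by
  cases n with
  | zero => exact le_rfl
  | succ n =>
    simp only [sel]
    split_ifs with h
    · exact le_rfl
    · exact not_lt.1 h

lemma strich_sup (v : ℝ → ℝ → ℂ) (hv : Continuous fun p : ℝ × ℝ => v p.1 p.2) (T : ℝ) (K : ℝ≥0∞)
    (h : ∀ X : ℝ → ℝ, Measurable X →
      (∫⁻ t in Set.Ioo 0 T, ‖v t (X t)‖ₑ ^ (6 : ℝ)) ^ (1 / 6 : ℝ) ≤ K) :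
    (∫⁻ t in Set.Ioo 0 T, (⨆ x, ‖v t x‖ₑ) ^ (6 : ℝ)) ^ (1 / 6 : ℝ) ≤ K := by
  have hle : ∀ t, (⨆ x, ‖v t x‖ₑ) ^ (6 : ℝ) ≤ ⨆ n, ‖v t (sel v n t)‖ₑ ^ (6 : ℝ) := by
    intro t
    have : (⨆ n, ‖v t (sel v n t)‖ₑ ^ (6 : ℝ)) = (⨆ n, ‖v t (sel v n t)‖ₑ) ^ (6 : ℝ) := by
      rw [← ENNReal.orderIsoRpow_apply 6 (by norm_num), OrderIso.map_iSup]
      simp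
    rw [this]
    refine ENNReal.rpow_le_rpow (iSup_le fun x => ?_) (by norm_num)
    have hvt : Continuous fun x => ‖v t x‖ₑ := (hv.comp (Continuous.prodMk_right t)).enorm
    refine (TopologicalSpace.denseRange_denseSeq ℝ).induction_on
      (p := fun x => ‖v t x‖ₑ ≤ ⨆ n, ‖v t (sel v n t)‖ₑ) x (isClosed_le hvt continuous_const) fun n => ?_
    refine le_trans ?_ (le_iSup (fun n => ‖v t (sel v n t)‖ₑ) n)
    rw [← ofReal_norm, ← ofReal_norm]
    exact ENNReal.ofReal_le_ofReal (sel_ge v n t)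
  have hm : ∀ n, Measurable fun t => ‖v t (sel v n t)‖ₑ ^ (6 : ℝ) := fun n =>
    (hv.measurable.comp (measurable_id.prodMk (sel_measurable v hv n))).enorm.pow_const _
  have hmono : Monotone fun n t => ‖v t (sel v n t)‖ₑ ^ (6 : ℝ) := by
    refine monotone_nat_of_le_succ fun n t => ?_
    refine ENNReal.rpow_le_rpow ?_ (by norm_num)
    rw [← ofReal_norm, ← ofReal_norm]
    exact ENNReal.ofReal_le_ofReal (sel_mono v n t)
  have e : ∀ a b : ℝ≥0∞, a ^ (1 / 6 : ℝ) ≤ b ↔ a ≤ b ^ (6 : ℝ) := fun a b => by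
    rw [one_div]; exact ENNReal.rpow_inv_le_iff (by norm_num)
  rw [e]
  refine (lintegral_mono hle).trans ?_
  rw [lintegral_iSup hm hmono]
  exact iSup_le fun n => (e _ _).1 (h _ (sel_measurable v hv n))

lemma case_top (σ μ ε T : ℝ) (hσ : |σ| = 1) (hμ : 0 < μ) (hε : 0 < ε) (f : SchwartzMap ℝ ℂ) :
    (∫⁻ t in Set.Ioo 0 T, (eLpNorm (fmult1 (fun ξ => prop1 σ (t / ε) μ ξ) f) ⊤ volume) ^ (6 : ℝ)) ^ (1 / 6 : ℝ) ≤
      ENNReal.ofReal (27 * (ε / μ) ^ (1 / 6 : ℝ)) *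
        eLpNorm (fmult1 (fun ξ => (((1 + μ * ξ ^ 2) ^ (5 / 12 : ℝ) : ℝ) : ℂ)) f) 2 volume := by
  obtain ⟨gs, hgs⟩ := exists_schwartz_ft1 f
  have hg : Continuous (ft1 f) := by
    have : (gs : ℝ → ℂ) = ft1 f := funext hgs
    rw [← this]; exact gs.continuous
  have hgi : Integrable (ft1 f) := by
    have : (gs : ℝ → ℂ) = ft1 f := funext hgs
    rw [← this]; exact gs.integrable
  have ha : 0 < √μ := Real.sqrt_pos.2 hμ
  set θ : ℝ → ℝ := fun ξ => σ / (ε * √μ) * ph (√μ * ξ) with hθd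
  set W : ℝ → ℝ := fun ξ => ww (√μ * ξ) with hWd
  have hθ : Continuous θ := continuous_const.mul (ph_cont.comp (continuous_const.mul continuous_id))
  have hWc : Continuous W := ww_cont.comp (continuous_const.mul continuous_id)
  have hWi : Integrable W := ww_integrable.comp_mul_left' ha.ne'
  have hB := kernel_scaled σ μ ε hσ hμ hε
  have hsup := strich_sup (fun t x => uu θ (ft1 f) t x) (uu_cont θ hθ _ hg hgi) T _
    (fun X hX => strich_sel θ W hθ hWc (fun ξ => ww_pos _) hWi _ hB (ft1 f) hg hgi T X hX)
  have hQ : ∀ ξ, QQ (√μ * ξ) = 1 + μ * ξ ^ 2 / 3 := fun ξ => by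
    simp only [QQ, mul_pow, Real.sq_sqrt hμ.le]
  have hpt : ∀ t x, fmult1 (fun ξ => prop1 σ (t / ε) μ ξ) f x =
      (((2 * π) ^ (-(1 : ℝ) / 2) : ℝ) : ℂ) * uu θ (ft1 f) t x := by
    intro t x
    simp only [fmult1, uu]
    congr 2; ext ξ
    congr 1
    simp only [prop1, osc, hθd]
    rw [← Complex.exp_add, ← mul_add, ← Complex.ofReal_add]
    congr 4
    simp only [ph, hQ]
    rw [Real.rpow_neg (by positivity), ← Real.sqrt_eq_rpow]
    have : 0 < √(1 + μ * ξ ^ 2 / 3) := Real.sqrt_pos.2 (by positivity)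
    field_simp
  have hc : ‖(((2 * π) ^ (-(1 : ℝ) / 2) : ℝ) : ℂ)‖ₑ ≤ 1 := by
    rw [← ofReal_norm, Complex.norm_real, Real.norm_of_nonneg (by positivity)]
    refine ENNReal.ofReal_le_one.2 (Real.rpow_le_one_of_one_le_of_nonpos ?_ (by norm_num))
    linarith [Real.pi_gt_three]
  have hleft : ∀ t, eLpNorm (fmult1 (fun ξ => prop1 σ (t / ε) μ ξ) f) ⊤ volume ≤ ⨆ x, ‖uu θ (ft1 f) t x‖ₑ := by
    intro t
    rw [eLpNorm_exponent_top]
    refine essSup_le_of_ae_le _ (Filter.Eventually.of_forall fun x => ?_)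
    simp only [hpt, enorm_mul]
    calc _ ≤ 1 * ‖uu θ (ft1 f) t x‖ₑ := by gcongr
      _ ≤ _ := by rw [one_mul]; exact le_iSup (fun x => ‖uu θ (ft1 f) t x‖ₑ) x
  have hN : (∫⁻ ξ, ‖ft1 f ξ‖ₑ ^ (2 : ℝ) * ENNReal.ofReal (W ξ)⁻¹) ^ (1 / 2 : ℝ) ≤
      eLpNorm (fmult1 (fun ξ => (((1 + μ * ξ ^ 2) ^ (5 / 12 : ℝ) : ℝ) : ℂ)) f) 2 volume := by
    rw [plancherel (fun ξ => (((1 + μ * ξ ^ 2) ^ (5 / 12 : ℝ) : ℝ) : ℂ)) (Complex.ofRealCLM.hasTemperateGrowth.comp (hasTG_weight μ hμ.le (5 / 12)))]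
    rw [eLpNorm_eq_lintegral_rpow_enorm_toReal (by norm_num) (by norm_num)]
    simp only [ENNReal.toReal_ofNat]
    refine ENNReal.rpow_le_rpow (lintegral_mono fun ξ => ?_) (by norm_num)
    simp only [enorm_mul]
    rw [ENNReal.mul_rpow_of_nonneg _ _ (by norm_num), mul_comm]
    gcongr
    have hp : 0 < 1 + μ * ξ ^ 2 := by positivity
    rw [← ofReal_norm, Complex.norm_real, Real.norm_of_nonneg (by positivity),
      ENNReal.ofReal_rpow_of_nonneg (by positivity) (by norm_num), ← Real.rpow_mul hp.le]
    refine ENNReal.ofReal_le_ofReal ?_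
    simp only [hWd, ww, hQ]
    rw [Real.rpow_neg (by positivity), inv_inv]
    norm_num
    refine Real.rpow_le_rpow (by positivity) ?_ (by norm_num)
    nlinarith [mul_nonneg hμ.le (sq_nonneg ξ)]
  have hK : (10 * ENNReal.ofReal (72 * (ε / μ) ^ (1 / 3 : ℝ))) ^ (1 / 2 : ℝ) ≤
      ENNReal.ofReal (27 * (ε / μ) ^ (1 / 6 : ℝ)) := by
    have hr : 0 < ε / μ := by positivity
    have : (10 : ℝ≥0∞) = ENNReal.ofReal 10 := by simp
    rw [this, ← ENNReal.ofReal_mul (by norm_num), ENNReal.ofReal_rpow_of_nonneg (by positivity) (by norm_num)]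
    refine ENNReal.ofReal_le_ofReal ?_
    rw [← mul_assoc, Real.mul_rpow (by norm_num) (by positivity), ← Real.rpow_mul hr.le]
    norm_num
    gcongr
    have h27 : (27 : ℝ) = (27 ^ (2 : ℝ)) ^ (1 / 2 : ℝ) := by
      rw [← Real.rpow_mul (by norm_num)]; norm_num
    rw [h27]
    exact Real.rpow_le_rpow (by norm_num) (by norm_num) (by norm_num)
  refine (ENNReal.rpow_le_rpow (lintegral_mono fun t => ENNReal.rpow_le_rpow (hleft t) (by norm_num))
    (by norm_num)).trans (hsup.trans ?_)
  gcongr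

end PartF

/-- Homogeneous Strichartz estimate (4.10): for `(q̃,r̃) ∈ {(6,∞),(∞,2)}`,
`‖e^{±(t/ε)∂ₓ/√(1+μD²/3)} f‖_{L^{q̃}(0,T;L^{r̃})} ≤ C (ε/μ)^{(1/3)(1/2−1/r̃)}
‖(1+μD²)^{(5/6)(1/2−1/r̃)} f‖_{L²}`. -/
theorem stmt13 (σ : ℝ) (hσ : σ = 1 ∨ σ = -1) :
    ∃ C : ℝ, 0 < C ∧
      ∀ qr ∈ ({((6 : ℝ≥0∞), (⊤ : ℝ≥0∞)), ((⊤ : ℝ≥0∞), (2 : ℝ≥0∞))} : Set (ℝ≥0∞ × ℝ≥0∞)),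
        ∀ T : ℝ, 0 < T → ∀ μ ∈ Set.Ioc (0 : ℝ) 1, ∀ ε ∈ Set.Ioc (0 : ℝ) 1,
          ∀ f : SchwartzMap ℝ ℂ,
            timeLp qr.1 T
                (fun t => eLpNorm (fmult1 (fun ξ => prop1 σ (t / ε) μ ξ) ⇑f) qr.2 volume) ≤
              ENNReal.ofReal
                  (C * (ε / μ) ^ ((1 / 3) * (1 / 2 - (qr.2⁻¹).toReal))) *
                eLpNorm
                  (fmult1 (fun ξ =>
                    (((1 + μ * ξ ^ 2) ^ ((5 / 6) * (1 / 2 - (qr.2⁻¹).toReal)) : ℝ) : ℂ)) ⇑f)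
                  2 volume := by
  have hσ' : |σ| = 1 := by rcases hσ with h | h <;> simp [h]
  refine ⟨27, by norm_num, ?_⟩
  intro qr hqr T hT μ hμ ε hε f
  rcases hqr with rfl | h
  · have h := case_top σ μ ε T hσ' hμ.1 hε.1 f
    have e1 : (1 / 3 : ℝ) * (1 / 2 - ((⊤ : ℝ≥0∞)⁻¹).toReal) = 1 / 6 := by
      rw [ENNReal.inv_top, ENNReal.toReal_zero]; norm_num
    have e2 : (5 / 6 : ℝ) * (1 / 2 - ((⊤ : ℝ≥0∞)⁻¹).toReal) = 5 / 12 := by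
      rw [ENNReal.inv_top, ENNReal.toReal_zero]; norm_num
    simp only [e1, e2, timeLp]
    rw [if_neg (by norm_num), ENNReal.toReal_ofNat]
    exact h
  · rw [Set.mem_singleton_iff] at h
    subst h
    have e0 : (1 / 2 : ℝ) - ((2 : ℝ≥0∞)⁻¹).toReal = 0 := by
      rw [ENNReal.toReal_inv, ENNReal.toReal_ofNat]; norm_num
    simp only [e0, timeLp, if_true, mul_zero, Real.rpow_zero, Complex.ofReal_one, mul_one]
    refine essSup_le_of_ae_le _ (Filter.Eventually.of_forall fun t => ?_)
    simp only
    rw [case_two σ (t / ε) μ hμ.1.le f]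
    refine le_mul_of_one_le_left zero_le ?_
    rw [ENNReal.one_le_ofReal]; norm_num
end

section
/- Fix one of the two signs ±. There exists a constant C > 0 such that for every pair (q̃, r̃) ∈ {(6,∞), (∞,2)}, every T > 0, every μ ∈ (0,1], every ε ∈ (0,1] and every continuous map F from [0,T] into the Schwartz functions on ℝ, the function u(t,x) = ∫₀ᵗ (e^{±((t−s)/ε) ∂ₓ/√(1+μD²/3)} F(s))(x) ds satisfies ‖u‖_{L^{q̃}(0,T; L^{r̃}(ℝ))} ≤ C (ε/μ)^{(1/3)(1 − 1/r̃)} ‖(1 + μD²)^{(5/6)(1 − 1/r̃)} F‖_{L^{6/5}(0,T; L¹(ℝ))}, with the convention 1/∞ = 0. -/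
open MeasureTheory Real Complex
open scoped ENNReal

lemma vdc1 (φ φ1 φ2 : ℝ → ℝ) (h1 : ∀ x, HasDerivAt φ (φ1 x) x)
    (h2 : ∀ x, HasDerivAt φ1 (φ2 x) x) (hc : Continuous φ2) {a b ν : ℝ} (hab : a ≤ b)
    (hν : 0 < ν) (hneg : ∀ x ∈ Set.Icc a b, φ2 x ≤ 0) (hge : ∀ x ∈ Set.Icc a b, ν ≤ |φ1 x|) :
    ‖∫ x in a..b, Complex.exp (Complex.I * (φ x : ℂ))‖ ≤ 4 / ν := by
  have cφ : Continuous φ := continuous_iff_continuousAt.2 fun x => (h1 x).continuousAt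
  have cφ1 : Continuous φ1 := continuous_iff_continuousAt.2 fun x => (h2 x).continuousAt
  have hne : ∀ x ∈ Set.Icc a b, φ1 x ≠ 0 := fun x hx h => by
    have := hge x hx
    rw [h, abs_zero] at this
    linarith
  have hneC : ∀ x ∈ Set.Icc a b, (φ1 x : ℂ) ≠ 0 := fun x hx => by exact_mod_cast hne x hx
  have hinv : ∀ x ∈ Set.Icc a b, |(φ1 x)⁻¹| ≤ 1 / ν := fun x hx => by
    rw [abs_inv, one_div]
    exact inv_anti₀ hν (hge x hx)
  set E : ℝ → ℂ := fun x => Complex.exp (Complex.I * (φ x : ℂ)) with hE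
  have cE : Continuous E := by fun_prop
  have nE : ∀ x, ‖E x‖ = 1 := fun x => by
    simp only [hE]
    rw [mul_comm]; exact Complex.norm_exp_ofReal_mul_I _
  have dE : ∀ x, HasDerivAt E (E x * (Complex.I * (φ1 x : ℂ))) x := fun x => by
    exact ((h1 x).ofReal_comp.const_mul Complex.I).cexp
  set G : ℝ → ℂ := fun x => E x * (Complex.I * (φ1 x : ℂ))⁻¹ with hG
  set Q : ℝ → ℂ := fun x => E x * (-Complex.I) * ((φ2 x / (φ1 x) ^ 2 : ℝ) : ℂ) with hQ
  have dG : ∀ x ∈ Set.Icc a b, HasDerivAt G (E x - Q x) x := fun x hx => by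
    have h := (dE x).mul (((h2 x).ofReal_comp.const_mul Complex.I).inv
      (mul_ne_zero Complex.I_ne_zero (hneC x hx)))
    refine h.congr_deriv ?_
    have := hneC x hx
    simp only [hQ, Pi.inv_apply]
    push_cast
    have e : (Complex.I * (φ1 x : ℂ))⁻¹ = -Complex.I * (φ1 x : ℂ)⁻¹ := by
      rw [mul_inv, Complex.inv_I]
    rw [div_eq_mul_inv _ ((Complex.I * (φ1 x : ℂ)) ^ 2), ← inv_pow, e]
    have e2 : (φ1 x : ℂ) * (φ1 x : ℂ)⁻¹ = 1 := mul_inv_cancel₀ this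
    linear_combination (-E x * Complex.I ^ 2) * e2 + (-E x - E x * Complex.I * (φ2 x : ℂ) * (φ1 x : ℂ)⁻¹ ^ 2) * Complex.I_sq
  have cr : ContinuousOn (fun x => φ2 x / (φ1 x) ^ 2) (Set.Icc a b) :=
    hc.continuousOn.div (by fun_prop) (fun x hx => pow_ne_zero 2 (hne x hx))
  have cQ : ContinuousOn Q (Set.Icc a b) := by
    refine (cE.continuousOn.mul continuousOn_const).mul ?_
    exact Complex.continuous_ofReal.comp_continuousOn cr
  have iQ : IntervalIntegrable Q volume a b := by
    apply ContinuousOn.intervalIntegrable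
    rwa [Set.uIcc_of_le hab]
  have iE : IntervalIntegrable E volume a b := cE.intervalIntegrable _ _
  have e1 : ∫ x in a..b, (E x - Q x) = G b - G a :=
    intervalIntegral.integral_eq_sub_of_hasDerivAt
      (fun x hx => dG x (by rwa [Set.uIcc_of_le hab] at hx)) (iE.sub iQ)
  have e2 : ∫ x in a..b, E x = G b - G a + ∫ x in a..b, Q x := by
    rw [← e1, intervalIntegral.integral_sub iE iQ]; ring
  have dr : ∀ x ∈ Set.Icc a b, HasDerivAt (fun x => (φ1 x)⁻¹) (- (φ2 x / (φ1 x) ^ 2)) x :=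
    fun x hx => by
      refine ((h2 x).inv (hne x hx)).congr_deriv ?_
      ring
  have ir : IntervalIntegrable (fun x => - (φ2 x / (φ1 x) ^ 2)) volume a b := by
    apply ContinuousOn.intervalIntegrable
    rw [Set.uIcc_of_le hab]; exact cr.neg
  have e3 : ∫ x in a..b, - (φ2 x / (φ1 x) ^ 2) = (φ1 b)⁻¹ - (φ1 a)⁻¹ :=
    intervalIntegral.integral_eq_sub_of_hasDerivAt
      (fun x hx => dr x (by rwa [Set.uIcc_of_le hab] at hx)) ir
  have bQ : ‖∫ x in a..b, Q x‖ ≤ (φ1 b)⁻¹ - (φ1 a)⁻¹ := by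
    rw [← e3]
    refine intervalIntegral.norm_integral_le_of_norm_le hab ?_ ir
    refine Filter.Eventually.of_forall fun x hx => ?_
    have hx' : x ∈ Set.Icc a b := ⟨hx.1.le, hx.2⟩
    simp only [hQ]
    rw [norm_mul, norm_mul, nE, norm_neg, Complex.norm_I, one_mul, one_mul, Complex.norm_real,
      Real.norm_eq_abs, abs_of_nonpos]
    exact div_nonpos_of_nonpos_of_nonneg (hneg x hx') (sq_nonneg _)
  have nG : ∀ x ∈ Set.Icc a b, ‖G x‖ ≤ 1 / ν := fun x hx => by
    simp only [hG]
    rw [norm_mul, nE, one_mul, norm_inv, norm_mul, Complex.norm_I, one_mul, Complex.norm_real,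
      Real.norm_eq_abs, ← abs_inv]
    exact hinv x hx
  have ha : a ∈ Set.Icc a b := ⟨le_rfl, hab⟩
  have hb : b ∈ Set.Icc a b := ⟨hab, le_rfl⟩
  change ‖∫ x in a..b, E x‖ ≤ _
  rw [e2]
  have t1 := norm_add_le (G b - G a) (∫ x in a..b, Q x)
  have t2 := norm_sub_le (G b) (G a)
  have t3 := nG a ha
  have t4 := nG b hb
  have t5 := (abs_le.1 (hinv a ha)).1
  have t6 := (abs_le.1 (hinv b hb)).2
  have : 4 / ν = 1/ν + 1/ν + 1/ν + 1/ν := by ring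
  linarith

lemma norm_int_exp_le (φ : ℝ → ℝ) {a b : ℝ} (hab : a ≤ b) :
    ‖∫ x in a..b, Complex.exp (Complex.I * (φ x : ℂ))‖ ≤ b - a := by
  have := intervalIntegral.norm_integral_le_of_norm_le_const (a := a) (b := b) (C := 1)
    (f := fun x => Complex.exp (Complex.I * (φ x : ℂ))) (fun x _ => by
      rw [mul_comm]; exact (Complex.norm_exp_ofReal_mul_I _).le)
  rwa [one_mul, abs_of_nonneg (by linarith)] at this

lemma vdc2 (φ φ1 φ2 : ℝ → ℝ) (h1 : ∀ x, HasDerivAt φ (φ1 x) x)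
    (h2 : ∀ x, HasDerivAt φ1 (φ2 x) x) (hc : Continuous φ2) {a b δ : ℝ} (hab : a ≤ b)
    (hδ : 0 < δ) (hneg : ∀ x ∈ Set.Icc a b, φ2 x ≤ - (δ ^ 2)⁻¹) :
    ‖∫ x in a..b, Complex.exp (Complex.I * (φ x : ℂ))‖ ≤ 10 * δ := by
  have cφ : Continuous φ := continuous_iff_continuousAt.2 fun x => (h1 x).continuousAt
  have cφ1 : Continuous φ1 := continuous_iff_continuousAt.2 fun x => (h2 x).continuousAt
  set l := (δ ^ 2)⁻¹ with hl
  have hl0 : 0 < l := by positivity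
  have hlδ : l * δ = 1 / δ := by rw [hl]; field_simp
  have mono : ∀ x ∈ Set.Icc a b, ∀ y ∈ Set.Icc a b, x ≤ y → φ1 y ≤ φ1 x - l * (y - x) := by
    intro x hx y hy hxy
    have hh := Convex.image_sub_le_mul_sub_of_deriv_le (convex_Icc a b) (f := φ1)
      cφ1.continuousOn (fun x _ => (h2 x).differentiableAt.differentiableWithinAt)
      (C := -l) (fun x hx => by
        rw [(h2 x).deriv]; exact hneg x (interior_subset hx)) x hx y hy hxy
    linarith
  obtain ⟨c, hcI, hca, hcb⟩ : ∃ c ∈ Set.Icc a b, (c = a ∨ 0 ≤ φ1 c) ∧ (c = b ∨ φ1 c ≤ 0) := by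
    by_cases hA : φ1 a ≤ 0
    · exact ⟨a, ⟨le_rfl, hab⟩, Or.inl rfl, Or.inr hA⟩
    by_cases hB : 0 ≤ φ1 b
    · exact ⟨b, ⟨hab, le_rfl⟩, Or.inr hB, Or.inl rfl⟩
    push Not at hA hB
    obtain ⟨c, hc1, hc2⟩ := intermediate_value_Icc' hab cφ1.continuousOn ⟨hB.le, hA.le⟩
    exact ⟨c, hc1, Or.inr hc2.ge, Or.inr hc2.le⟩
  have hii : ∀ x y, IntervalIntegrable (fun x => Complex.exp (Complex.I * (φ x : ℂ))) volume x y :=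
    fun x y => Continuous.intervalIntegrable (by fun_prop) _ _
  set a' := max a (c - δ) with ha'
  set b' := min b (c + δ) with hb'
  have haa' : a ≤ a' := le_max_left _ _
  have hbb' : b' ≤ b := min_le_left _ _
  have ha'c : a' ≤ c := max_le hcI.1 (by linarith)
  have hb'c : c ≤ b' := le_min hcI.2 (by linarith)
  have ha'2 : c - δ ≤ a' := le_max_right _ _
  have hb'2 : b' ≤ c + δ := min_le_right _ _
  have B1 : ‖∫ x in a..a', Complex.exp (Complex.I * (φ x : ℂ))‖ ≤ 4 * δ := by
    by_cases h : c - δ ≤ a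
    · rw [ha', max_eq_left h]; simp; positivity
    push Not at h
    have : a' = c - δ := max_eq_right h.le
    have := vdc1 φ φ1 φ2 h1 h2 hc haa' (ν := 1 / δ) (by positivity)
      (fun x hx => (hneg x ⟨hx.1, by linarith [hx.2, hcI.2]⟩).trans (by linarith))
      (fun x hx => by
        have hxI : x ∈ Set.Icc a b := ⟨hx.1, by linarith [hx.2, hcI.2]⟩
        have m := mono x hxI c hcI (by linarith [hx.2])
        rcases hca with hca | hca
        · linarith
        refine le_trans ?_ (le_abs_self _)
        have : l * δ ≤ l * (c - x) := by gcongr; linarith [hx.2]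
        linarith)
    refine this.trans (le_of_eq ?_)
    field_simp
  have B3 : ‖∫ x in b'..b, Complex.exp (Complex.I * (φ x : ℂ))‖ ≤ 4 * δ := by
    by_cases h : b ≤ c + δ
    · rw [hb', min_eq_left h]; simp; positivity
    push Not at h
    have : b' = c + δ := min_eq_right h.le
    have := vdc1 φ φ1 φ2 h1 h2 hc hbb' (ν := 1 / δ) (by positivity)
      (fun x hx => (hneg x ⟨by linarith [hx.1, hcI.1], hx.2⟩).trans (by linarith))
      (fun x hx => by
        have hxI : x ∈ Set.Icc a b := ⟨by linarith [hx.1, hcI.1], hx.2⟩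
        have m := mono c hcI x hxI (by linarith [hx.1])
        rcases hcb with hcb | hcb
        · linarith
        refine le_trans ?_ (neg_le_abs _)
        have : l * δ ≤ l * (x - c) := by gcongr; linarith [hx.1]
        linarith)
    refine this.trans (le_of_eq ?_)
    field_simp
  have B2 := norm_int_exp_le φ (ha'c.trans hb'c)
  rw [← intervalIntegral.integral_add_adjacent_intervals (hii a a') (hii a' b),
    ← intervalIntegral.integral_add_adjacent_intervals (hii a' b') (hii b' b)]
  refine (norm_add_le _ _).trans ?_
  have := norm_add_le (∫ x in a'..b', Complex.exp (Complex.I * (φ x : ℂ)))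
    (∫ x in b'..b, Complex.exp (Complex.I * (φ x : ℂ)))
  linarith

/-- the phase function `η / √(1+η²/3)` -/
noncomputable def gph (x : ℝ) : ℝ := x / Real.sqrt (1 + x ^ 2 / 3)

lemma hasDerivAt_S (x : ℝ) : HasDerivAt (fun x : ℝ => Real.sqrt (1 + x ^ 2 / 3))
    (x / 3 / Real.sqrt (1 + x ^ 2 / 3)) x := by
  have h : HasDerivAt (fun x : ℝ => 1 + x ^ 2 / 3) (2 * x / 3) x := by
    have := ((hasDerivAt_pow 2 x).div_const 3).const_add 1
    refine this.congr_deriv ?_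
    norm_num
  refine (h.sqrt (by positivity)).congr_deriv ?_
  have : Real.sqrt (1 + x ^ 2 / 3) ≠ 0 := by positivity
  field_simp

lemma S_sq (x : ℝ) : Real.sqrt (1 + x ^ 2 / 3) ^ 2 = 1 + x ^ 2 / 3 :=
  Real.sq_sqrt (by positivity)

lemma hasDerivAt_gph (x : ℝ) : HasDerivAt gph ((Real.sqrt (1 + x ^ 2 / 3) ^ 3)⁻¹) x := by
  have hS : Real.sqrt (1 + x ^ 2 / 3) ≠ 0 := by positivity
  refine ((hasDerivAt_id x).div (hasDerivAt_S x) hS).congr_deriv ?_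
  have h2 := S_sq x
  simp only [id]
  generalize Real.sqrt (1 + x ^ 2 / 3) = S at *
  field_simp
  linear_combination 3 * h2

lemma hasDerivAt_gph1 (x : ℝ) : HasDerivAt (fun x : ℝ => (Real.sqrt (1 + x ^ 2 / 3) ^ 3)⁻¹)
    (- (x / Real.sqrt (1 + x ^ 2 / 3) ^ 5)) x := by
  have hS : Real.sqrt (1 + x ^ 2 / 3) ≠ 0 := by positivity
  refine (((hasDerivAt_S x).pow 3).inv (pow_ne_zero 3 hS)).congr_deriv ?_
  simp only [Pi.pow_apply]
  field_simp
  ring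

lemma S5_le_one {x : ℝ} (h0 : 0 ≤ x) (h : x ≤ 1) : Real.sqrt (1 + x ^ 2 / 3) ^ 5 ≤ 3 := by
  have h1 : Real.sqrt (1 + x ^ 2 / 3) ≤ 6 / 5 := by
    apply Real.sqrt_le_iff.2
    constructor
    · norm_num
    · nlinarith
  calc _ ≤ (6 / 5 : ℝ) ^ 5 := by gcongr
    _ ≤ 3 := by norm_num

lemma S5_le_of_one_le {x : ℝ} (h : 1 ≤ x) : Real.sqrt (1 + x ^ 2 / 3) ^ 5 ≤ 3 * x ^ 5 := by
  have h1 : Real.sqrt (1 + x ^ 2 / 3) ≤ 6 / 5 * x := by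
    apply Real.sqrt_le_iff.2
    constructor
    · positivity
    · nlinarith
  calc _ ≤ (6 / 5 * x : ℝ) ^ 5 := by gcongr
    _ = (6 / 5) ^ 5 * x ^ 5 := by ring
    _ ≤ 3 * x ^ 5 := by gcongr; norm_num

lemma osc_partial (y κ x : ℝ) (hκ : 1 ≤ κ) (hx : 0 ≤ x) :
    ‖∫ η in (0:ℝ)..x, Complex.exp (Complex.I * ((y * η + κ ^ 6 * gph η : ℝ) : ℂ))‖ ≤
      21 / κ ^ 2 + 20 / κ ^ 3 * x ^ 2 := by
  have hκ0 : 0 < κ := by linarith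
  set r := 1 / κ ^ 2 with hr
  have hr0 : 0 < r := by positivity
  set φ : ℝ → ℝ := fun η => y * η + κ ^ 6 * gph η with hφ
  have h1 : ∀ x, HasDerivAt φ (y + κ ^ 6 * (Real.sqrt (1 + x ^ 2 / 3) ^ 3)⁻¹) x := fun x => by
    refine (((hasDerivAt_id x).const_mul y).add ((hasDerivAt_gph x).const_mul (κ ^ 6))).congr_deriv ?_
    ring
  have h2 : ∀ x, HasDerivAt (fun x : ℝ => y + κ ^ 6 * (Real.sqrt (1 + x ^ 2 / 3) ^ 3)⁻¹)
      (κ ^ 6 * (- (x / Real.sqrt (1 + x ^ 2 / 3) ^ 5))) x := fun x =>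
    ((hasDerivAt_gph1 x).const_mul (κ ^ 6)).const_add y
  have hc : Continuous fun x : ℝ => κ ^ 6 * (- (x / Real.sqrt (1 + x ^ 2 / 3) ^ 5)) := by
    refine continuous_const.mul (Continuous.neg (continuous_id.div (by fun_prop) fun x => ?_))
    positivity
  have cφ : Continuous φ := continuous_iff_continuousAt.2 fun x => (h1 x).continuousAt
  have hii : ∀ x y, IntervalIntegrable (fun x => Complex.exp (Complex.I * (φ x : ℂ))) volume x y :=
    fun x y => Continuous.intervalIntegrable (by fun_prop) _ _
  change ‖∫ η in (0:ℝ)..x, Complex.exp (Complex.I * (φ η : ℂ))‖ ≤ _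
  by_cases hxr : x ≤ r
  · refine (norm_int_exp_le φ hx).trans ?_
    have : r ≤ 21 / κ ^ 2 := by rw [hr]; gcongr; norm_num
    have : 0 ≤ 20 / κ ^ 3 * x ^ 2 := by positivity
    linarith
  push Not at hxr
  rw [← intervalIntegral.integral_add_adjacent_intervals (hii 0 r) (hii r x)]
  have B1 := norm_int_exp_le φ hr0.le
  set M := κ + x ^ 2 with hM
  have hM0 : 0 < M := by positivity
  have B2 := vdc2 φ _ _ h1 h2 hc hxr.le (δ := 2 * M / κ ^ 3) (by positivity) (by
    intro η hη
    have hη0 : 0 < η := hr0.trans_le hη.1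
    have key : (3 * M ^ 2)⁻¹ ≤ η / Real.sqrt (1 + η ^ 2 / 3) ^ 5 := by
      rw [inv_eq_one_div, div_le_div_iff₀ (by positivity) (by positivity), one_mul]
      by_cases h : η ≤ 1
      · have a1 := S5_le_one hη0.le h
        have a2 : κ ^ 2 ≤ M ^ 2 := by gcongr; rw [hM]; nlinarith
        have a3 : 1 ≤ η * κ ^ 2 := by
          have := hη.1
          rw [hr, div_le_iff₀ (by positivity)] at this
          exact this
        nlinarith [mul_le_mul_of_nonneg_left a2 hη0.le]
      · push Not at h
        have a1 := S5_le_of_one_le h.le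
        have a2 : η ^ 2 ≤ M := by
          have : η ^ 2 ≤ x ^ 2 := by gcongr; exact hη.2
          rw [hM]; linarith
        have a3 : η ^ 5 ≤ η * M ^ 2 := by
          calc η ^ 5 = η * (η ^ 2) ^ 2 := by ring
            _ ≤ _ := by gcongr
        linarith
    have : ((2 * M / κ ^ 3) ^ 2)⁻¹ ≤ κ ^ 6 * (3 * M ^ 2)⁻¹ := by
      have e : ((2 * M / κ ^ 3) ^ 2)⁻¹ = κ ^ 6 * (4 * M ^ 2)⁻¹ := by field_simp; norm_num
      rw [e]
      gcongr
      norm_num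
    have := mul_le_mul_of_nonneg_left key (by positivity : 0 ≤ κ ^ 6)
    linarith)
  refine (norm_add_le _ _).trans ?_
  have e : 21 / κ ^ 2 + 20 / κ ^ 3 * x ^ 2 = r + 10 * (2 * M / κ ^ 3) := by
    rw [hr, hM]; field_simp; ring
  linarith

/-- amplitude -/
noncomputable def amp (x : ℝ) : ℝ := (1 + x ^ 2) ^ (-(5/6) : ℝ)

lemma amp_pos (x : ℝ) : 0 < amp x := by unfold amp; positivity

lemma amp_cont : Continuous amp := by
  unfold amp
  refine Continuous.rpow_const (by fun_prop) fun x => Or.inl (by positivity)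

lemma amp_integrable : Integrable amp := by
  have := integrable_rpow_neg_one_add_norm_sq (E := ℝ) (μ := volume) (r := 5/3) (by simp; norm_num)
  refine this.congr (Filter.Eventually.of_forall fun x => ?_)
  simp [amp]; norm_num

lemma hasDerivAt_pw (x p : ℝ) : HasDerivAt (fun x : ℝ => (1 + x ^ 2) ^ p)
    (2 * p * x * (1 + x ^ 2) ^ (p - 1)) x := by
  have h : HasDerivAt (fun x : ℝ => 1 + x ^ 2) (2 * x) x := by
    have := (hasDerivAt_pow 2 x).const_add 1
    refine this.congr_deriv ?_
    norm_num
  refine (h.rpow_const (p := p) (Or.inl (by positivity))).congr_deriv ?_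
  ring

lemma amp_tail (κ : ℝ) (hκ : 1 ≤ κ) : ∫ x in Set.Ioi (κ ^ 3), amp x ≤ 3 / 2 / κ ^ 2 := by
  have hκ0 : 0 < κ := by linarith
  have hp : 0 < κ ^ 3 := by positivity
  have h := integral_Ioi_rpow_of_lt (a := -(5/3)) (by norm_num) hp
  have e : -(κ ^ 3) ^ (-(5/3) + 1 : ℝ) / (-(5/3) + 1) = 3 / 2 / κ ^ 2 := by
    rw [← Real.rpow_natCast κ 3, ← Real.rpow_mul hκ0.le, ← Real.rpow_natCast κ 2]
    norm_num
    ring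
  rw [← e, ← h]
  refine setIntegral_mono_on amp_integrable.integrableOn
    (integrableOn_Ioi_rpow_of_lt (by norm_num) hp) measurableSet_Ioi fun x hx => ?_
  have hx0 : 0 < x := hp.trans hx
  unfold amp
  have : x ^ (-(5/3) : ℝ) = (x ^ 2) ^ (-(5/6) : ℝ) := by
    rw [← Real.rpow_natCast x 2, ← Real.rpow_mul hx0.le]; norm_num
  rw [this]
  apply Real.rpow_le_rpow_of_nonpos (by positivity) (by linarith) (by norm_num)

lemma osc_mid (y κ : ℝ) (hκ : 1 ≤ κ) :
    ‖∫ η in (0:ℝ)..(κ ^ 3), Complex.exp (Complex.I * ((y * η + κ ^ 6 * gph η : ℝ) : ℂ)) * (amp η : ℂ)‖ ≤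
      300 / κ ^ 2 := by
  have hκ0 : 0 < κ := by linarith
  have cg : Continuous gph := continuous_iff_continuousAt.2 fun x => (hasDerivAt_gph x).continuousAt
  set R := κ ^ 3 with hR
  have hR0 : 0 ≤ R := by positivity
  set E : ℝ → ℂ := fun η => Complex.exp (Complex.I * ((y * η + κ ^ 6 * gph η : ℝ) : ℂ)) with hE
  have cE : Continuous E := by fun_prop
  set P : ℝ → ℂ := fun x => ∫ η in (0:ℝ)..x, E η with hP
  have dP : ∀ x, HasDerivAt P (E x) x := fun x =>
    intervalIntegral.integral_hasDerivAt_right (cE.intervalIntegrable _ _)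
      cE.aestronglyMeasurable.stronglyMeasurableAtFilter cE.continuousAt
  have cP : Continuous P := continuous_iff_continuousAt.2 fun x => (dP x).continuousAt
  set a1 : ℝ → ℝ := fun x => 2 * (-(5/6)) * x * (1 + x ^ 2) ^ (-(5/6) - 1 : ℝ) with ha1
  have da : ∀ x, HasDerivAt amp (a1 x) x := fun x => hasDerivAt_pw x _
  have ca1 : Continuous a1 := by
    refine Continuous.mul (by fun_prop) ?_
    exact Continuous.rpow_const (by fun_prop) fun x => Or.inl (by positivity)
  have ibp := intervalIntegral.integral_mul_deriv_eq_deriv_mul (a := 0) (b := R)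
    (u := fun x => (amp x : ℂ)) (v := P) (u' := fun x => (a1 x : ℂ)) (v' := E)
    (fun x _ => (da x).ofReal_comp) (fun x _ => dP x)
    (Continuous.intervalIntegrable (by fun_prop) _ _) (cE.intervalIntegrable _ _)
  have e0 : ∫ η in (0:ℝ)..R, E η * (amp η : ℂ) = ∫ η in (0:ℝ)..R, (amp η : ℂ) * E η := by
    congr 1; ext; ring
  rw [e0, ibp]
  have hP0 : P 0 = 0 := by simp [hP]
  rw [hP0, mul_zero, sub_zero]
  set B : ℝ → ℝ := fun x => 21 / κ ^ 2 + 20 / κ ^ 3 * x ^ 2 with hB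
  have bP : ∀ x, 0 ≤ x → ‖P x‖ ≤ B x := fun x hx => osc_partial y κ x hκ hx
  set H : ℝ → ℝ := fun x => -(B x * amp x) + 120 / κ ^ 3 * (1 + x ^ 2) ^ (1/6 : ℝ) with hH
  have dB : ∀ x, HasDerivAt B (20 / κ ^ 3 * (2 * x)) x := fun x => by
    have := ((hasDerivAt_pow 2 x).const_mul (20 / κ ^ 3)).const_add (21 / κ ^ 2)
    refine this.congr_deriv ?_
    norm_num
  have cB : Continuous B := by fun_prop
  have dH : ∀ x, HasDerivAt H (B x * (- a1 x)) x := fun x => by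
    refine (((dB x).mul (da x)).neg.add
      ((hasDerivAt_pw x (1/6)).const_mul (120 / κ ^ 3))).congr_deriv ?_
    have : amp x = (1 + x ^ 2) ^ (1/6 - 1 : ℝ) := by unfold amp; norm_num
    rw [← this]
    ring
  have eH : ∫ x in (0:ℝ)..R, B x * (- a1 x) = H R - H 0 :=
    intervalIntegral.integral_eq_sub_of_hasDerivAt (fun x _ => dH x)
      (Continuous.intervalIntegrable (by fun_prop) _ _)
  have b2 : ‖∫ x in (0:ℝ)..R, (a1 x : ℂ) * P x‖ ≤ H R - H 0 := by
    rw [← eH]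
    refine intervalIntegral.norm_integral_le_of_norm_le hR0 ?_
      (Continuous.intervalIntegrable (by fun_prop) _ _)
    refine Filter.Eventually.of_forall fun x hx => ?_
    have : a1 x ≤ 0 := by
      have : 0 ≤ x * (1 + x ^ 2) ^ (-(5/6) - 1 : ℝ) := mul_nonneg hx.1.le (by positivity)
      simp only [ha1]; nlinarith
    rw [norm_mul, Complex.norm_real, Real.norm_eq_abs, abs_of_nonpos this, mul_comm]
    exact mul_le_mul_of_nonneg_right (bP x hx.1.le) (by linarith)
  have b1 : ‖(amp R : ℂ) * P R‖ ≤ B R * amp R := by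
    rw [norm_mul, Complex.norm_real, Real.norm_eq_abs, abs_of_pos (amp_pos R), mul_comm]
    exact mul_le_mul_of_nonneg_right (bP R hR0) (amp_pos R).le
  have hH0 : H 0 = -(21 / κ ^ 2) + 120 / κ ^ 3 := by simp [hH, hB, amp]
  have hHR : (1 + R ^ 2) ^ (1/6 : ℝ) ≤ 2 * κ := by
    have : 1 + R ^ 2 ≤ (2 * κ) ^ 6 := by
      have : 1 ≤ κ ^ 6 := one_le_pow₀ hκ
      rw [hR]; nlinarith
    calc (1 + R ^ 2) ^ (1/6 : ℝ) ≤ ((2 * κ) ^ 6) ^ (1/6 : ℝ) :=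
          Real.rpow_le_rpow (by positivity) this (by norm_num)
      _ = 2 * κ := by
        rw [← Real.rpow_natCast, ← Real.rpow_mul (by positivity)]; norm_num
  refine (norm_sub_le _ _).trans ?_
  have h3 : H R ≤ -(B R * amp R) + 120 / κ ^ 3 * (2 * κ) := by
    simp only [hH]; gcongr
  have h4 : 120 / κ ^ 3 * (2 * κ) = 240 / κ ^ 2 := by field_simp; norm_num
  have h5 : 0 < 120 / κ ^ 3 := by positivity
  have h6 : 300 / κ ^ 2 = 240 / κ ^ 2 + 21 / κ ^ 2 + 39 / κ ^ 2 := by ring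
  have h7 : 0 < 39 / κ ^ 2 := by positivity
  linarith

lemma osc_half (y κ : ℝ) (hκ : 0 < κ) :
    ‖∫ η in Set.Ioi (0:ℝ), Complex.exp (Complex.I * ((y * η + κ ^ 6 * gph η : ℝ) : ℂ)) * (amp η : ℂ)‖ ≤
      (302 + ∫ x, amp x) / κ ^ 2 := by
  have cg : Continuous gph := continuous_iff_continuousAt.2 fun x => (hasDerivAt_gph x).continuousAt
  have cg := amp_cont
  set f : ℝ → ℂ := fun η => Complex.exp (Complex.I * ((y * η + κ ^ 6 * gph η : ℝ) : ℂ)) * (amp η : ℂ)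
    with hf
  have nf : ∀ x, ‖f x‖ = amp x := fun x => by
    simp only [hf]
    rw [norm_mul, mul_comm Complex.I, Complex.norm_exp_ofReal_mul_I, one_mul, Complex.norm_real,
      Real.norm_eq_abs, abs_of_pos (amp_pos x)]
  have fi : Integrable f := by
    refine amp_integrable.mono' (Continuous.aestronglyMeasurable (by fun_prop))
      (Filter.Eventually.of_forall fun x => (nf x).le)
  have hA : 0 ≤ ∫ x, amp x := integral_nonneg fun x => (amp_pos x).le
  have hle : ∀ s : Set ℝ, ‖∫ x in s, f x‖ ≤ ∫ x in s, amp x := fun s => by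
    refine (norm_integral_le_integral_norm _).trans (le_of_eq ?_)
    simp_rw [nf]
  have hs : ∀ s : Set ℝ, ∫ x in s, amp x ≤ ∫ x, amp x := fun s =>
    setIntegral_le_integral amp_integrable (Filter.Eventually.of_forall fun x => (amp_pos x).le)
  by_cases h1 : 1 ≤ κ
  · have hR : 0 ≤ κ ^ 3 := by positivity
    have e := intervalIntegral.integral_interval_add_Ioi (μ := volume) (f := f) (a := 0) (b := κ ^ 3)
      fi.integrableOn fi.integrableOn
    rw [← e]
    refine (norm_add_le _ _).trans ?_
    have b1 := osc_mid y κ h1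
    have b2 := (hle (Set.Ioi (κ ^ 3))).trans (amp_tail κ h1)
    have e1 : (302 + ∫ x, amp x) / κ ^ 2 = 300 / κ ^ 2 + 3/2 / κ ^ 2 + (1/2 + ∫ x, amp x) / κ ^ 2 := by
      ring
    have : 0 ≤ (1/2 + ∫ x, amp x) / κ ^ 2 := by positivity
    linarith
  · push Not at h1
    refine ((hle _).trans (hs _)).trans ?_
    rw [le_div_iff₀ (by positivity)]
    have : κ ^ 2 ≤ 1 := pow_le_one₀ hκ.le h1.le
    nlinarith

lemma gph_neg (x : ℝ) : gph (-x) = - gph x := by simp [gph, neg_div]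
lemma amp_neg (x : ℝ) : amp (-x) = amp x := by simp [amp]

/-- the dispersive estimate for the rescaled kernel. -/
lemma dispersive : ∃ C : ℝ, 0 < C ∧ ∀ y θ : ℝ, θ ≠ 0 →
    ‖∫ η : ℝ, Complex.exp (Complex.I * ((y * η + θ * gph η : ℝ) : ℂ)) * (amp η : ℂ)‖ ≤
      C * |θ| ^ (-(1/3) : ℝ) := by
  have cg : Continuous gph := continuous_iff_continuousAt.2 fun x => (hasDerivAt_gph x).continuousAt
  have cg' := amp_cont
  have hA : 0 ≤ ∫ x, amp x := integral_nonneg fun x => (amp_pos x).le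
  refine ⟨2 * (302 + ∫ x, amp x), by positivity, ?_⟩
  have pos : ∀ y θ : ℝ, 0 < θ →
    ‖∫ η : ℝ, Complex.exp (Complex.I * ((y * η + θ * gph η : ℝ) : ℂ)) * (amp η : ℂ)‖ ≤
      2 * (302 + ∫ x, amp x) * |θ| ^ (-(1/3) : ℝ) := by
    intro y θ hθ
    set κ := θ ^ (1/6 : ℝ) with hκ
    have hκ0 : 0 < κ := by positivity
    have e6 : κ ^ 6 = θ := by
      rw [hκ, ← Real.rpow_natCast, ← Real.rpow_mul hθ.le]; norm_num
    have e2 : |θ| ^ (-(1/3) : ℝ) = 1 / κ ^ 2 := by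
      rw [abs_of_pos hθ, hκ, ← Real.rpow_natCast, ← Real.rpow_mul hθ.le, Real.rpow_neg hθ.le]
      norm_num
    have hh := osc_half y κ hκ0
    rw [e6] at hh
    set f : ℝ → ℂ := fun η => Complex.exp (Complex.I * ((y * η + θ * gph η : ℝ) : ℂ)) * (amp η : ℂ)
      with hf
    have nf : ∀ x, ‖f x‖ = amp x := fun x => by
      simp only [hf]
      rw [norm_mul, mul_comm Complex.I, Complex.norm_exp_ofReal_mul_I, one_mul, Complex.norm_real,
        Real.norm_eq_abs, abs_of_pos (amp_pos x)]
    have fi : Integrable f := by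
      refine amp_integrable.mono' (Continuous.aestronglyMeasurable (by fun_prop))
        (Filter.Eventually.of_forall fun x => (nf x).le)
    have hconj : ∀ x, f (-x) = (starRingEnd ℂ) (f x) := fun x => by
      simp only [hf, gph_neg, amp_neg, map_mul, ← Complex.exp_conj, Complex.conj_I,
        Complex.conj_ofReal]
      congr 2
      push_cast
      ring
    have e3 : ∫ x in Set.Iic (0:ℝ), f x = (starRingEnd ℂ) (∫ x in Set.Ioi (0:ℝ), f x) := by
      rw [← integral_conj]
      have := integral_comp_neg_Ioi (0:ℝ) f
      rw [neg_zero] at this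
      rw [← this]
      simp_rw [hconj]
    have e4 := intervalIntegral.integral_Iic_add_Ioi (μ := volume) (f := f) (b := 0) fi.integrableOn fi.integrableOn
    rw [← e4, e3]
    refine (norm_add_le _ _).trans ?_
    rw [RCLike.norm_conj, e2]
    have : 2 * (302 + ∫ x, amp x) * (1 / κ ^ 2) = (302 + ∫ x, amp x) / κ ^ 2 + (302 + ∫ x, amp x) / κ ^ 2 := by
      ring
    linarith
  intro y θ hθ
  rcases lt_or_gt_of_ne hθ with h | h
  · have := pos (-y) (-θ) (by linarith)
    rw [abs_neg] at this
    refine le_trans (le_of_eq ?_) this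
    rw [← integral_neg_eq_self]
    congr 2
    ext x
    rw [gph_neg, amp_neg]
    congr 4
    ring
  · exact pos y θ h

/-- the kernel `|t-s|^{-1/3}` -/
noncomputable def kk (t s : ℝ) : ℝ≥0∞ := ENNReal.ofReal |t - s| ^ (-(1/3) : ℝ)

lemma kk_comm (t s : ℝ) : kk t s = kk s t := by unfold kk; rw [abs_sub_comm]

lemma kk_meas : Measurable (fun p : ℝ × ℝ => kk p.1 p.2) := by
  unfold kk; fun_prop

lemma lintegral_even_le (f : ℝ → ℝ≥0∞) (hf : Measurable f) (s : ℝ) :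
    ∫⁻ t, f |t - s| ≤ 2 * ∫⁻ x in Set.Ioi 0, f x := by
  rw [lintegral_sub_right_eq_self (fun t => f |t|) s]
  rw [← lintegral_add_compl (fun t => f |t|) (measurableSet_Ioi (a := (0:ℝ))), two_mul]
  have h1 : ∫⁻ x in Set.Ioi 0, f |x| = ∫⁻ x in Set.Ioi 0, f x :=
    setLIntegral_congr_fun measurableSet_Ioi fun x hx => by
      change f |x| = f x
      rw [abs_of_pos hx]
  have h2 : ∫⁻ x in (Set.Ioi 0)ᶜ, f |x| = ∫⁻ x in Set.Ioi 0, f x := by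
    rw [Set.compl_Ioi, ← h1, setLIntegral_congr Iio_ae_eq_Iic.symm,
      ← lintegral_indicator measurableSet_Iio, ← lintegral_indicator measurableSet_Ioi,
      ← lintegral_neg_eq_self]
    congr 1
    ext x
    by_cases hx : 0 < x
    · simp [Set.indicator, hx]
    · simp [Set.indicator, hx]
  rw [h1, h2]

lemma near_int (R : ℝ) (hR : 0 < R) (s : ℝ) :
    ∫⁻ t in {t | |t - s| ≤ R}, kk t s ≤ ENNReal.ofReal (3 * R ^ (2/3 : ℝ)) := by
  have hm : MeasurableSet {t | |t - s| ≤ R} := measurableSet_le (by fun_prop) measurable_const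
  set f : ℝ → ℝ≥0∞ := (Set.Iic R).indicator fun x => ENNReal.ofReal x ^ (-(1/3) : ℝ) with hf
  have hfm : Measurable f := Measurable.indicator (by fun_prop) measurableSet_Iic
  have e1 : ∫⁻ t in {t | |t - s| ≤ R}, kk t s = ∫⁻ t, f |t - s| := by
    rw [← lintegral_indicator hm]
    rfl
  rw [e1]
  refine (lintegral_even_le f hfm s).trans ?_
  have e2 : ∫⁻ x in Set.Ioi 0, f x = ∫⁻ x in Set.Ioc 0 R, ENNReal.ofReal (x ^ (-(1/3) : ℝ)) := by
    rw [hf, lintegral_indicator measurableSet_Iic, Measure.restrict_restrict measurableSet_Iic,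
      Set.inter_comm, Set.Ioi_inter_Iic]
    refine setLIntegral_congr_fun measurableSet_Ioc fun x hx => ?_
    exact ENNReal.ofReal_rpow_of_pos hx.1
  have ii : IntervalIntegrable (fun x : ℝ => x ^ (-(1/3) : ℝ)) volume 0 R :=
    intervalIntegral.intervalIntegrable_rpow' (by norm_num)
  rw [e2, ← ofReal_integral_eq_lintegral_ofReal
    ((intervalIntegrable_iff_integrableOn_Ioc_of_le hR.le).1 ii)
    ((ae_restrict_mem measurableSet_Ioc).mono fun x hx => Real.rpow_nonneg hx.1.le _),
    ← intervalIntegral.integral_of_le hR.le, integral_rpow (Or.inl (by norm_num))]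
  rw [show (2:ℝ≥0∞) = ENNReal.ofReal 2 by simp, ← ENNReal.ofReal_mul (by norm_num)]
  apply ENNReal.ofReal_le_ofReal
  norm_num
  linarith

lemma far_int (R : ℝ) (hR : 0 < R) (s : ℝ) :
    ∫⁻ t in {t | R < |t - s|}, kk t s ^ (6:ℝ) ≤ ENNReal.ofReal (2 / R) := by
  have hm : MeasurableSet {t | R < |t - s|} := measurableSet_lt measurable_const (by fun_prop)
  set f : ℝ → ℝ≥0∞ := (Set.Ioi R).indicator fun x => (ENNReal.ofReal x ^ (-(1/3) : ℝ)) ^ (6:ℝ) with hf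
  have hfm : Measurable f := Measurable.indicator (by fun_prop) measurableSet_Ioi
  have e1 : ∫⁻ t in {t | R < |t - s|}, kk t s ^ (6:ℝ) = ∫⁻ t, f |t - s| := by
    rw [← lintegral_indicator hm]
    rfl
  rw [e1]
  refine (lintegral_even_le f hfm s).trans ?_
  have e2 : ∫⁻ x in Set.Ioi 0, f x = ∫⁻ x in Set.Ioi R, ENNReal.ofReal (x ^ (-2 : ℝ)) := by
    rw [hf, lintegral_indicator measurableSet_Ioi, Measure.restrict_restrict measurableSet_Ioi,
      Set.Ioi_inter_Ioi, max_eq_left hR.le]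
    refine setLIntegral_congr_fun measurableSet_Ioi fun x hx => ?_
    change (ENNReal.ofReal x ^ (-(1/3) : ℝ)) ^ (6:ℝ) = _
    rw [← ENNReal.rpow_mul, ENNReal.ofReal_rpow_of_pos (hR.trans hx)]
    norm_num
  rw [e2, ← ofReal_integral_eq_lintegral_ofReal
    (integrableOn_Ioi_rpow_of_lt (by norm_num) hR)
    ((ae_restrict_mem measurableSet_Ioi).mono fun x hx => Real.rpow_nonneg (hR.trans hx).le _),
    integral_Ioi_rpow_of_lt (by norm_num) hR]
  rw [show (2:ℝ≥0∞) = ENNReal.ofReal 2 by simp, ← ENNReal.ofReal_mul (by norm_num)]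
  apply ENNReal.ofReal_le_ofReal
  norm_num
  rw [Real.rpow_neg hR.le]
  simp [div_eq_mul_inv]

lemma hlsA (h : ℝ → ℝ≥0∞) (hh : Measurable h) (h1 : ∫⁻ t, h t ^ (6/5 : ℝ) ≤ 1) (s : ℝ) (a : ℝ≥0∞) :
    ∫⁻ t in {t | h t ≤ a}, kk t s * h t ≤ 5 * a ^ (1/5 : ℝ) := by
  have hm : MeasurableSet {t | h t ≤ a} := measurableSet_le hh measurable_const
  have km : Measurable fun t => kk t s := kk_meas.comp (by fun_prop : Measurable fun t : ℝ => (t, s))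
  by_cases ha0 : a = 0
  · rw [setLIntegral_congr_fun (g := fun _ => 0) hm fun t ht => by
      simp only [Set.mem_ofPred_eq, ha0, nonpos_iff_eq_zero] at ht
      simp [ht]]
    simp
  by_cases hat : a = ⊤
  · rw [hat, ENNReal.top_rpow_of_pos (by norm_num)]
    simp
  obtain ⟨r, rfl⟩ : ∃ r : ℝ, a = ENNReal.ofReal r := ⟨a.toReal, (ENNReal.ofReal_toReal hat).symm⟩
  have hr : 0 < r := by
    by_contra h; exact ha0 (ENNReal.ofReal_eq_zero.2 (not_lt.1 h))
  set R := r ^ (-(6/5) : ℝ) with hR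
  have hR0 : 0 < R := by positivity
  set N := {t | |t - s| ≤ R} with hN
  have hNm : MeasurableSet N := measurableSet_le (by fun_prop) measurable_const
  have hNc : Nᶜ = {t | R < |t - s|} := by ext; simp [hN]
  rw [← lintegral_inter_add_sdiff _ _ hNm]
  have b1 : ∫⁻ t in {t | h t ≤ ENNReal.ofReal r} ∩ N, kk t s * h t ≤ ENNReal.ofReal (3 * r ^ (1/5 : ℝ)) := by
    calc _ ≤ ∫⁻ t in {t | h t ≤ ENNReal.ofReal r} ∩ N, kk t s * ENNReal.ofReal r := by
          refine setLIntegral_mono' (hm.inter hNm) fun t ht => ?_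
          gcongr
          exact ht.1
      _ ≤ ∫⁻ t in N, kk t s * ENNReal.ofReal r := lintegral_mono_set Set.inter_subset_right
      _ = (∫⁻ t in N, kk t s) * ENNReal.ofReal r := lintegral_mul_const _ km
      _ ≤ ENNReal.ofReal (3 * R ^ (2/3 : ℝ)) * ENNReal.ofReal r := by
          gcongr; exact near_int R hR0 s
      _ = _ := by
          rw [← ENNReal.ofReal_mul (by positivity)]
          congr 1
          rw [hR, ← Real.rpow_mul hr.le, mul_assoc]
          nth_rewrite 2 [← Real.rpow_one r]
          rw [← Real.rpow_add hr]
          norm_num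
  have b2 : ∫⁻ t in {t | h t ≤ ENNReal.ofReal r} \ N, kk t s * h t ≤ ENNReal.ofReal (2 * r ^ (1/5 : ℝ)) := by
    calc _ ≤ ∫⁻ t in Nᶜ, kk t s * h t := lintegral_mono_set fun x hx => hx.2
      _ ≤ (∫⁻ t in Nᶜ, kk t s ^ (6:ℝ)) ^ (1/(6:ℝ)) * (∫⁻ t in Nᶜ, h t ^ (6/5:ℝ)) ^ (1/(6/5:ℝ)) :=
          ENNReal.lintegral_mul_le_Lp_mul_Lq _ (Real.holderConjugate_iff.2 ⟨by norm_num, by norm_num⟩)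
            km.aemeasurable hh.aemeasurable
      _ ≤ (ENNReal.ofReal (2 / R)) ^ (1/(6:ℝ)) * 1 ^ (1/(6/5:ℝ)) := by
          gcongr
          · rw [hNc]; exact far_int R hR0 s
          · exact (setLIntegral_le_lintegral _ _).trans h1
      _ = ENNReal.ofReal ((2 / R) ^ (1/6:ℝ)) := by
          rw [ENNReal.one_rpow, mul_one, ENNReal.ofReal_rpow_of_pos (by positivity)]
      _ ≤ _ := by
          apply ENNReal.ofReal_le_ofReal
          rw [Real.div_rpow (by norm_num) hR0.le, hR, ← Real.rpow_mul hr.le, div_eq_mul_inv,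
            ← Real.rpow_neg hr.le]
          have : (2:ℝ) ^ (1/6 : ℝ) ≤ 2 ^ (1:ℝ) :=
            Real.rpow_le_rpow_of_exponent_le (by norm_num) (by norm_num)
          rw [Real.rpow_one] at this
          norm_num at this ⊢
          gcongr
  refine (add_le_add b1 b2).trans (le_of_eq ?_)
  rw [← ENNReal.ofReal_add (by positivity) (by positivity), ENNReal.ofReal_rpow_of_pos hr,
    ← add_mul, ENNReal.ofReal_mul (by norm_num)]
  norm_num

lemma hlsB (g h : ℝ → ℝ≥0∞) (hg : Measurable g) (hh : Measurable h)
    (g1 : ∫⁻ t, g t ^ (6/5 : ℝ) ≤ 1) (h1 : ∫⁻ t, h t ^ (6/5 : ℝ) ≤ 1) :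
    ∫⁻ s, ∫⁻ t, kk t s * (g s * h t) ≤ 10 := by
  have half : ∀ g h : ℝ → ℝ≥0∞, Measurable g → Measurable h → ∫⁻ t, g t ^ (6/5 : ℝ) ≤ 1 →
      ∫⁻ t, h t ^ (6/5 : ℝ) ≤ 1 →
      ∫⁻ s, ∫⁻ t, {t | h t ≤ g s}.indicator (fun t => kk t s * (g s * h t)) t ≤ 5 := by
    intro g h hg hh g1 h1
    calc _ ≤ ∫⁻ s, 5 * g s ^ (6/5 : ℝ) := by
          refine lintegral_mono fun s => ?_
          have km : Measurable fun t => kk t s :=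
            kk_meas.comp (by fun_prop : Measurable fun t : ℝ => (t, s))
          rw [lintegral_indicator (measurableSet_le hh measurable_const)]
          have : ∀ t, kk t s * (g s * h t) = g s * (kk t s * h t) := fun t => by ring
          simp_rw [this]
          rw [lintegral_const_mul _ (by fun_prop)]
          refine (mul_le_mul_right (hlsA h hh h1 s (g s)) (g s)).trans (le_of_eq ?_)
          rw [mul_left_comm]
          congr 1
          nth_rewrite 1 [← ENNReal.rpow_one (g s)]
          rw [← ENNReal.rpow_add_of_nonneg _ _ (by norm_num) (by norm_num)]
          norm_num
      _ = 5 * ∫⁻ s, g s ^ (6/5 : ℝ) := lintegral_const_mul _ (by fun_prop)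
      _ ≤ 5 * 1 := by gcongr
      _ = 5 := by simp
  have e := half g h hg hh g1 h1
  have e' := half h g hh hg h1 g1
  have km := kk_meas
  have meas1 : Measurable fun p : ℝ × ℝ => {t | h t ≤ g p.1}.indicator (fun t => kk t p.1 * (g p.1 * h t)) p.2 := by
    have hs : MeasurableSet {p : ℝ × ℝ | h p.2 ≤ g p.1} := measurableSet_le (by fun_prop) (by fun_prop)
    have : Measurable fun p : ℝ × ℝ => kk p.2 p.1 * (g p.1 * h p.2) := by
      have := km.comp measurable_swap
      exact this.mul (by fun_prop)
    exact this.indicator hs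
  have meas2 : Measurable fun p : ℝ × ℝ => {t | g t ≤ h p.1}.indicator (fun t => kk t p.1 * (h p.1 * g t)) p.2 := by
    have hs : MeasurableSet {p : ℝ × ℝ | g p.2 ≤ h p.1} := measurableSet_le (by fun_prop) (by fun_prop)
    have : Measurable fun p : ℝ × ℝ => kk p.2 p.1 * (h p.1 * g p.2) := by
      have := km.comp measurable_swap
      exact this.mul (by fun_prop)
    exact this.indicator hs
  rw [lintegral_lintegral_swap meas2.aemeasurable] at e'
  calc _ ≤ ∫⁻ s, ∫⁻ t, ({t | h t ≤ g s}.indicator (fun t => kk t s * (g s * h t)) t +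
        {s | g s ≤ h t}.indicator (fun s => kk s t * (h t * g s)) s) := by
        refine lintegral_mono fun s => lintegral_mono fun t => ?_
        rcases le_total (h t) (g s) with hl | hl
        · simp only [Set.indicator, Set.mem_ofPred_eq, hl, if_true]
          exact le_self_add
        · simp only [Set.indicator, Set.mem_ofPred_eq, hl, if_true]
          rw [kk_comm s t, mul_comm (h t)]
          exact le_add_self
    _ = (∫⁻ s, ∫⁻ t, {t | h t ≤ g s}.indicator (fun t => kk t s * (g s * h t)) t) +
        ∫⁻ s, ∫⁻ t, {s | g s ≤ h t}.indicator (fun s => kk s t * (h t * g s)) s := by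
        rw [← lintegral_add_left meas1.lintegral_prod_right']
        congr 1
        ext s
        exact lintegral_add_left (meas1.comp (by fun_prop : Measurable fun t : ℝ => (s, t))) _
    _ ≤ 5 + 5 := add_le_add e e'
    _ = 10 := by norm_num

lemma hlsC (g h : ℝ → ℝ≥0∞) (hg : Measurable g) (hh : Measurable h)
    (gt : ∫⁻ t, g t ^ (6/5 : ℝ) ≠ ⊤) (ht : ∫⁻ t, h t ^ (6/5 : ℝ) ≠ ⊤) :
    ∫⁻ s, ∫⁻ t, kk t s * (g s * h t) ≤
      10 * ((∫⁻ t, g t ^ (6/5 : ℝ)) ^ (5/6 : ℝ) * (∫⁻ t, h t ^ (6/5 : ℝ)) ^ (5/6 : ℝ)) := by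
  set A := (∫⁻ t, g t ^ (6/5 : ℝ)) ^ (5/6 : ℝ) with hA
  set B := (∫⁻ t, h t ^ (6/5 : ℝ)) ^ (5/6 : ℝ) with hB
  have km := kk_meas
  have kms : ∀ s, Measurable fun t => kk t s := fun s =>
    kk_meas.comp (by fun_prop : Measurable fun t : ℝ => (t, s))
  by_cases g0 : ∫⁻ t, g t ^ (6/5 : ℝ) = 0
  · rw [lintegral_eq_zero_iff (by fun_prop)] at g0
    have : ∫⁻ s, ∫⁻ t, kk t s * (g s * h t) = 0 := by
      rw [← lintegral_zero (α := ℝ) (μ := volume)]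
      refine lintegral_congr_ae (g0.mono fun s hs => ?_)
      have : g s = 0 := by
        have hs' := ENNReal.rpow_eq_zero_iff.1 hs
        rcases hs' with hs' | hs'
        · exact hs'.1
        · norm_num at hs'
      simp [this]
    rw [this]; exact zero_le
  by_cases h0 : ∫⁻ t, h t ^ (6/5 : ℝ) = 0
  · rw [lintegral_eq_zero_iff (by fun_prop)] at h0
    have : ∫⁻ s, ∫⁻ t, kk t s * (g s * h t) = 0 := by
      rw [← lintegral_zero (α := ℝ) (μ := volume)]
      congr 1
      ext s
      rw [← lintegral_zero (α := ℝ) (μ := volume)]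
      refine lintegral_congr_ae (h0.mono fun s hs => ?_)
      have : h s = 0 := by
        have hs' := ENNReal.rpow_eq_zero_iff.1 hs
        rcases hs' with hs' | hs'
        · exact hs'.1
        · norm_num at hs'
      simp [this]
    rw [this]; exact zero_le
  have nrm : ∀ f : ℝ → ℝ≥0∞, Measurable f → ∫⁻ t, f t ^ (6/5 : ℝ) ≠ 0 → ∫⁻ t, f t ^ (6/5 : ℝ) ≠ ⊤ →
      ∫⁻ t, (((∫⁻ t, f t ^ (6/5 : ℝ)) ^ (5/6 : ℝ))⁻¹ * f t) ^ (6/5 : ℝ) ≤ 1 := by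
    intro f hf f0 ft
    have : ∀ t, (((∫⁻ t, f t ^ (6/5 : ℝ)) ^ (5/6 : ℝ))⁻¹ * f t) ^ (6/5 : ℝ) =
        (∫⁻ t, f t ^ (6/5 : ℝ))⁻¹ * f t ^ (6/5 : ℝ) := fun t => by
      rw [ENNReal.mul_rpow_of_nonneg _ _ (by norm_num), ← ENNReal.inv_rpow, ← ENNReal.rpow_mul]
      norm_num
    simp_rw [this]
    rw [lintegral_const_mul _ (by fun_prop), ENNReal.inv_mul_cancel f0 ft]
  have A0 : A ≠ 0 := by
    rw [hA, Ne, ENNReal.rpow_eq_zero_iff]; simp [g0, gt]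
  have At : A ≠ ⊤ := ENNReal.rpow_ne_top_of_nonneg (by norm_num) gt
  have B0 : B ≠ 0 := by
    rw [hB, Ne, ENNReal.rpow_eq_zero_iff]; simp [h0, ht]
  have Bt : B ≠ ⊤ := ENNReal.rpow_ne_top_of_nonneg (by norm_num) ht
  have key := hlsB (fun t => A⁻¹ * g t) (fun t => B⁻¹ * h t) (by fun_prop) (by fun_prop)
    (nrm g hg g0 gt) (nrm h hh h0 ht)
  have e : ∫⁻ s, ∫⁻ t, kk t s * (g s * h t) =
      A * B * ∫⁻ s, ∫⁻ t, kk t s * ((A⁻¹ * g s) * (B⁻¹ * h t)) := by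
    rw [← lintegral_const_mul' _ _ (ENNReal.mul_ne_top At Bt)]
    congr 1
    ext s
    rw [← lintegral_const_mul' _ _ (ENNReal.mul_ne_top At Bt)]
    congr 1
    ext t
    calc kk t s * (g s * h t) = (A * A⁻¹) * (B * B⁻¹) * (kk t s * (g s * h t)) := by
          rw [ENNReal.mul_inv_cancel A0 At, ENNReal.mul_inv_cancel B0 Bt]; simp
      _ = _ := by ring
  rw [e, mul_comm 10]
  gcongr

lemma hls2 (T : ℝ) (g h : ℝ → ℝ≥0∞) (hg : AEMeasurable g (volume.restrict (Set.Ioo 0 T)))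
    (hh : AEMeasurable h (volume.restrict (Set.Ioo 0 T)))
    (gt : ∫⁻ t in Set.Ioo 0 T, g t ^ (6/5 : ℝ) ≠ ⊤) (ht : ∫⁻ t in Set.Ioo 0 T, h t ^ (6/5 : ℝ) ≠ ⊤) :
    ∫⁻ s in Set.Ioo 0 T, ∫⁻ t in Set.Ioo 0 T, kk t s * (g s * h t) ≤
      10 * ((∫⁻ t in Set.Ioo 0 T, g t ^ (6/5 : ℝ)) ^ (5/6 : ℝ) *
        (∫⁻ t in Set.Ioo 0 T, h t ^ (6/5 : ℝ)) ^ (5/6 : ℝ)) := by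
  have main : ∀ g h : ℝ → ℝ≥0∞, Measurable g → Measurable h →
    ∫⁻ t in Set.Ioo 0 T, g t ^ (6/5 : ℝ) ≠ ⊤ → ∫⁻ t in Set.Ioo 0 T, h t ^ (6/5 : ℝ) ≠ ⊤ →
    ∫⁻ s in Set.Ioo 0 T, ∫⁻ t in Set.Ioo 0 T, kk t s * (g s * h t) ≤
      10 * ((∫⁻ t in Set.Ioo 0 T, g t ^ (6/5 : ℝ)) ^ (5/6 : ℝ) *
        (∫⁻ t in Set.Ioo 0 T, h t ^ (6/5 : ℝ)) ^ (5/6 : ℝ)) := by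
    intro g h hg hh gt ht
    have mI : MeasurableSet (Set.Ioo 0 T) := measurableSet_Ioo
    have ei : ∀ f : ℝ → ℝ≥0∞, ∫⁻ t in Set.Ioo 0 T, f t ^ (6/5 : ℝ) =
        ∫⁻ t, ((Set.Ioo 0 T).indicator f t) ^ (6/5 : ℝ) := fun f => by
      rw [← lintegral_indicator mI]
      congr 1
      ext t
      by_cases h : t ∈ Set.Ioo 0 T
      · rw [Set.indicator_of_mem h, Set.indicator_of_mem h]
      · rw [Set.indicator_of_notMem h, Set.indicator_of_notMem h, ENNReal.zero_rpow_of_pos (by norm_num)]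
    rw [ei] at gt ht ⊢
    rw [ei h]
    refine le_trans (le_of_eq ?_) (hlsC _ _ (hg.indicator mI) (hh.indicator mI) gt ht)
    rw [← lintegral_indicator mI]
    congr 1
    ext s
    by_cases h : s ∈ Set.Ioo 0 T
    · rw [Set.indicator_of_mem h, Set.indicator_of_mem h, ← lintegral_indicator mI]
      congr 1
      ext t
      by_cases h : t ∈ Set.Ioo 0 T
      · rw [Set.indicator_of_mem h, Set.indicator_of_mem h]
      · rw [Set.indicator_of_notMem h, Set.indicator_of_notMem h]; simp
    · rw [Set.indicator_of_notMem h, Set.indicator_of_notMem h]; simp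
  have eg : ∫⁻ t in Set.Ioo 0 T, g t ^ (6/5 : ℝ) = ∫⁻ t in Set.Ioo 0 T, hg.mk g t ^ (6/5 : ℝ) :=
    lintegral_congr_ae (hg.ae_eq_mk.mono fun t ht => by simp only [ht])
  have eh : ∫⁻ t in Set.Ioo 0 T, h t ^ (6/5 : ℝ) = ∫⁻ t in Set.Ioo 0 T, hh.mk h t ^ (6/5 : ℝ) :=
    lintegral_congr_ae (hh.ae_eq_mk.mono fun t ht => by simp only [ht])
  rw [eg] at gt
  rw [eh] at ht
  rw [eg, eh]
  refine le_trans (le_of_eq ?_) (main _ _ hg.measurable_mk hh.measurable_mk gt ht)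
  refine lintegral_congr_ae (hg.ae_eq_mk.mono fun s hs => ?_)
  refine lintegral_congr_ae (hh.ae_eq_mk.mono fun t ht => ?_)
  simp only [hs, ht]

set_option maxHeartbeats 1000000 in
lemma hls1 (T : ℝ) (hT : 0 < T) (g : ℝ → ℝ≥0∞)
    (hg : AEMeasurable g (volume.restrict (Set.Ioo 0 T)))
    (M : ℝ≥0∞) (hM : M ≠ ⊤) (hb : ∀ t ∈ Set.Ioo 0 T, g t ≤ M) :
    (∫⁻ t in Set.Ioo 0 T, (∫⁻ s in Set.Ioo 0 T, kk t s * g s) ^ (6 : ℝ)) ^ (1/6 : ℝ) ≤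
      10 * (∫⁻ t in Set.Ioo 0 T, g t ^ (6/5 : ℝ)) ^ (5/6 : ℝ) := by
  have mI : MeasurableSet (Set.Ioo 0 T) := measurableSet_Ioo
  have kms : ∀ s, Measurable fun t => kk s t := fun s =>
    kk_meas.comp (by fun_prop : Measurable fun t : ℝ => (s, t))
  set J : ℝ → ℝ≥0∞ := fun t => ∫⁻ s in Set.Ioo 0 T, kk t s * g s with hJ
  have Jm : Measurable J := by
    have : J = fun t => ∫⁻ s in Set.Ioo 0 T, kk t s * hg.mk g s := by
      ext t
      exact lintegral_congr_ae (hg.ae_eq_mk.mono fun t ht => by simp only [ht])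
    rw [this]
    exact Measurable.lintegral_prod_right' (f := fun p : ℝ × ℝ => kk p.1 p.2 * hg.mk g p.2)
      (kk_meas.mul (hg.measurable_mk.comp measurable_snd))
  set K : ℝ≥0∞ := ENNReal.ofReal (3 * T ^ (2/3 : ℝ)) * M with hK
  have Kt : K ≠ ⊤ := ENNReal.mul_ne_top ENNReal.ofReal_ne_top hM
  have Jb : ∀ t ∈ Set.Ioo 0 T, J t ≤ K := fun t ht => by
    calc J t ≤ ∫⁻ s in Set.Ioo 0 T, kk t s * M :=
          setLIntegral_mono' mI fun s hs => by gcongr; exact hb s hs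
      _ ≤ ∫⁻ s in {s | |s - t| ≤ T}, kk t s * M := lintegral_mono_set fun s hs => by
          change |s - t| ≤ T
          rw [abs_le]; constructor <;> linarith [hs.1, hs.2, ht.1, ht.2]
      _ = (∫⁻ s in {s | |s - t| ≤ T}, kk t s) * M := lintegral_mul_const _ (kms t)
      _ ≤ K := by
          rw [hK]; gcongr
          simp_rw [kk_comm t]
          exact near_int T hT t
  have fin : ∀ (f : ℝ → ℝ≥0∞) (p : ℝ) (L : ℝ≥0∞), 0 ≤ p → L ≠ ⊤ → (∀ t ∈ Set.Ioo 0 T, f t ≤ L) →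
      ∫⁻ t in Set.Ioo 0 T, f t ^ p ≠ ⊤ := by
    intro f p L hp hL hf
    refine ne_of_lt (lt_of_le_of_lt (setLIntegral_mono' (g := fun _ => L ^ p) mI fun t ht =>
      ENNReal.rpow_le_rpow (hf t ht) hp) ?_)
    rw [lintegral_const]
    refine ENNReal.mul_lt_top (ENNReal.rpow_lt_top_of_nonneg hp hL) ?_
    simp
  set X := ∫⁻ t in Set.Ioo 0 T, J t ^ (6 : ℝ) with hX
  have Xt : X ≠ ⊤ := fin J 6 K (by norm_num) Kt Jb
  have e65 : ∀ t, (J t ^ (5:ℝ)) ^ (6/5 : ℝ) = J t ^ (6:ℝ) := fun t => by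
    rw [← ENNReal.rpow_mul]; norm_num
  have h2 := hls2 T g (fun t => J t ^ (5:ℝ)) hg (Jm.pow_const (5:ℝ)).aemeasurable
    (fin g _ M (by norm_num) hM hb) (by simp_rw [e65]; exact Xt)
  simp_rw [e65] at h2
  have e1 : ∫⁻ s in Set.Ioo 0 T, ∫⁻ t in Set.Ioo 0 T, kk t s * (g s * J t ^ (5:ℝ)) = X := by
    rw [lintegral_lintegral_swap]
    · rw [hX]
      congr 1
      ext t
      have : ∀ s, kk t s * (g s * J t ^ (5:ℝ)) = kk t s * g s * J t ^ (5:ℝ) := fun s => by ring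
      simp_rw [this]
      rw [lintegral_mul_const'' (f := fun s => kk t s * g s) _ ((kms t).aemeasurable.mul hg)]
      change J t * J t ^ (5:ℝ) = _
      nth_rewrite 1 [← ENNReal.rpow_one (J t)]
      rw [← ENNReal.rpow_add_of_nonneg _ _ (by norm_num) (by norm_num)]
      norm_num
    · refine AEMeasurable.mul (kk_meas.comp measurable_swap).aemeasurable ?_
      refine AEMeasurable.mul ?_ ?_
      · exact hg.comp_quasiMeasurePreserving Measure.quasiMeasurePreserving_fst
      · exact ((Jm.comp measurable_snd).pow_const _).aemeasurable
  rw [e1] at h2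
  by_cases X0 : X = 0
  · rw [X0, ENNReal.zero_rpow_of_pos (by norm_num)]; exact zero_le
  have X50 : X ^ (5/6:ℝ) ≠ 0 := by rw [Ne, ENNReal.rpow_eq_zero_iff]; simp [X0, Xt]
  have X5t : X ^ (5/6:ℝ) ≠ ⊤ := ENNReal.rpow_ne_top_of_nonneg (by norm_num) Xt
  rw [← ENNReal.mul_le_mul_iff_left X50 X5t, ← ENNReal.rpow_add_of_nonneg _ _ (by norm_num) (by norm_num)]
  norm_num
  rw [mul_assoc]
  exact h2

section fourierPart
open FourierTransform SchwartzMap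

lemma ft1_eq (f : ℝ → ℂ) (w : ℝ) :
    ft1 f (2 * π * w) = (((2 * π) ^ (-(1 : ℝ) / 2) : ℝ) : ℂ) * 𝓕 f w := by
  unfold ft1
  rw [Real.fourier_real_eq_integral_exp_smul]
  congr 2
  ext x
  rw [smul_eq_mul]
  congr 2
  push_cast; ring

lemma finv_eq (A : ℝ → ℂ) (x : ℝ) :
    𝓕⁻ A x = ∫ w : ℝ, cexp (I * ((2 * π * x * w : ℝ) : ℂ)) * A w := by
  rw [Real.fourierInv_eq']
  congr 1
  ext w
  rw [smul_eq_mul]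
  congr 2
  simp
  ring

lemma fmult1_eq (m f : ℝ → ℂ) (x : ℝ) :
    fmult1 m f x = 𝓕⁻ (fun w => m (2 * π * w) * 𝓕 f w) x := by
  rw [finv_eq]
  unfold fmult1
  have h := Measure.integral_comp_mul_left
    (fun ξ : ℝ => Complex.exp (Complex.I * (x * ξ : ℝ)) * m ξ * ft1 f ξ) (2 * π)
  have hpi : (0:ℝ) < 2 * π := by positivity
  have h2 : ∫ ξ : ℝ, Complex.exp (Complex.I * (x * ξ : ℝ)) * m ξ * ft1 f ξ
     = ((2 * π : ℝ) : ℂ) * ∫ w : ℝ, Complex.exp (Complex.I * (x * (2 * π * w) : ℝ)) * m (2 * π * w) * ft1 f (2 * π * w) := by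
    rw [h, abs_of_pos (by positivity), Complex.real_smul, ← mul_assoc, ← Complex.ofReal_mul,
      mul_inv_cancel₀ hpi.ne', Complex.ofReal_one, one_mul]
  rw [h2, ← mul_assoc, ← integral_const_mul]
  congr 1
  ext w
  rw [ft1_eq]
  have h3 : (((2 * π) ^ (-(1 : ℝ) / 2) : ℝ) : ℂ) * ((2 * π : ℝ) : ℂ) * (((2 * π) ^ (-(1 : ℝ) / 2) : ℝ) : ℂ) = 1 := by
    rw [← Complex.ofReal_mul, ← Complex.ofReal_mul, ← Complex.ofReal_one]
    congr 1
    have : (2 * π) ^ (-(1 : ℝ) / 2) * (2 * π) ^ (-(1 : ℝ) / 2) = (2 * π)⁻¹ := by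
      rw [← Real.rpow_add hpi, ← Real.rpow_neg_one]; norm_num
    calc _ = ((2 * π) ^ (-(1 : ℝ) / 2) * (2 * π) ^ (-(1 : ℝ) / 2)) * (2 * π) := by ring
      _ = _ := by rw [this, inv_mul_cancel₀ hpi.ne']
  calc _ = ((((2 * π) ^ (-(1 : ℝ) / 2) : ℝ) : ℂ) * ((2 * π : ℝ) : ℂ) * (((2 * π) ^ (-(1 : ℝ) / 2) : ℝ) : ℂ)) * (Complex.exp (Complex.I * (x * (2 * π * w) : ℝ)) * (m (2 * π * w) * 𝓕 f w)) := by ring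
    _ = _ := by
      rw [h3, one_mul]
      congr 3
      push_cast; ring

lemma selfadj {f g : ℝ → ℂ} (hf : Integrable f) (hg : Integrable g) :
    ∫ w, 𝓕 f w * g w = ∫ x, f x * 𝓕 g x := by
  simpa using! VectorFourier.integral_bilin_fourierIntegral_eq_flip (ContinuousLinearMap.mul ℂ ℂ) (L := innerₗ ℝ)
    continuous_fourierChar continuous_inner hf hg

lemma integrable_cont_finv {A : ℝ → ℂ} (hA : Integrable A) : Continuous (𝓕⁻ A) := by
  have : 𝓕⁻ A = fun x => 𝓕 A (-x) := by
    ext x; rw [Real.fourierInv_eq_fourier_neg]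
  rw [this]
  have h : Continuous (𝓕 A) := VectorFourier.fourierIntegral_continuous (L := innerₗ ℝ) continuous_fourierChar continuous_inner hA
  exact h.comp continuous_neg

lemma selfadj_inv {f g : ℝ → ℂ} (hf : Integrable f) (hg : Integrable g) :
    ∫ w, 𝓕⁻ f w * g w = ∫ x, f x * 𝓕⁻ g x := by
  have h := selfadj (f := f) (g := fun x => g (-x)) hf hg.comp_neg
  have e : ∀ x, 𝓕⁻ g x = 𝓕 (fun x => g (-x)) x := by
    intro x; rw [Real.fourierInv_eq_fourier_comp_neg]
  simp_rw [e]
  rw [← h, ← integral_neg_eq_self]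
  congr 1; ext w
  rw [Real.fourierInv_eq_fourier_neg, neg_neg]

lemma planch {A : ℝ → ℂ} (hA : Integrable A) (hA2 : MemLp A 2) :
    eLpNorm (𝓕⁻ A) 2 = eLpNorm A 2 := by
  have hae : 𝓕⁻ A =ᵐ[volume] (𝓕⁻ (hA2.toLp A) : Lp ℂ 2 (volume : Measure ℝ)) := by
    apply ae_eq_of_integral_contDiff_smul_eq
    · exact (integrable_cont_finv hA).locallyIntegrable
    · exact (Lp.memLp _).locallyIntegrable (by norm_num)
    intro g hg hgs
    have hgs' : HasCompactSupport (fun x => (g x : ℂ)) := hgs.comp_left (g := fun x : ℝ => (x:ℂ)) (by simp)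
    let G : 𝓢(ℝ, ℂ) := hgs'.toSchwartzMap (Complex.ofRealCLM.contDiff.comp hg)
    have hG : ∀ x, G x = (g x : ℂ) := fun x => rfl
    have h1 := congrArg (fun L => L G) (MeasureTheory.Lp.fourierInv_toTemperedDistribution_eq (hA2.toLp A))
    simp only [TemperedDistribution.fourierInv_apply, Lp.toTemperedDistribution_apply] at h1
    have h2 : ∫ x, g x • (𝓕⁻ (hA2.toLp A) : Lp ℂ 2 (volume : Measure ℝ)) x = ∫ x, G x • (𝓕⁻ (hA2.toLp A) : Lp ℂ 2 (volume : Measure ℝ)) x := by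
      congr 1; 
    rw [h2, ← h1]
    have h3 : ∫ x, (𝓕⁻ G) x • (hA2.toLp A) x = ∫ x, (𝓕⁻ G) x * A x := by
      apply integral_congr_ae
      filter_upwards [hA2.coeFn_toLp] with x hx
      rw [hx, smul_eq_mul]
    rw [h3, SchwartzMap.fourierInv_coe, selfadj_inv G.integrable hA]
    congr 1
  rw [eLpNorm_congr_ae hae]
  have h4 : ‖(𝓕⁻ (hA2.toLp A) : Lp ℂ 2 (volume : Measure ℝ))‖ = ‖hA2.toLp A‖ := by
    rw [← MeasureTheory.Lp.norm_fourier_eq, fourier_fourierInv_eq]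
  rw [Lp.norm_def, Lp.norm_toLp, ENNReal.toReal_eq_toReal_iff' (Lp.eLpNorm_ne_top _) hA2.eLpNorm_ne_top] at h4
  exact h4
end fourierPart

section fourierPart2
open FourierTransform SchwartzMap

noncomputable def wt (μ p w : ℝ) : ℝ := (1 + μ * (2 * π * w) ^ 2) ^ p

lemma wt_pos {μ : ℝ} (hμ : 0 < μ) (p w : ℝ) : 0 < wt μ p w := by unfold wt; positivity

lemma wt_mul {μ : ℝ} (hμ : 0 < μ) (p q w : ℝ) : wt μ p w * wt μ q w = wt μ (p + q) w := by
  unfold wt; rw [← Real.rpow_add (by positivity)]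

lemma wt_amp {μ : ℝ} (hμ : 0 < μ) (w : ℝ) : wt μ (-(5/6)) w = amp (2 * π * √μ * w) := by
  unfold wt amp
  congr 2
  have h : (2 * π * √μ * w) ^ 2 = μ * (2 * π * w) ^ 2 := by
    rw [mul_pow, mul_pow, mul_pow, Real.sq_sqrt hμ.le, mul_pow]; ring
  rw [h]

noncomputable def bb (σ τ μ w : ℝ) : ℂ := prop1 σ τ μ (2 * π * w) * (wt μ (-(5/6)) w : ℂ)

lemma prop1_eq {μ : ℝ} (hμ : 0 < μ) (σ τ w : ℝ) : prop1 σ τ μ (2 * π * w) =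
    cexp (I * ((σ * τ / √μ * gph (2 * π * √μ * w) : ℝ) : ℂ)) := by
  unfold prop1 gph
  congr 3
  have h : (2 * π * √μ * w) ^ 2 = μ * (2 * π * w) ^ 2 := by
    rw [mul_pow, mul_pow, mul_pow, Real.sq_sqrt hμ.le, mul_pow]; ring
  rw [h]
  have := Real.sqrt_pos.2 hμ
  field_simp

lemma norm_prop1 (σ τ μ ξ : ℝ) : ‖prop1 σ τ μ ξ‖ = 1 := by
  unfold prop1; rw [mul_comm, Complex.norm_exp_ofReal_mul_I]

lemma prop1_cont {μ : ℝ} (hμ : 0 < μ) (σ : ℝ) :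
    Continuous (fun p : ℝ × ℝ => prop1 σ p.1 μ p.2) := by
  unfold prop1
  have : ∀ p : ℝ × ℝ, √(1 + μ * p.2 ^ 2 / 3) ≠ 0 := fun p => (Real.sqrt_pos.2 (by positivity)).ne'
  fun_prop (disch := assumption)

lemma wt_cont {μ : ℝ} (hμ : 0 < μ) (p : ℝ) : Continuous (wt μ p) := by
  unfold wt
  apply Continuous.rpow_const (by fun_prop)
  intro w; left; positivity

lemma bb_cont {μ : ℝ} (hμ : 0 < μ) (σ τ : ℝ) : Continuous (bb σ τ μ) := by
  unfold bb
  apply Continuous.mul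
  · exact (prop1_cont hμ σ).comp (f := fun w : ℝ => (τ, 2 * π * w)) (by fun_prop)
  · exact Complex.continuous_ofReal.comp (wt_cont hμ _)

lemma bb_int {μ : ℝ} (hμ : 0 < μ) (σ τ : ℝ) : Integrable (bb σ τ μ) := by
  have h : Integrable (fun w => amp (2 * π * √μ * w)) :=
    amp_integrable.comp_mul_left' (by have := Real.sqrt_pos.2 hμ; positivity)
  apply h.mono (bb_cont hμ σ τ).aestronglyMeasurable
  filter_upwards with w
  unfold bb
  rw [norm_mul, norm_prop1, one_mul, wt_amp hμ, Complex.norm_real]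

lemma bb_conj (σ τ μ w : ℝ) : starRingEnd ℂ (bb σ τ μ w) = bb σ (-τ) μ w := by
  unfold bb prop1
  rw [map_mul, Complex.conj_ofReal, ← Complex.exp_conj, map_mul, Complex.conj_I, Complex.conj_ofReal]
  congr 2
  push_cast; ring

lemma disp2 : ∃ C : ℝ, 0 < C ∧ ∀ σ τ μ x : ℝ, |σ| = 1 → τ ≠ 0 → 0 < μ →
    ‖𝓕⁻ (bb σ τ μ) x‖ ≤ C * (|τ| * μ) ^ (-(1/3) : ℝ) := by
  obtain ⟨C, hC, h⟩ := dispersive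
  refine ⟨C, hC, ?_⟩
  intro σ τ μ x hσ hτ hμ
  have hsq := Real.sqrt_pos.2 hμ
  have hσ0 : σ ≠ 0 := by rintro rfl; simp at hσ
  have h1 := h (x / √μ) (σ * τ / √μ) (by positivity)
  rw [finv_eq]
  have e : ∀ w : ℝ, cexp (I * ((2 * π * x * w : ℝ) : ℂ)) * bb σ τ μ w
     = (fun η : ℝ => cexp (I * ((x / √μ * η + σ * τ / √μ * gph η : ℝ):ℂ)) * (amp η : ℂ)) (2 * π * √μ * w) := by
    intro w
    unfold bb
    simp only []
    rw [prop1_eq hμ, wt_amp hμ, ← mul_assoc, ← Complex.exp_add, ← mul_add, ← Complex.ofReal_add]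
    congr 5
    field_simp
  simp_rw [e]
  rw [Measure.integral_comp_mul_left (fun η : ℝ => cexp (I * ((x / √μ * η + σ * τ / √μ * gph η : ℝ):ℂ)) * (amp η : ℂ)), norm_smul, Real.norm_eq_abs, abs_abs, abs_of_pos (by positivity)]
  have h2 : |σ * τ / √μ| = |τ| / √μ := by rw [abs_div, abs_mul, hσ, one_mul, abs_of_pos hsq]
  rw [h2] at h1
  have hτ' : 0 < |τ| := abs_pos.2 hτ
  have h3 : (√μ)⁻¹ * (|τ| / √μ) ^ (-(1/3) : ℝ) = (|τ| * μ) ^ (-(1/3) : ℝ) := by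
    rw [Real.div_rpow hτ'.le hsq.le, Real.mul_rpow hτ'.le hμ.le, ← Real.rpow_neg_one, div_eq_mul_inv, ← Real.rpow_neg hsq.le, Real.sqrt_eq_rpow, ← Real.rpow_mul hμ.le, ← Real.rpow_mul hμ.le]
    rw [mul_left_comm, ← Real.rpow_add hμ]; norm_num
  have hpi : (2 * π)⁻¹ ≤ 1 := inv_le_one_of_one_le₀ (by nlinarith [Real.pi_gt_three])
  rw [mul_inv, ← h3]
  calc _ ≤ (1 * (√μ)⁻¹) * (C * (|τ| / √μ) ^ (-(1/3) : ℝ)) := by gcongr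
    _ = _ := by ring

lemma fourier_bdd {G : ℝ → ℂ} (_hG : Integrable G) (w : ℝ) : ‖𝓕 G w‖ ≤ ∫ x, ‖G x‖ :=
  VectorFourier.norm_fourierIntegral_le_integral_norm _ _ _ _ _

lemma fourier_cont {G : ℝ → ℂ} (hG : Integrable G) : Continuous (𝓕 G) :=
  VectorFourier.fourierIntegral_continuous (L := innerₗ ℝ) continuous_fourierChar continuous_inner hG

lemma norm_cexp_I (x : ℝ) : ‖cexp (I * (x : ℂ))‖ = 1 := by
  rw [mul_comm, Complex.norm_exp_ofReal_mul_I]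

lemma disp3 {b G : ℝ → ℂ} {D : ℝ} (hb : Integrable b) (hD : ∀ y, ‖𝓕⁻ b y‖ ≤ D)
    (hG : Integrable G) (x : ℝ) : ‖𝓕⁻ (fun w => b w * 𝓕 G w) x‖ ≤ D * ∫ y, ‖G y‖ := by
  have hg : Integrable (fun w : ℝ => cexp (I * ((2 * π * x * w : ℝ) : ℂ)) * b w) := by
    apply hb.bdd_mul (c := 1)
    · exact Continuous.aestronglyMeasurable (by fun_prop)
    · filter_upwards with w; rw [norm_cexp_I]
  have h := selfadj hG hg
  rw [finv_eq]
  have e1 : ∫ w : ℝ, cexp (I * ((2 * π * x * w : ℝ) : ℂ)) * (b w * 𝓕 G w) =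
      ∫ w, 𝓕 G w * (cexp (I * ((2 * π * x * w : ℝ) : ℂ)) * b w) := by
    congr 1; ext w; ring
  have e2 : ∀ y, 𝓕 (fun w : ℝ => cexp (I * ((2 * π * x * w : ℝ) : ℂ)) * b w) y = 𝓕⁻ b (x - y) := by
    intro y
    rw [finv_eq, Real.fourier_real_eq_integral_exp_smul]
    congr 1; ext w
    rw [smul_eq_mul, ← mul_assoc, ← Complex.exp_add]
    congr 2
    push_cast; ring
  rw [e1, h, ← integral_const_mul]
  apply norm_integral_le_of_norm_le (hG.norm.const_mul D)
  filter_upwards with y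
  rw [norm_mul, e2, mul_comm]
  gcongr
  exact hD _

lemma disp4 {b G H : ℝ → ℂ} {D : ℝ} (hb : Integrable b) (hD : ∀ y, ‖𝓕⁻ (fun w => starRingEnd ℂ (b w)) y‖ ≤ D)
    (hG : Integrable G) (hH : Integrable H) :
    ‖∫ w, b w * (𝓕 G w * starRingEnd ℂ (𝓕 H w))‖ ≤ D * ((∫ y, ‖G y‖) * ∫ y, ‖H y‖) := by
  have hg : Integrable (fun w : ℝ => b w * starRingEnd ℂ (𝓕 H w)) := by
    apply hb.mul_bdd (c := ∫ y, ‖H y‖)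
    · exact (Complex.continuous_conj.comp (fourier_cont hH)).aestronglyMeasurable
    · filter_upwards with w
      rw [Complex.norm_conj]; exact fourier_bdd hH w
  have h := selfadj hG hg
  have e1 : ∫ w, b w * (𝓕 G w * starRingEnd ℂ (𝓕 H w)) = ∫ w, 𝓕 G w * (b w * starRingEnd ℂ (𝓕 H w)) := by
    congr 1; ext w; ring
  have hb' : Integrable (fun w => starRingEnd ℂ (b w)) := by
    apply hb.mono (Complex.continuous_conj.comp_aestronglyMeasurable hb.1)
    filter_upwards with w
    rw [Complex.norm_conj]
  have e2 : ∀ y, ‖𝓕 (fun w : ℝ => b w * starRingEnd ℂ (𝓕 H w)) y‖ ≤ D * ∫ y, ‖H y‖ := by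
    intro y
    refine le_trans (le_of_eq ?_) (disp3 hb' hD hH y)
    rw [← Complex.norm_conj, Real.fourier_real_eq_integral_exp_smul, ← integral_conj, finv_eq]
    congr 2; ext w
    rw [smul_eq_mul, map_mul, map_mul, Complex.conj_conj, ← Complex.exp_conj, map_mul, Complex.conj_I, Complex.conj_ofReal]
    congr 2
    push_cast; ring
  rw [e1, h]
  calc _ ≤ ∫ y, ‖G y‖ * (D * ∫ y, ‖H y‖) := by
        apply norm_integral_le_of_norm_le (hG.norm.mul_const _)
        filter_upwards with y
        rw [norm_mul]
        gcongr
        exact e2 y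
    _ = _ := by rw [integral_mul_const]; ring
end fourierPart2

section fourierPart3
open FourierTransform SchwartzMap

lemma wt_temp {μ : ℝ} (hμ : 0 < μ) (p : ℝ) :
    Function.HasTemperateGrowth (fun w : ℝ => (wt μ p w : ℂ)) := by
  have h1 := Function.hasTemperateGrowth_one_add_norm_sq_rpow ℝ p
  have h2 : Function.HasTemperateGrowth (fun w : ℝ => √μ * (2 * π) * w) :=
    ((√μ * (2 * π)) • ContinuousLinearMap.id ℝ ℝ).hasTemperateGrowth
  have h3 := h1.comp h2
  have h4 := Complex.ofRealCLM.hasTemperateGrowth.comp h3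
  convert h4 using 1
  ext w
  simp only [Function.comp, wt]
  congr 3
  rw [Real.norm_eq_abs, sq_abs]
  simp only [mul_pow, Real.sq_sqrt hμ.le]
  ring

noncomputable def GG (μ p : ℝ) : 𝓢(ℝ, ℂ) →L[ℂ] 𝓢(ℝ, ℂ) :=
  SchwartzMap.fourierMultiplierCLM ℂ (fun w => (wt μ p w : ℂ))

lemma GG_four {μ : ℝ} (hμ : 0 < μ) (p : ℝ) (f : 𝓢(ℝ, ℂ)) (w : ℝ) :
    𝓕 (⇑(GG μ p f)) w = (wt μ p w : ℂ) * 𝓕 (⇑f) w := by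
  rw [← SchwartzMap.fourier_coe, ← SchwartzMap.fourier_coe]
  unfold GG
  rw [SchwartzMap.fourierMultiplierCLM_apply, fourier_fourierInv_eq,
    SchwartzMap.smulLeftCLM_apply_apply (wt_temp hμ p), smul_eq_mul]

lemma GG_coe {μ : ℝ} (hμ : 0 < μ) (p : ℝ) (f : 𝓢(ℝ, ℂ)) :
    fmult1 (fun ξ => (((1 + μ * ξ ^ 2) ^ p : ℝ) : ℂ)) (⇑f) = ⇑(GG μ p f) := by
  ext x
  rw [fmult1_eq]
  have : (fun w : ℝ => (((1 + μ * (2 * π * w) ^ 2) ^ p : ℝ) : ℂ) * 𝓕 (⇑f) w) = 𝓕 (⇑(GG μ p f)) := by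
    ext w; rw [GG_four hμ]; rfl
  rw [this, ← SchwartzMap.fourier_coe, ← SchwartzMap.fourierInv_coe, fourierInv_fourier_eq]

noncomputable def nn (μ p : ℝ) (f : 𝓢(ℝ, ℂ)) : ℝ := ∫ x, ‖GG μ p f x‖

lemma nn_nonneg (μ p : ℝ) (f : 𝓢(ℝ, ℂ)) : 0 ≤ nn μ p f := integral_nonneg fun _ => norm_nonneg _

lemma nn_cont (μ p : ℝ) : Continuous (nn μ p) := by
  have h : nn μ p = fun f => ‖(GG μ p f).toLp 1‖ := by
    ext f; rw [SchwartzMap.norm_toLp_one]; rfl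
  rw [h]
  exact (SchwartzMap.continuous_toLp.comp (GG μ p).continuous).norm

lemma nn_eLp (μ p : ℝ) (f : 𝓢(ℝ, ℂ)) : eLpNorm (⇑(GG μ p f)) 1 volume = ENNReal.ofReal (nn μ p f) := by
  rw [eLpNorm_one_eq_lintegral_enorm, nn, ofReal_integral_norm_eq_lintegral_enorm (GG μ p f).integrable]

/-- uniform decay of Fourier transforms -/
lemma four_decay {T : ℝ} {F : ℝ → 𝓢(ℝ, ℂ)} (hF : ContinuousOn F (Set.Icc 0 T)) :
    ∃ K : ℝ, 0 ≤ K ∧ ∀ s ∈ Set.Icc 0 T, ∀ w, ‖𝓕 (⇑(F s)) w‖ ≤ K * (1 + w ^ 2)⁻¹ := by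
  have hq : Continuous (fun s : 𝓢(ℝ, ℂ) => SchwartzMap.seminorm ℝ 0 0 s + SchwartzMap.seminorm ℝ 2 0 s) :=
    ((schwartz_withSeminorms ℝ ℝ ℂ).continuous_seminorm (0, 0)).add ((schwartz_withSeminorms ℝ ℝ ℂ).continuous_seminorm (2, 0))
  have hc : ContinuousOn (fun s => SchwartzMap.seminorm ℝ 0 0 (𝓕 (F s)) + SchwartzMap.seminorm ℝ 2 0 (𝓕 (F s))) (Set.Icc 0 T) :=
    hq.comp_continuousOn ((fourierCLM ℂ 𝓢(ℝ, ℂ)).continuous.comp_continuousOn hF)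
  obtain ⟨K, hK⟩ := isCompact_Icc.exists_bound_of_continuousOn hc
  refine ⟨max K 0, le_max_right _ _, fun s hs w => ?_⟩
  have h1 := SchwartzMap.norm_le_seminorm ℝ (𝓕 (F s)) w
  have h2 := SchwartzMap.norm_pow_mul_le_seminorm ℝ (𝓕 (F s)) 2 w
  have h3 := (le_abs_self _).trans (hK s hs)
  rw [← SchwartzMap.fourier_coe, ← div_eq_mul_inv, le_div_iff₀ (by positivity)]
  rw [Real.norm_eq_abs, sq_abs] at h2
  have := le_max_left K 0
  nlinarith

/-- joint continuity -/
lemma four_joint {T : ℝ} {F : ℝ → 𝓢(ℝ, ℂ)} (hF : ContinuousOn F (Set.Icc 0 T)) :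
    ContinuousOn (fun p : ℝ × ℝ => 𝓕 (⇑(F p.1)) p.2) (Set.Icc 0 T ×ˢ Set.univ) := by
  have hc : ContinuousOn (fun s => toBoundedContinuousFunctionCLM ℂ ℝ ℂ (𝓕 (F s))) (Set.Icc 0 T) :=
    (toBoundedContinuousFunctionCLM ℂ ℝ ℂ).continuous.comp_continuousOn ((fourierCLM ℂ 𝓢(ℝ, ℂ)).continuous.comp_continuousOn hF)
  have h2 : ContinuousOn (fun p : ℝ × ℝ => (toBoundedContinuousFunctionCLM ℂ ℝ ℂ (𝓕 (F p.1)), p.2)) (Set.Icc 0 T ×ˢ Set.univ) :=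
    (hc.comp continuousOn_fst (fun p hp => hp.1)).prodMk continuousOn_snd
  have h3 := (continuous_eval (F := BoundedContinuousFunction ℝ ℂ)).comp_continuousOn h2
  refine h3.congr fun p hp => ?_
  rw [← SchwartzMap.fourier_coe]; rfl
end fourierPart3

section fourierPart4
open FourierTransform SchwartzMap

lemma kk_bound {C ε μ : ℝ} (hC : 0 < C) (hε : 0 < ε) (hμ : 0 < μ) {t s : ℝ} (hts : t ≠ s) :
    ENNReal.ofReal (C * (|(t - s) / ε| * μ) ^ (-(1/3) : ℝ)) =
      ENNReal.ofReal (C * (ε / μ) ^ (1/3 : ℝ)) * kk t s := by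
  have h : 0 < |t - s| := abs_pos.2 (sub_ne_zero.2 hts)
  unfold kk
  rw [ENNReal.ofReal_rpow_of_pos h, ← ENNReal.ofReal_mul (by positivity)]
  congr 1
  rw [abs_div, abs_of_pos hε]
  have : |t - s| / ε * μ = |t - s| * (ε / μ)⁻¹ := by field_simp
  rw [this, Real.mul_rpow h.le (by positivity), Real.inv_rpow (by positivity), Real.rpow_neg (x := ε / μ) (by positivity), inv_inv]
  ring

lemma nn_contOn {μ p T : ℝ} {F : ℝ → 𝓢(ℝ, ℂ)} (hF : ContinuousOn F (Set.Icc 0 T)) :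
    ContinuousOn (fun s => ENNReal.ofReal (nn μ p (F s))) (Set.Icc 0 T) :=
  ENNReal.continuous_ofReal.comp_continuousOn ((nn_cont μ p).comp_continuousOn hF)

lemma nn_aem {μ p T : ℝ} {F : ℝ → 𝓢(ℝ, ℂ)} (hF : ContinuousOn F (Set.Icc 0 T)) :
    AEMeasurable (fun s => ENNReal.ofReal (nn μ p (F s))) (volume.restrict (Set.Ioo 0 T)) :=
  ((nn_contOn hF).mono Set.Ioo_subset_Icc_self).aemeasurable measurableSet_Ioo

lemma nn_bdd {μ p T : ℝ} {F : ℝ → 𝓢(ℝ, ℂ)} (hF : ContinuousOn F (Set.Icc 0 T)) :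
    ∃ M : ℝ≥0∞, M ≠ ⊤ ∧ ∀ s ∈ Set.Icc 0 T, ENNReal.ofReal (nn μ p (F s)) ≤ M := by
  obtain ⟨K, hK⟩ := isCompact_Icc.exists_bound_of_continuousOn ((nn_cont μ p).comp_continuousOn hF)
  exact ⟨ENNReal.ofReal K, ENNReal.ofReal_ne_top, fun s hs => ENNReal.ofReal_le_ofReal ((le_abs_self _).trans (hK s hs))⟩

lemma caseA : ∃ C : ℝ, 0 < C ∧ ∀ σ T μ ε : ℝ, |σ| = 1 → 0 < T → 0 < μ → 0 < ε →
    ∀ F : ℝ → 𝓢(ℝ, ℂ), ContinuousOn F (Set.Icc 0 T) →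
    (∫⁻ t in Set.Ioo 0 T, (eLpNorm (fun x => ∫ s in (0 : ℝ)..t,
        fmult1 (fun ξ => prop1 σ ((t - s) / ε) μ ξ) (⇑(F s)) x) ⊤ volume) ^ (6:ℝ)) ^ (1/6 : ℝ) ≤
      ENNReal.ofReal (C * (ε / μ) ^ (1/3 : ℝ)) *
        (∫⁻ s in Set.Ioo 0 T, ENNReal.ofReal (nn μ (5/6) (F s)) ^ (6/5:ℝ)) ^ (5/6:ℝ) := by
  obtain ⟨C, hC, h⟩ := disp2
  refine ⟨C * 10, by positivity, ?_⟩
  intro σ T μ ε hσ hT hμ hε F hF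
  obtain ⟨M, hM, hb⟩ := nn_bdd (μ := μ) (p := 5/6) hF
  have hls := hls1 T hT _ (nn_aem (μ := μ) (p := 5/6) hF) M hM (fun t ht => hb t (Set.Ioo_subset_Icc_self ht))
  set A := ENNReal.ofReal (C * (ε / μ) ^ (1/3 : ℝ)) with hA
  have pt : ∀ t s x, t ≠ s → ‖fmult1 (fun ξ => prop1 σ ((t - s) / ε) μ ξ) (⇑(F s)) x‖ₑ ≤
      A * (kk t s * ENNReal.ofReal (nn μ (5/6) (F s))) := by
    intro t s x hts
    have h1 := disp3 (bb_int hμ σ ((t - s) / ε)) (fun y => h σ ((t - s) / ε) μ y hσ (div_ne_zero (sub_ne_zero.2 hts) hε.ne') hμ)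
      (GG μ (5/6) (F s)).integrable x
    rw [fmult1_eq]
    have e : (fun w => prop1 σ ((t - s) / ε) μ (2 * π * w) * 𝓕 (⇑(F s)) w) = fun w => bb σ ((t - s) / ε) μ w * 𝓕 (⇑(GG μ (5/6) (F s))) w := by
      ext w
      have hw : (wt μ (-(5/6)) w : ℂ) * (wt μ (5/6) w : ℂ) = 1 := by
        rw [← Complex.ofReal_mul, wt_mul hμ]; simp [wt]
      rw [GG_four hμ, bb]
      linear_combination -(prop1 σ ((t - s) / ε) μ (2 * π * w) * 𝓕 (⇑(F s)) w) * hw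
    rw [e, ← ofReal_norm, ← mul_assoc, hA, ← kk_bound hC hε hμ hts, ← ENNReal.ofReal_mul (by positivity)]
    exact ENNReal.ofReal_le_ofReal h1
  have key : ∀ t ∈ Set.Ioo 0 T, eLpNorm (fun x => ∫ s in (0 : ℝ)..t,
        fmult1 (fun ξ => prop1 σ ((t - s) / ε) μ ξ) (⇑(F s)) x) ⊤ volume ≤
      A * ∫⁻ s in Set.Ioo 0 T, kk t s * ENNReal.ofReal (nn μ (5/6) (F s)) := by
    intro t ht
    rw [eLpNorm_exponent_top]
    apply eLpNormEssSup_le_of_ae_enorm_bound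
    filter_upwards with x
    rw [intervalIntegral.integral_of_le ht.1.le, integral_Ioc_eq_integral_Ioo]
    refine (enorm_integral_le_lintegral_enorm _).trans ?_
    rw [← lintegral_const_mul' _ _ ENNReal.ofReal_ne_top]
    calc _ ≤ ∫⁻ s in Set.Ioo 0 t, A * (kk t s * ENNReal.ofReal (nn μ (5/6) (F s))) := by
          apply setLIntegral_mono_ae' measurableSet_Ioo
          filter_upwards with s hs
          exact pt t s x hs.2.ne'
      _ ≤ _ := lintegral_mono_set (Set.Ioo_subset_Ioo_right ht.2.le)
  calc _ ≤ (∫⁻ t in Set.Ioo 0 T, (A * ∫⁻ s in Set.Ioo 0 T, kk t s * ENNReal.ofReal (nn μ (5/6) (F s))) ^ (6:ℝ)) ^ (1/6 : ℝ) := by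
        gcongr ?_ ^ _
        apply setLIntegral_mono_ae' measurableSet_Ioo
        filter_upwards with t ht
        gcongr
        exact key t ht
    _ = A * (∫⁻ t in Set.Ioo 0 T, (∫⁻ s in Set.Ioo 0 T, kk t s * ENNReal.ofReal (nn μ (5/6) (F s))) ^ (6:ℝ)) ^ (1/6 : ℝ) := by
        simp_rw [ENNReal.mul_rpow_of_nonneg _ _ (by norm_num : (0:ℝ) ≤ 6)]
        rw [lintegral_const_mul' _ _ (ENNReal.rpow_ne_top_of_nonneg (by norm_num) ENNReal.ofReal_ne_top),
          ENNReal.mul_rpow_of_nonneg _ _ (by norm_num), ← ENNReal.rpow_mul,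
          show (6:ℝ) * (1/6) = 1 by norm_num, ENNReal.rpow_one]
    _ ≤ A * (10 * (∫⁻ s in Set.Ioo 0 T, ENNReal.ofReal (nn μ (5/6) (F s)) ^ (6/5:ℝ)) ^ (5/6:ℝ)) := by gcongr
    _ = _ := by
        rw [hA, ← mul_assoc, show (10 : ℝ≥0∞) = ENNReal.ofReal 10 by simp, ← ENNReal.ofReal_mul (by positivity)]
        congr 2; ring
end fourierPart4

section fourierPart5
open FourierTransform SchwartzMap

/-- The Duhamel integrand on the Fourier side. -/
noncomputable def BB (σ ε μ t : ℝ) (F : ℝ → 𝓢(ℝ, ℂ)) (s w : ℝ) : ℂ :=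
  prop1 σ ((t - s) / ε) μ (2 * π * w) * 𝓕 (⇑(F s)) w

lemma BB_contOn {σ ε μ t : ℝ} (hμ : 0 < μ) {F : ℝ → 𝓢(ℝ, ℂ)} (hF : ContinuousOn F (Set.Icc 0 t)) :
    ContinuousOn (fun p : ℝ × ℝ => BB σ ε μ t F p.1 p.2) (Set.Icc 0 t ×ˢ Set.univ) := by
  unfold BB
  apply ContinuousOn.mul _ (four_joint hF)
  apply Continuous.continuousOn
  exact (prop1_cont hμ σ).comp (f := fun p : ℝ × ℝ => ((t - p.1) / ε, 2 * π * p.2)) (by fun_prop)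

lemma BB_aesm {σ ε μ t : ℝ} (hμ : 0 < μ) {F : ℝ → 𝓢(ℝ, ℂ)} (hF : ContinuousOn F (Set.Icc 0 t)) :
    AEStronglyMeasurable (fun p : ℝ × ℝ => BB σ ε μ t F p.1 p.2)
      ((volume.restrict (Set.Ioo 0 t)).prod volume) := by
  have h : (volume.restrict (Set.Ioo 0 t)).prod (volume : Measure ℝ) =
      (volume.prod volume).restrict (Set.Ioo 0 t ×ˢ Set.univ) := by
    rw [← Measure.prod_restrict, Measure.restrict_univ]
  rw [h]
  apply ContinuousOn.aestronglyMeasurable _ (measurableSet_Ioo.prod MeasurableSet.univ)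
  exact (BB_contOn hμ hF).mono (Set.prod_mono Set.Ioo_subset_Icc_self le_rfl)

lemma BB_norm (σ ε μ t : ℝ) (F : ℝ → 𝓢(ℝ, ℂ)) (s w : ℝ) :
    ‖BB σ ε μ t F s w‖ = ‖𝓕 (⇑(F s)) w‖ := by
  unfold BB; rw [norm_mul, norm_prop1, one_mul]

lemma ae_prod_fst {t : ℝ} {α : Type*} [MeasurableSpace α] (ν : Measure α) [SFinite ν] :
    ∀ᵐ p : ℝ × α ∂((volume.restrict (Set.Ioo 0 t)).prod ν), p.1 ∈ Set.Ioo 0 t :=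
  Measure.quasiMeasurePreserving_fst.ae (ae_restrict_mem measurableSet_Ioo)

lemma BB_int {σ ε μ t : ℝ} (hμ : 0 < μ) {F : ℝ → 𝓢(ℝ, ℂ)} (hF : ContinuousOn F (Set.Icc 0 t)) :
    Integrable (fun p : ℝ × ℝ => BB σ ε μ t F p.1 p.2)
      ((volume.restrict (Set.Ioo 0 t)).prod volume) := by
  obtain ⟨K, hK, hb⟩ := four_decay hF
  have h1 : Integrable (fun p : ℝ × ℝ => K * (1 + p.2 ^ 2)⁻¹) ((volume.restrict (Set.Ioo 0 t)).prod volume) :=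
    Integrable.mul_prod (f := fun _ => K) (integrable_const K) integrable_inv_one_add_sq
  apply h1.mono' (BB_aesm hμ hF)
  filter_upwards [ae_prod_fst (t := t) (volume : Measure ℝ)] with p hp
  rw [BB_norm]
  exact hb _ (Set.Ioo_subset_Icc_self hp) _

noncomputable def AA (σ ε μ t : ℝ) (F : ℝ → 𝓢(ℝ, ℂ)) (w : ℝ) : ℂ :=
  ∫ s in Set.Ioo 0 t, BB σ ε μ t F s w

lemma AA_int {σ ε μ t : ℝ} (hμ : 0 < μ) {F : ℝ → 𝓢(ℝ, ℂ)} (hF : ContinuousOn F (Set.Icc 0 t)) :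
    Integrable (AA σ ε μ t F) := (BB_int hμ hF).integral_prod_right

lemma AA_mem {σ ε μ t : ℝ} (hμ : 0 < μ) {F : ℝ → 𝓢(ℝ, ℂ)} (hF : ContinuousOn F (Set.Icc 0 t)) :
    MemLp (AA σ ε μ t F) 2 := by
  obtain ⟨K, hK, hb⟩ := four_decay hF
  have h1 : Integrable (AA σ ε μ t F) := AA_int hμ hF
  rw [memLp_two_iff_integrable_sq_norm h1.1]
  apply (h1.norm.const_mul (K * volume.real (Set.Ioo 0 t))).mono' (h1.1.norm.pow 2)
  filter_upwards with w
  rw [Pi.pow_apply, Real.norm_eq_abs, abs_of_nonneg (by positivity), sq]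
  gcongr
  unfold AA
  apply norm_setIntegral_le_of_norm_le_const (by simp)
  intro s hs
  rw [BB_norm]
  refine (hb s (Set.Ioo_subset_Icc_self hs) w).trans ?_
  have : (1 + w ^ 2)⁻¹ ≤ 1 := inv_le_one_of_one_le₀ (by nlinarith [sq_nonneg w])
  nlinarith

lemma u_eq {σ ε μ t : ℝ} (hμ : 0 < μ) (ht : 0 < t) {F : ℝ → 𝓢(ℝ, ℂ)} (hF : ContinuousOn F (Set.Icc 0 t)) :
    (fun x => ∫ s in (0 : ℝ)..t, fmult1 (fun ξ => prop1 σ ((t - s) / ε) μ ξ) (⇑(F s)) x) =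
      𝓕⁻ (AA σ ε μ t F) := by
  ext x
  rw [intervalIntegral.integral_of_le ht.le, integral_Ioc_eq_integral_Ioo, finv_eq]
  simp_rw [fmult1_eq, finv_eq]
  rw [integral_integral_swap]
  · congr 1
    ext w
    unfold AA
    rw [← integral_const_mul]
    rfl
  · have h : Integrable (fun p : ℝ × ℝ => cexp (I * ((2 * π * x * p.2 : ℝ) : ℂ)) * BB σ ε μ t F p.1 p.2)
      ((volume.restrict (Set.Ioo 0 t)).prod volume) := by
      apply (BB_int hμ hF).bdd_mul (c := 1)
      · exact Continuous.aestronglyMeasurable (by fun_prop)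
      · filter_upwards with p; rw [norm_cexp_I]
    exact h

lemma BB_bil {σ ε μ t : ℝ} (hμ : 0 < μ) (F : ℝ → 𝓢(ℝ, ℂ)) (s s' w : ℝ) :
    BB σ ε μ t F s w * starRingEnd ℂ (BB σ ε μ t F s' w) =
      bb σ ((s' - s) / ε) μ w * (𝓕 (⇑(GG μ (5/12) (F s))) w * starRingEnd ℂ (𝓕 (⇑(GG μ (5/12) (F s'))) w)) := by
  have hw : (wt μ (-(5/6)) w : ℂ) * ((wt μ (5/12) w : ℂ) * (wt μ (5/12) w : ℂ)) = 1 := by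
    rw [← Complex.ofReal_mul, ← Complex.ofReal_mul, wt_mul hμ, wt_mul hμ]
    norm_num [wt]
  have hp : prop1 σ ((t - s) / ε) μ (2 * π * w) * starRingEnd ℂ (prop1 σ ((t - s') / ε) μ (2 * π * w)) =
      prop1 σ ((s' - s) / ε) μ (2 * π * w) := by
    unfold prop1
    rw [← Complex.exp_conj, map_mul, Complex.conj_I, Complex.conj_ofReal, ← Complex.exp_add]
    congr 1
    push_cast; ring
  rw [GG_four hμ, GG_four hμ, bb, BB, BB, ← hp, map_mul, map_mul, Complex.conj_ofReal]
  linear_combination -(prop1 σ ((t - s) / ε) μ (2 * π * w) * starRingEnd ℂ (prop1 σ ((t - s') / ε) μ (2 * π * w)) * 𝓕 (⇑(F s)) w * starRingEnd ℂ (𝓕 (⇑(F s')) w)) * hw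

lemma BB2_int {σ ε μ t : ℝ} (hμ : 0 < μ) {F : ℝ → 𝓢(ℝ, ℂ)} (hF : ContinuousOn F (Set.Icc 0 t)) :
    Integrable (fun p : ℝ × (ℝ × ℝ) => BB σ ε μ t F p.2.1 p.1 * starRingEnd ℂ (BB σ ε μ t F p.2.2 p.1))
      (volume.prod ((volume.restrict (Set.Ioo 0 t)).prod (volume.restrict (Set.Ioo 0 t)))) := by
  obtain ⟨K, hK, hb⟩ := four_decay hF
  have h1 : Integrable (fun p : ℝ × (ℝ × ℝ) => (1 + p.1 ^ 2)⁻¹ * (K * K))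
      (volume.prod ((volume.restrict (Set.Ioo 0 t)).prod (volume.restrict (Set.Ioo 0 t)))) :=
    Integrable.mul_prod (g := fun _ : ℝ × ℝ => K * K) integrable_inv_one_add_sq (integrable_const _)
  have hm : (volume.prod ((volume.restrict (Set.Ioo 0 t)).prod (volume.restrict (Set.Ioo 0 t))) : Measure (ℝ × (ℝ × ℝ))) =
      (volume.prod (volume.prod volume)).restrict (Set.univ ×ˢ (Set.Ioo 0 t ×ˢ Set.Ioo 0 t)) := by
    rw [← Measure.prod_restrict, Measure.restrict_univ, ← Measure.prod_restrict]
  have hms : MeasurableSet ((Set.univ : Set ℝ) ×ˢ (Set.Ioo 0 t ×ˢ Set.Ioo 0 t)) :=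
    MeasurableSet.univ.prod (measurableSet_Ioo.prod measurableSet_Ioo)
  have hc := BB_contOn (σ := σ) (ε := ε) hμ hF
  have c1 : ContinuousOn (fun p : ℝ × (ℝ × ℝ) => BB σ ε μ t F p.2.1 p.1) ((Set.univ : Set ℝ) ×ˢ (Set.Ioo 0 t ×ˢ Set.Ioo 0 t)) :=
    hc.comp (f := fun p : ℝ × (ℝ × ℝ) => (p.2.1, p.1)) (by fun_prop)
      (fun p hp => ⟨Set.Ioo_subset_Icc_self hp.2.1, Set.mem_univ _⟩)
  have c2 : ContinuousOn (fun p : ℝ × (ℝ × ℝ) => BB σ ε μ t F p.2.2 p.1) ((Set.univ : Set ℝ) ×ˢ (Set.Ioo 0 t ×ˢ Set.Ioo 0 t)) :=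
    hc.comp (f := fun p : ℝ × (ℝ × ℝ) => (p.2.2, p.1)) (by fun_prop)
      (fun p hp => ⟨Set.Ioo_subset_Icc_self hp.2.2, Set.mem_univ _⟩)
  rw [hm] at h1 ⊢
  apply h1.mono' ((c1.mul (Complex.continuous_conj.comp_continuousOn c2)).aestronglyMeasurable hms)
  filter_upwards [ae_restrict_mem hms] with p hp
  have hp1 := hp.2.1
  have hp2 := hp.2.2
  simp only [Pi.mul_apply, Function.comp]
  rw [norm_mul, Complex.norm_conj, BB_norm, BB_norm]
  have b1 := hb _ (Set.Ioo_subset_Icc_self hp1) p.1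
  have b2 := hb _ (Set.Ioo_subset_Icc_self hp2) p.1
  have : (1 + p.1 ^ 2)⁻¹ ≤ 1 := inv_le_one_of_one_le₀ (by nlinarith [sq_nonneg p.1])
  have h0 : 0 ≤ (1 + p.1 ^ 2)⁻¹ := by positivity
  calc _ ≤ (K * (1 + p.1 ^ 2)⁻¹) * (K * 1) := by gcongr; exact b2.trans (by gcongr)
    _ = _ := by ring
end fourierPart5

section fourierPart6
open FourierTransform SchwartzMap

lemma AA_sq {σ ε μ t : ℝ} (hμ : 0 < μ) {F : ℝ → 𝓢(ℝ, ℂ)} (hF : ContinuousOn F (Set.Icc 0 t)) :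
    eLpNorm (AA σ ε μ t F) 2 = ‖∫ p : ℝ × ℝ, (∫ w, BB σ ε μ t F p.1 w * starRingEnd ℂ (BB σ ε μ t F p.2 w))
      ∂((volume.restrict (Set.Ioo 0 t)).prod (volume.restrict (Set.Ioo 0 t)))‖ₑ ^ (1/2 : ℝ) := by
  rw [(AA_mem hμ hF).eLpNorm_eq_integral_rpow_norm (by norm_num) (by norm_num)]
  have h1 : ∫ w, (‖AA σ ε μ t F w‖ ^ (2:ℝ≥0∞).toReal) = ∫ w, ‖AA σ ε μ t F w‖ ^ 2 := by
    congr 1; ext w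
    norm_num
  rw [h1]
  have h2 : ((∫ w, ‖AA σ ε μ t F w‖ ^ 2 : ℝ) : ℂ) = ∫ p : ℝ × ℝ, (∫ w, BB σ ε μ t F p.1 w * starRingEnd ℂ (BB σ ε μ t F p.2 w))
      ∂((volume.restrict (Set.Ioo 0 t)).prod (volume.restrict (Set.Ioo 0 t))) := by
    rw [← integral_complex_ofReal]
    have := integral_integral_swap (f := fun w (p : ℝ × ℝ) => BB σ ε μ t F p.1 w * starRingEnd ℂ (BB σ ε μ t F p.2 w)) (BB2_int (σ := σ) (ε := ε) hμ hF)
    rw [← this]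
    congr 1
    ext w
    rw [integral_prod_mul (fun s => BB σ ε μ t F s w) (fun s => starRingEnd ℂ (BB σ ε μ t F s w)), integral_conj]
    push_cast
    exact (Complex.mul_conj' _).symm
  rw [← h2, ← ofReal_norm, Complex.norm_real, Real.norm_eq_abs, abs_of_nonneg (integral_nonneg fun w => by positivity),
    ENNReal.ofReal_rpow_of_nonneg (integral_nonneg fun w => by positivity) (by norm_num)]
  norm_num

lemma caseB : ∃ C : ℝ, 0 < C ∧ ∀ σ T μ ε : ℝ, |σ| = 1 → 0 < T → 0 < μ → 0 < ε →
    ∀ F : ℝ → 𝓢(ℝ, ℂ), ContinuousOn F (Set.Icc 0 T) → ∀ t ∈ Set.Ioo 0 T,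
    eLpNorm (fun x => ∫ s in (0 : ℝ)..t,
        fmult1 (fun ξ => prop1 σ ((t - s) / ε) μ ξ) (⇑(F s)) x) 2 volume ≤
      ENNReal.ofReal (C * (ε / μ) ^ (1/6 : ℝ)) *
        (∫⁻ s in Set.Ioo 0 T, ENNReal.ofReal (nn μ (5/12) (F s)) ^ (6/5:ℝ)) ^ (5/6:ℝ) := by
  obtain ⟨C, hC, h⟩ := disp2
  refine ⟨(C * 10) ^ (1/2 : ℝ), by positivity, ?_⟩
  intro σ T μ ε hσ hT hμ hε F hF' t ht
  have hF : ContinuousOn F (Set.Icc 0 t) := hF'.mono (Set.Icc_subset_Icc_right ht.2.le)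
  rw [u_eq hμ ht.1 hF, planch (AA_int hμ hF) (AA_mem hμ hF), AA_sq hμ hF]
  set A := ENNReal.ofReal (C * (ε / μ) ^ (1/3 : ℝ)) with hA
  set g : ℝ → ℝ≥0∞ := fun s => ENNReal.ofReal (nn μ (5/12) (F s)) with hg
  set N := (∫⁻ s in Set.Ioo 0 t, g s ^ (6/5:ℝ)) ^ (5/6:ℝ) with hN
  have gm : AEMeasurable g (volume.restrict (Set.Ioo 0 t)) := nn_aem hF
  obtain ⟨M, hM, hb⟩ := nn_bdd (μ := μ) (p := 5/12) hF
  have gfin : ∫⁻ s in Set.Ioo 0 t, g s ^ (6/5:ℝ) ≠ ⊤ := by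
    apply ne_of_lt
    calc _ ≤ ∫⁻ s in Set.Ioo 0 t, M ^ (6/5:ℝ) := by
          apply setLIntegral_mono_ae' measurableSet_Ioo
          filter_upwards with s hs
          gcongr
          exact hb s (Set.Ioo_subset_Icc_self hs)
      _ < ⊤ := by
          rw [setLIntegral_const]
          exact ENNReal.mul_lt_top (ENNReal.rpow_lt_top_of_nonneg (by norm_num) hM) (by simp)
  have pt : ∀ s s', s' ≠ s → ‖∫ w, BB σ ε μ t F s w * starRingEnd ℂ (BB σ ε μ t F s' w)‖ₑ ≤
      A * (kk s' s * (g s * g s')) := by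
    intro s s' hs
    simp_rw [BB_bil hμ]
    have h1 := disp4 (bb_int hμ σ ((s' - s) / ε)) (D := C * (|(s' - s) / ε| * μ) ^ (-(1/3) : ℝ)) (fun y => by
        simp_rw [bb_conj]
        rw [← abs_neg]
        exact h σ (-((s' - s) / ε)) μ y hσ (neg_ne_zero.2 (div_ne_zero (sub_ne_zero.2 hs) hε.ne')) hμ)
      (GG μ (5/12) (F s)).integrable (GG μ (5/12) (F s')).integrable
    rw [← ofReal_norm, ← mul_assoc, hA, ← kk_bound hC hε hμ hs, hg]
    simp only []
    rw [← ENNReal.ofReal_mul (nn_nonneg _ _ _), ← ENNReal.ofReal_mul (by positivity)]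
    exact ENNReal.ofReal_le_ofReal h1
  have hmeas : AEMeasurable (fun p : ℝ × ℝ => A * (kk p.2 p.1 * (g p.1 * g p.2)))
      ((volume.restrict (Set.Ioo 0 t)).prod (volume.restrict (Set.Ioo 0 t))) := by
    apply AEMeasurable.const_mul
    apply AEMeasurable.mul
    · exact (kk_meas.comp measurable_swap).aemeasurable
    · exact gm.comp_fst.mul gm.comp_snd
  have main : ‖∫ p : ℝ × ℝ, (∫ w, BB σ ε μ t F p.1 w * starRingEnd ℂ (BB σ ε μ t F p.2 w))
      ∂((volume.restrict (Set.Ioo 0 t)).prod (volume.restrict (Set.Ioo 0 t)))‖ₑ ≤ A * (10 * (N * N)) := by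
    calc _ ≤ ∫⁻ p : ℝ × ℝ, ‖∫ w, BB σ ε μ t F p.1 w * starRingEnd ℂ (BB σ ε μ t F p.2 w)‖ₑ
            ∂((volume.restrict (Set.Ioo 0 t)).prod (volume.restrict (Set.Ioo 0 t))) := enorm_integral_le_lintegral_enorm _
      _ ≤ ∫⁻ p : ℝ × ℝ, A * (kk p.2 p.1 * (g p.1 * g p.2))
            ∂((volume.restrict (Set.Ioo 0 t)).prod (volume.restrict (Set.Ioo 0 t))) := by
          apply lintegral_mono_ae
          have hd : ∀ᵐ p : ℝ × ℝ ∂((volume.restrict (Set.Ioo 0 t)).prod (volume.restrict (Set.Ioo 0 t))), p.2 ≠ p.1 := by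
            refine (Measure.ae_prod_iff_ae_ae (p := fun p : ℝ × ℝ => p.2 ≠ p.1) (measurableSet_eq_fun measurable_snd measurable_fst).compl).2 ?_
            filter_upwards with s
            exact Measure.ae_ne _ _
          filter_upwards [hd] with p hp
          exact pt _ _ hp
      _ = A * ∫⁻ s in Set.Ioo 0 t, ∫⁻ s' in Set.Ioo 0 t, kk s' s * (g s * g s') := by
          rw [lintegral_prod _ hmeas, ← lintegral_const_mul' _ _ ENNReal.ofReal_ne_top]
          congr 1; ext s
          rw [lintegral_const_mul' _ _ ENNReal.ofReal_ne_top]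
      _ ≤ A * (10 * (N * N)) := by
          gcongr
          exact hls2 t g g gm gm gfin gfin
  calc _ ≤ (A * (10 * (N * N))) ^ (1/2 : ℝ) := by gcongr
    _ = ENNReal.ofReal ((C * 10) ^ (1/2 : ℝ) * (ε / μ) ^ (1/6 : ℝ)) * N := by
        have e : A * (10 * (N * N)) = ENNReal.ofReal ((C * 10) * (ε / μ) ^ (1/3 : ℝ)) * N ^ (2:ℝ) := by
          rw [hA, ← mul_assoc, show (10 : ℝ≥0∞) = ENNReal.ofReal 10 by simp, ← ENNReal.ofReal_mul (by positivity), ENNReal.rpow_two, sq]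
          congr 2; ring
        rw [e, ENNReal.mul_rpow_of_nonneg _ _ (by norm_num), ← ENNReal.rpow_mul, ENNReal.ofReal_rpow_of_nonneg (by positivity) (by norm_num),
          Real.mul_rpow (by positivity) (by positivity), ← Real.rpow_mul (by positivity)]
        norm_num
    _ ≤ _ := by
        refine mul_le_mul_right ?_ _
        exact ENNReal.rpow_le_rpow (lintegral_mono_set (Set.Ioo_subset_Ioo_right ht.2.le)) (by norm_num)
end fourierPart6

/-- Retarded Strichartz estimate (4.11): for `(q̃,r̃) ∈ {(6,∞),(∞,2)}`, the Duhamel term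
`u(t) = ∫₀ᵗ e^{±((t−s)/ε)∂ₓ/√(1+μD²/3)} F(s) ds` satisfies
`‖u‖_{L^{q̃}(0,T;L^{r̃})} ≤ C (ε/μ)^{(1/3)(1−1/r̃)} ‖(1+μD²)^{(5/6)(1−1/r̃)} F‖_{L^{6/5}(0,T;L¹)}`. -/
theorem stmt14 (σ : ℝ) (hσ : σ = 1 ∨ σ = -1) :
    ∃ C : ℝ, 0 < C ∧
      ∀ qr ∈ ({((6 : ℝ≥0∞), (⊤ : ℝ≥0∞)), ((⊤ : ℝ≥0∞), (2 : ℝ≥0∞))} : Set (ℝ≥0∞ × ℝ≥0∞)),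
        ∀ T : ℝ, 0 < T → ∀ μ ∈ Set.Ioc (0 : ℝ) 1, ∀ ε ∈ Set.Ioc (0 : ℝ) 1,
          ∀ F : ℝ → SchwartzMap ℝ ℂ, ContinuousOn F (Set.Icc 0 T) →
            timeLp qr.1 T
                (fun t => eLpNorm
                  (fun x => ∫ s in (0 : ℝ)..t,
                    fmult1 (fun ξ => prop1 σ ((t - s) / ε) μ ξ) (⇑(F s)) x) qr.2 volume) ≤
              ENNReal.ofReal (C * (ε / μ) ^ ((1 / 3) * (1 - (qr.2⁻¹).toReal))) *
                timeLp (6 / 5 : ℝ≥0∞) T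
                  (fun s => eLpNorm
                    (fmult1 (fun ξ =>
                      (((1 + μ * ξ ^ 2) ^ ((5 / 6) * (1 - (qr.2⁻¹).toReal)) : ℝ) : ℂ))
                      (⇑(F s))) 1 volume) := by
  obtain ⟨C1, hC1, h1⟩ := caseA
  obtain ⟨C2, hC2, h2⟩ := caseB
  have hs : |σ| = 1 := by rcases hσ with rfl | rfl <;> simp
  refine ⟨C1 + C2, by positivity, ?_⟩
  intro qr hqr T hT μ hμ ε hε F hF
  have h65 : (6 / 5 : ℝ≥0∞) ≠ ⊤ := ENNReal.div_ne_top (by norm_num) (by norm_num)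
  have h65r : (6 / 5 : ℝ≥0∞).toReal = 6 / 5 := by rw [ENNReal.toReal_div]; norm_num
  have hrp : ∀ p : ℝ, 0 ≤ (ε / μ) ^ p := fun p => by have := hε.1; have := hμ.1; positivity
  have hrhs : ∀ p : ℝ, timeLp (6 / 5 : ℝ≥0∞) T
      (fun s => eLpNorm (fmult1 (fun ξ => (((1 + μ * ξ ^ 2) ^ p : ℝ) : ℂ)) (⇑(F s))) 1 volume) =
      (∫⁻ s in Set.Ioo 0 T, ENNReal.ofReal (nn μ p (F s)) ^ (6/5:ℝ)) ^ (5/6:ℝ) := by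
    intro p
    unfold timeLp
    rw [if_neg h65, h65r]
    simp_rw [GG_coe hμ.1, nn_eLp]
    norm_num
  rw [hrhs]
  rcases hqr with rfl | rfl
  · have e := h1 σ T μ ε hs hT hμ.1 hε.1 F hF
    have e1 : (1 / 3 : ℝ) * (1 - ((⊤ : ℝ≥0∞)⁻¹).toReal) = 1 / 3 := by simp
    have e2 : (5 / 6 : ℝ) * (1 - ((⊤ : ℝ≥0∞)⁻¹).toReal) = 5 / 6 := by simp
    simp only [e1, e2]
    unfold timeLp
    rw [if_neg (by norm_num), show (6 : ℝ≥0∞).toReal = 6 by norm_num]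
    refine e.trans ?_
    gcongr
    · exact hrp _
    · linarith
  · have e1 : (1 / 3 : ℝ) * (1 - ((2 : ℝ≥0∞)⁻¹).toReal) = 1 / 6 := by rw [ENNReal.toReal_inv]; norm_num
    have e2 : (5 / 6 : ℝ) * (1 - ((2 : ℝ≥0∞)⁻¹).toReal) = 5 / 12 := by rw [ENNReal.toReal_inv]; norm_num
    simp only [e1, e2]
    unfold timeLp
    rw [if_pos rfl]
    refine essSup_le_of_ae_le _ ?_
    filter_upwards [ae_restrict_mem measurableSet_Ioo] with t ht
    refine (h2 σ T μ ε hs hT hμ.1 hε.1 F hF t ht).trans ?_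
    gcongr
    · exact hrp _
    · linarith
end
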